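/- Let R be a commutative Noetherian ring, a an ideal of R, and M a finitely generated R-module of finite dimension d. Let 𝔐 = ∩_{m ∈ Supp_R H^d_a(M)} m (with 𝔐 = R if this support is empty) and let T denote the 𝔐-adic completion of R. Then the following are equivalent: (i) H^d_a(M) = 0; (ii) H^d_𝔐(M) = Σ_{n∈ℕ} ⟨𝔐⟩(0 :_{H^d_𝔐(M)} aⁿ); (iii) for every l ∈ ℕ there exists n = n(l) ∈ ℕ such that (0 :_{H^d_𝔐(M)} a^l) ⊆ ⟨𝔐⟩(0 :_{H^d_𝔐(M)} aⁿ); (iv) dim T/(aT + p) > 0 for all p ∈ Assh_T(M ⊗_R T); (v) cd_R(a, R/p) < d for all p ∈ Assh_R M. -/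

import Mathlib

/- Common definitions: local cohomology modules, cohomological dimension, module dimension,
secondary representations and attached primes. -/

open CategoryTheory TensorProduct

/-- The `i`-th local cohomology module `H^i_a(M)`, as a type with its `R`-module structure. -/
noncomputable def TopLC (R : Type) [CommRing R] (a : Ideal R) (i : ℕ)
    (M : Type) [AddCommGroup M] [Module R M] : Type :=
  ((localCohomology a i).obj (ModuleCat.of R M))

noncomputable instance (R : Type) [CommRing R] (a : Ideal R) (i : ℕ)
    (M : Type) [AddCommGroup M] [Module R M] : AddCommGroup (TopLC R a i M) :=
  inferInstanceAs (AddCommGroup ((localCohomology a i).obj (ModuleCat.of R M)))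

noncomputable instance (R : Type) [CommRing R] (a : Ideal R) (i : ℕ)
    (M : Type) [AddCommGroup M] [Module R M] : Module R (TopLC R a i M) :=
  inferInstanceAs (Module R ((localCohomology a i).obj (ModuleCat.of R M)))

/-- The cohomological dimension `cd_R(a, M) = sup { i | H^i_a(M) ≠ 0 }`,
with value `⊥` if all local cohomology modules vanish. -/
noncomputable def cohDim (R : Type) [CommRing R] (a : Ideal R)
    (M : Type) [AddCommGroup M] [Module R M] : WithBot ℕ∞ :=
  sSup {n : WithBot ℕ∞ | ∃ i : ℕ, n = (i : ℕ) ∧ Nontrivial (TopLC R a i M)}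

/-- The (Krull) dimension of a module, i.e. the Krull dimension of its support. -/
noncomputable def moduleDim (R : Type) [CommRing R]
    (M : Type) [AddCommGroup M] [Module R M] : WithBot ℕ∞ :=
  Order.krullDim (Module.support R M)

/-- `Assh_R M`: the associated primes `p` of `M` with `dim R/p = dim M`. -/
noncomputable def Assh (R : Type) [CommRing R]
    (M : Type) [AddCommGroup M] [Module R M] : Set (Ideal R) :=
  { p | p ∈ associatedPrimes R M ∧ ringKrullDim (R ⧸ p) = moduleDim R M }

/-- A submodule `S` is secondary if `S ≠ 0` and every `r : R` acts on `S` either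
surjectively or nilpotently. -/
def IsSecondarySub (R : Type) [CommRing R] {M : Type} [AddCommGroup M] [Module R M]
    (S : Submodule R M) : Prop :=
  S ≠ ⊥ ∧ ∀ r : R, (∀ m ∈ S, ∃ s ∈ S, r • s = m) ∨ (∃ n : ℕ, ∀ m ∈ S, r ^ n • m = 0)

/-- A module is representable if it is the (finite) sum of secondary submodules. -/
def IsRepresentable (R : Type) [CommRing R] (M : Type) [AddCommGroup M] [Module R M] : Prop :=
  ∃ (n : ℕ) (S : Fin n → Submodule R M), (∀ i, IsSecondarySub R (S i)) ∧ (⨆ i, S i) = ⊤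

/-- A minimal secondary representation: secondary submodules summing to the whole module,
with pairwise distinct attached primes, none contained in the sum of the others. -/
def IsMinimalRep (R : Type) [CommRing R] {M : Type} [AddCommGroup M] [Module R M]
    {n : ℕ} (S : Fin n → Submodule R M) : Prop :=
  (∀ i, IsSecondarySub R (S i)) ∧ (⨆ i, S i) = ⊤ ∧
    (Function.Injective fun i => (S i).annihilator.radical) ∧
    ∀ j, ¬ (S j ≤ ⨆ i ∈ ({j}ᶜ : Set (Fin n)), S i)

/-- The attached primes of a module: the radicals of the annihilators of the terms of a
minimal secondary representation. -/
def AttachedPrimes (R : Type) [CommRing R] (M : Type) [AddCommGroup M] [Module R M] :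
    Set (Ideal R) :=
  { p | ∃ (n : ℕ) (S : Fin n → Submodule R M), IsMinimalRep R S ∧
      ∃ i, p = (S i).annihilator.radical }

/-- `stab b N = ⟨b⟩N = ⋂ₙ bⁿN`. -/
def stab {R M : Type} [CommRing R] [AddCommGroup M] [Module R M]
    (b : Ideal R) (N : Submodule R M) : Submodule R M :=
  ⨅ n : ℕ, b ^ n • N

namespace LH
open Limits Opposite

noncomputable section

variable {R : Type} [CommRing R]

/-- The chain complex (in the opposite category) computing `Ext` from a projective resolution. -/
abbrev homCx {A : ModuleCat.{0} R} (P : ProjectiveResolution A) (Y : ModuleCat.{0} R) :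
    ChainComplex (ModuleCat.{0} R)ᵒᵖ ℕ :=
  ((((linearYoneda R (ModuleCat.{0} R)).obj Y).rightOp).mapHomologicalComplex
    (ComplexShape.down ℕ)).obj P.complex

variable {A : ModuleCat.{0} R} (P : ProjectiveResolution A) (Y : ModuleCat.{0} R) (n : ℕ)

/-- The underlying cochain of a cocycle. -/
def cocycleVal : (homCx P Y).opcycles n |>.unop →ₗ[R] (P.complex.X n ⟶ Y) :=
  ((homCx P Y).pOpcycles n).unop.hom

/-- The class of a cocycle. -/
def cocycleCls : (homCx P Y).opcycles n |>.unop →ₗ[R] ((homCx P Y).homology n).unop :=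
  ((homCx P Y).homologyι n).unop.hom

lemma cocycleVal_d (c) : P.complex.d (n+1) n ≫ cocycleVal P Y n c = 0 := by
  have h := (homCx P Y).d_pOpcycles (n+1) n
  have h2 := congrArg Quiver.Hom.unop h
  have h3 := congrArg (fun f => (ModuleCat.Hom.hom f) c) h2
  exact h3

lemma cocycleVal_injective : Function.Injective (cocycleVal P Y n) := by
  have : Mono ((homCx P Y).pOpcycles n).unop := inferInstance
  exact (ModuleCat.mono_iff_injective _).1 this

lemma cocycleCls_surjective : Function.Surjective (cocycleCls P Y n) := by
  have : Epi ((homCx P Y).homologyι n).unop := inferInstance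
  exact (ModuleCat.epi_iff_surjective _).1 this

lemma exists_cocycle (f : P.complex.X n ⟶ Y) (hf : P.complex.d (n+1) n ≫ f = 0) :
    ∃ c, cocycleVal P Y n c = f := by
  let S := ShortComplex.mk _ _ ((homCx P Y).d_pOpcycles (n+1) n)
  have hS : S.Exact := S.exact_of_g_is_cokernel ((homCx P Y).opcyclesIsCokernel (n+1) n (by simp))
  have h2 := (ShortComplex.moduleCat_exact_iff _).1 hS.unop
  exact h2 f hf

lemma cls_eq_zero_iff (m : ℕ) (hm : m + 1 = n) (c) : cocycleCls P Y n c = 0 ↔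
    ∃ g : P.complex.X m ⟶ Y, P.complex.d n m ≫ g = cocycleVal P Y n c := by
  subst hm
  let S := ShortComplex.mk _ _ ((homCx P Y).homologyι_comp_fromOpcycles (m+1) m)
  have hS : S.Exact := S.exact_of_f_is_kernel ((homCx P Y).homologyIsKernel (m+1) m (by simp))
  have h2 := (ShortComplex.moduleCat_exact_iff _).1 hS.unop
  have key : ∀ g, (((homCx P Y).pOpcycles (m+1)).unop.hom)
      (((homCx P Y).fromOpcycles (m+1) m).unop.hom g) = P.complex.d (m+1) m ≫ g := by
    intro g
    have h := (homCx P Y).p_fromOpcycles (m+1) m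
    have h2 := congrArg Quiver.Hom.unop h
    exact congrArg (fun f => (ModuleCat.Hom.hom f) g) h2
  constructor
  · intro h
    obtain ⟨g, hg⟩ := h2 c h
    exact ⟨g, (key g).symm.trans (congrArg _ hg)⟩
  · rintro ⟨g, hg⟩
    have := cocycleVal_injective P Y (m+1) ((key g).trans hg)
    rw [← this]
    have h := (homCx P Y).homologyι_comp_fromOpcycles (m+1) m
    have h2 := congrArg Quiver.Hom.unop h
    exact congrArg (fun f => (ModuleCat.Hom.hom f) g) h2

lemma cls_zero_injective : Function.Injective (cocycleCls P Y 0) := by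
  have : IsIso ((homCx P Y).homologyι 0) := inferInstance
  have : Mono ((homCx P Y).homologyι 0).unop := inferInstance
  exact (ModuleCat.mono_iff_injective _).1 this

/-- The class of a cocycle in the `Ext` group defined through the derived category. -/
def cocycleExt : (homCx P Y).opcycles n |>.unop →ₗ[R] Abelian.Ext A Y n where
  toFun c := P.extMk (cocycleVal P Y n c) (n+1) rfl (cocycleVal_d P Y n c)
  map_add' c c' := by
    rw [P.add_extMk]
    congr 1
    exact map_add _ _ _
  map_smul' r c := by
    rw [RingHom.id_apply, Abelian.Ext.smul_eq_comp_mk₀, P.extMk_comp_mk₀]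
    congr 1
    rw [map_smul]
    simp

lemma cocycleExt_apply (c) : cocycleExt P Y n c =
    P.extMk (cocycleVal P Y n c) (n+1) rfl (cocycleVal_d P Y n c) := rfl

lemma cocycleExt_surjective : Function.Surjective (cocycleExt P Y n) := by
  intro α
  obtain ⟨f, hf, rfl⟩ := P.extMk_surjective α (n+1) rfl
  obtain ⟨c, rfl⟩ := exists_cocycle P Y n f hf
  exact ⟨c, rfl⟩

open CochainComplex HomComplex in
lemma extMk_zero_injective (f : P.complex.X 0 ⟶ Y) (hf : P.complex.d 1 0 ≫ f = 0)
    (h : P.extMk f 1 rfl hf = 0) : f = 0 := by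
  rw [← P.extEquivCohomologyClass.apply_eq_iff_eq,
    P.extEquivCohomologyClass_extMk, P.extEquivCohomologyClass_zero,
    CohomologyClass.mk_eq_zero_iff, Cocycle.toSingleMk_mem_coboundaries_iff _ _ _ _ _ 1
      (by simp)] at h
  obtain ⟨g, hg⟩ := h
  have hz : Limits.IsZero (P.cochainComplex.X 1) :=
    P.cochainComplex.isZero_of_isStrictlyLE 0 1 (by simp)
  rw [hz.eq_of_src g 0, Limits.comp_zero] at hg
  rw [← cancel_epi (P.cochainComplexXIso (-0) 0 rfl).hom, Limits.comp_zero]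
  exact hg.symm

lemma cls_ext_ker : LinearMap.ker (cocycleCls P Y n) = LinearMap.ker (cocycleExt P Y n) := by
  ext c
  rw [LinearMap.mem_ker, LinearMap.mem_ker]
  cases n with
  | zero =>
    constructor
    · intro h
      have : c = 0 := cls_zero_injective P Y (by rw [h, map_zero])
      rw [this, map_zero]
    · intro h
      have : c = 0 := cocycleVal_injective P Y 0
        (by rw [map_zero]; exact extMk_zero_injective P Y _ (cocycleVal_d P Y 0 c) h)
      rw [this, map_zero]
  | succ m =>
    rw [cls_eq_zero_iff P Y (m+1) m rfl, cocycleExt_apply,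
      P.extMk_eq_zero_iff _ _ _ _ m rfl]

/-- Comparison of the two `Ext` groups via a projective resolution. -/
def homologyExtEquiv : ((homCx P Y).homology n).unop ≃ₗ[R] Abelian.Ext A Y n :=
  ((cocycleCls P Y n).quotKerEquivOfSurjective (cocycleCls_surjective P Y n)).symm ≪≫ₗ
    (Submodule.quotEquivOfEq _ _ (cls_ext_ker P Y n)) ≪≫ₗ
    ((cocycleExt P Y n).quotKerEquivOfSurjective (cocycleExt_surjective P Y n))

lemma homologyExtEquiv_cls (c) :
    homologyExtEquiv P Y n (cocycleCls P Y n c) = cocycleExt P Y n c := by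
  have h : ((cocycleCls P Y n).quotKerEquivOfSurjective (cocycleCls_surjective P Y n)).symm
      (cocycleCls P Y n c) = Submodule.Quotient.mk c := by
    rw [LinearEquiv.symm_apply_eq]; rfl
  simp only [homologyExtEquiv, LinearEquiv.trans_apply]
  rw [h]
  rfl

variable {A' : ModuleCat.{0} R} {P} {P' : ProjectiveResolution A'} {g : A' ⟶ A}

lemma homologyExtEquiv_naturality (φ : ProjectiveResolution.Hom P' P g)
    (x : ((homCx P Y).homology n).unop) :
    homologyExtEquiv P' Y n ((HomologicalComplex.homologyMap
      (((((linearYoneda R (ModuleCat.{0} R)).obj Y).rightOp).mapHomologicalComplex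
    (ComplexShape.down ℕ)).map φ.hom) n).unop.hom x) =
      (Abelian.Ext.mk₀ g).comp (homologyExtEquiv P Y n x) (zero_add _) := by
  obtain ⟨c, rfl⟩ := cocycleCls_surjective P Y n x
  set ψ := (((((linearYoneda R (ModuleCat.{0} R)).obj Y).rightOp).mapHomologicalComplex
    (ComplexShape.down ℕ)).map φ.hom)
  have h1 := congrArg (fun f => (ModuleCat.Hom.hom f) c)
    (congrArg Quiver.Hom.unop (HomologicalComplex.homologyι_naturality ψ n))
  have h2 := congrArg (fun f => (ModuleCat.Hom.hom f) c)
    (congrArg Quiver.Hom.unop (HomologicalComplex.p_opcyclesMap ψ n))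
  have h1' : (HomologicalComplex.homologyMap ψ n).unop.hom (cocycleCls P Y n c) =
    cocycleCls P' Y n ((HomologicalComplex.opcyclesMap ψ n).unop.hom c) := h1
  have h2' : cocycleVal P' Y n ((HomologicalComplex.opcyclesMap ψ n).unop.hom c) =
    φ.hom.f n ≫ cocycleVal P Y n c := h2
  rw [h1', homologyExtEquiv_cls, homologyExtEquiv_cls, cocycleExt_apply, cocycleExt_apply,
    ProjectiveResolution.mk₀_comp_extMk _ _ _ _ φ]
  congr 1


/-- Comparison of the `Ext` functor of abelian categories with enough projectives with the
`Ext` groups defined through the derived category. -/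
def oldExtEquiv (A Y : ModuleCat.{0} R) (n : ℕ) :
    ((Ext R (ModuleCat.{0} R) n).obj (op A)).obj Y ≃ₗ[R] Abelian.Ext A Y n :=
  (((projectiveResolution A).isoLeftDerivedObj
    ((linearYoneda R (ModuleCat.{0} R)).obj Y).rightOp n).unop.symm).toLinearEquiv ≪≫ₗ
    homologyExtEquiv (projectiveResolution A) Y n

lemma oldExtEquiv_naturality {A A' : ModuleCat.{0} R} (g : A' ⟶ A) (Y : ModuleCat.{0} R) (n : ℕ)
    (x : ((Ext R (ModuleCat.{0} R) n).obj (op A)).obj Y) :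
    oldExtEquiv A' Y n ((((Ext R (ModuleCat.{0} R) n).map g.op).app Y).hom x) =
      (Abelian.Ext.mk₀ g).comp (oldExtEquiv A Y n x) (zero_add _) := by
  let φ : ProjectiveResolution.Hom (projectiveResolution A') (projectiveResolution A) g :=
    { hom := ProjectiveResolution.lift g _ _
      hom_f_zero_comp_π_f_zero := ProjectiveResolution.lift_commutes_zero _ _ _ }
  have h := ProjectiveResolution.isoLeftDerivedObj_inv_naturality g _ _ φ.hom
    φ.hom_f_zero_comp_π_f_zero ((linearYoneda R (ModuleCat.{0} R)).obj Y).rightOp n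
  have h2 := congrArg (fun f => (ModuleCat.Hom.hom f) x) (congrArg Quiver.Hom.unop h)
  have h3 := homologyExtEquiv_naturality Y n φ ((((projectiveResolution A).isoLeftDerivedObj
    ((linearYoneda R (ModuleCat.{0} R)).obj Y).rightOp n).unop.symm).toLinearEquiv x)
  refine Eq.trans ?_ h3
  exact congrArg (homologyExtEquiv (projectiveResolution A') Y n) h2

end
end LH

namespace LH
open Limits Opposite

noncomputable section

variable {R : Type} [CommRing R]

/-- The cyclic module `R / aⁿ`. -/
abbrev quo (a : Ideal R) (n : ℕ) : ModuleCat.{0} R := ModuleCat.of R (R ⧸ a ^ n)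

/-- The projection `R / aᵐ → R / aⁿ`. -/
def quoMap (a : Ideal R) {n m : ℕ} (h : n ≤ m) : quo a m ⟶ quo a n :=
  ModuleCat.ofHom (Submodule.mapQ _ _ LinearMap.id (Ideal.pow_le_pow_right h))

lemma quoMap_comp (a : Ideal R) {n m k : ℕ} (h : n ≤ m) (h' : m ≤ k) :
    quoMap a h' ≫ quoMap a h = quoMap a (h.trans h') := by
  ext
  rfl

lemma quoMap_refl (a : Ideal R) (n : ℕ) : quoMap a (le_refl n) = 𝟙 _ := by
  ext
  rfl

/-- The transition maps of the system defining local cohomology. -/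
def trans (a : Ideal R) (i : ℕ) (M : ModuleCat.{0} R) (n m : ℕ) (h : n ≤ m) :
    Abelian.Ext (quo a n) M i →ₗ[R] Abelian.Ext (quo a m) M i :=
  (Abelian.Ext.mk₀ (quoMap a h)).precompOfLinear R M (zero_add i)

lemma trans_apply (a : Ideal R) (i : ℕ) (M : ModuleCat.{0} R) (n m : ℕ) (h : n ≤ m)
    (x : Abelian.Ext (quo a n) M i) :
    trans a i M n m h x = (Abelian.Ext.mk₀ (quoMap a h)).comp x (zero_add i) := rfl

instance (a : Ideal R) (i : ℕ) (M : ModuleCat.{0} R) :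
    DirectedSystem (fun n => Abelian.Ext (quo a n) M i) (fun n m h => trans a i M n m h) where
  map_self n x := by
    rw [trans_apply, quoMap_refl, Abelian.Ext.mk₀_id_comp]
  map_map {k j n} h h' x := by
    simp only [trans_apply]
    rw [← Abelian.Ext.comp_assoc _ _ _ (zero_add 0) (zero_add i) (by lia),
      Abelian.Ext.mk₀_comp_mk₀, quoMap_comp]

/-- Local cohomology as an explicit direct limit. -/
def LC (a : Ideal R) (i : ℕ) (M : ModuleCat.{0} R) : Type :=
  Module.DirectLimit (fun n => Abelian.Ext (quo a n) M i) (trans a i M)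

instance (a : Ideal R) (i : ℕ) (M : ModuleCat.{0} R) : AddCommGroup (LC a i M) :=
  inferInstanceAs (AddCommGroup (Module.DirectLimit _ _))

instance (a : Ideal R) (i : ℕ) (M : ModuleCat.{0} R) : Module R (LC a i M) :=
  inferInstanceAs (Module R (Module.DirectLimit _ _))

namespace LC

variable (a : Ideal R) (i : ℕ) (M : ModuleCat.{0} R)

/-- The structure map into the direct limit. -/
def of (n : ℕ) : Abelian.Ext (quo a n) M i →ₗ[R] LC a i M :=
  Module.DirectLimit.of R ℕ (fun n => Abelian.Ext (quo a n) M i) (trans a i M) n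

variable {a i M}

lemma of_trans {n m : ℕ} (h : n ≤ m) (x) : of a i M m (trans a i M n m h x) = of a i M n x :=
  Module.DirectLimit.of_f

lemma exists_of (z : LC a i M) : ∃ n x, of a i M n x = z :=
  Module.DirectLimit.exists_of z

lemma of_eq_zero {n : ℕ} {x} (h : of a i M n x = 0) : ∃ m, ∃ h : n ≤ m, trans a i M n m h x = 0 :=
  Module.DirectLimit.of.zero_exact h

lemma of_eq_zero_of_trans {n m : ℕ} {x} (h : n ≤ m) (h0 : trans a i M n m h x = 0) :
    of a i M n x = 0 := by
  rw [← of_trans h, h0, map_zero]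

/-- The universal property of the direct limit. -/
def lift {P : Type} [AddCommGroup P] [Module R P] (g : ∀ n, Abelian.Ext (quo a n) M i →ₗ[R] P)
    (hg : ∀ n m h x, g m (trans a i M n m h x) = g n x) : LC a i M →ₗ[R] P :=
  Module.DirectLimit.lift R ℕ _ _ g hg

lemma lift_of {P : Type} [AddCommGroup P] [Module R P]
    (g : ∀ n, Abelian.Ext (quo a n) M i →ₗ[R] P)
    (hg : ∀ n m h x, g m (trans a i M n m h x) = g n x) (n x) :
    lift g hg (of a i M n x) = g n x :=
  Module.DirectLimit.lift_of _ hg x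

end LC

/-- The structure maps of the colimit in the definition of local cohomology. -/
def topOf (a : Ideal R) (i : ℕ) (M : ModuleCat.{0} R) (n : ℕ) :
    Abelian.Ext (quo a n) M i →ₗ[R] ((localCohomology a i).obj M) :=
  (((colimit.ι (localCohomology.diagram (localCohomology.idealPowersDiagram a) i)
    (op (op n))).app M).hom).comp (oldExtEquiv (quo a n) M i).symm.toLinearMap

lemma topOf_old (a : Ideal R) (i : ℕ) (M : ModuleCat.{0} R) (n : ℕ)
    (y : ((Ext R (ModuleCat.{0} R) i).obj (op (quo a n))).obj M) :
    topOf a i M n (oldExtEquiv (quo a n) M i y) =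
      ((colimit.ι (localCohomology.diagram (localCohomology.idealPowersDiagram a) i)
        (op (op n))).app M).hom y :=
  congrArg ((colimit.ι (localCohomology.diagram (localCohomology.idealPowersDiagram a) i)
    (op (op n))).app M).hom ((oldExtEquiv (quo a n) M i).symm_apply_apply y)

lemma topOf_trans (a : Ideal R) (i : ℕ) (M : ModuleCat.{0} R) (n m : ℕ) (h : n ≤ m) (x) :
    topOf a i M m (trans a i M n m h x) = topOf a i M n x := by
  obtain ⟨y, rfl⟩ := (oldExtEquiv (quo a n) M i).surjective x
  rw [trans_apply, ← oldExtEquiv_naturality]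
  have h2 := colimit.w (localCohomology.diagram (localCohomology.idealPowersDiagram a) i)
    ((homOfLE h).op.op)
  have h3 := congrArg (fun f => (ModuleCat.Hom.hom (NatTrans.app f M)) y) h2
  rw [topOf_old, topOf_old]
  exact h3

/-- The colimit cocone evaluated at a module. -/
def evalIsColimit (a : Ideal R) (i : ℕ) (M : ModuleCat.{0} R) :
    IsColimit (((evaluation _ _).obj M).mapCocone
      (colimit.cocone (localCohomology.diagram (localCohomology.idealPowersDiagram a) i))) :=
  isColimitOfPreserves _ (colimit.isColimit _)

lemma topOf_surjective (a : Ideal R) (i : ℕ) (M : ModuleCat.{0} R)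
    (z : (localCohomology a i).obj M) : ∃ n x, topOf a i M n x = z := by
  obtain ⟨j, y, hy⟩ := Concrete.isColimit_exists_rep _ (evalIsColimit a i M) z
  refine ⟨j.unop.unop, oldExtEquiv (quo a j.unop.unop) M i y, ?_⟩
  exact (topOf_old a i M _ y).trans hy

lemma topOf_eq_zero (a : Ideal R) (i : ℕ) (M : ModuleCat.{0} R) (n : ℕ) (x)
    (h : topOf a i M n x = 0) : ∃ m, ∃ h : n ≤ m, trans a i M n m h x = 0 := by
  obtain ⟨y, rfl⟩ := (oldExtEquiv (quo a n) M i).surjective x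
  rw [topOf_old] at h
  obtain ⟨k, f, g, hk⟩ := Concrete.isColimit_exists_of_rep_eq _ (evalIsColimit a i M)
    (i := op (op n)) (j := op (op n)) y 0 (by
      rw [map_zero]; exact h)
  rw [map_zero] at hk
  have hle : n ≤ k.unop.unop := leOfHom f.unop.unop
  refine ⟨k.unop.unop, hle, ?_⟩
  rw [trans_apply, ← oldExtEquiv_naturality]
  refine Eq.trans (congrArg _ ?_) (map_zero _)
  exact hk

/-- Comparison with the definition by colimits. -/
def lcEquiv (a : Ideal R) (i : ℕ) (M : ModuleCat.{0} R) :
    LC a i M ≃ₗ[R] ((localCohomology a i).obj M) :=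
  LinearEquiv.ofBijective (LC.lift (topOf a i M) (topOf_trans a i M)) <| by
    constructor
    · rw [injective_iff_map_eq_zero]
      intro z hz
      obtain ⟨n, x, rfl⟩ := LC.exists_of z
      rw [LC.lift_of] at hz
      obtain ⟨m, h, h'⟩ := topOf_eq_zero a i M n x hz
      exact LC.of_eq_zero_of_trans h h'
    · intro z
      obtain ⟨n, x, rfl⟩ := topOf_surjective a i M z
      exact ⟨LC.of a i M n x, LC.lift_of _ _ n x⟩

/-- `TopLC` as an explicit direct limit. -/
def topLCEquiv (a : Ideal R) (i : ℕ) (M : Type) [AddCommGroup M] [Module R M] :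
    LC a i (ModuleCat.of R M) ≃ₗ[R] TopLC R a i M :=
  lcEquiv a i (ModuleCat.of R M)

end
end LH

namespace LH
open Limits Opposite

noncomputable section

variable {R : Type} [CommRing R]

namespace LC

/-- Composition with an `Ext` class on local cohomology. -/
def post (a : Ideal R) {M N : ModuleCat.{0} R} {k : ℕ} (ξ : Abelian.Ext M N k) (i j : ℕ)
    (h : i + k = j) : LC a i M →ₗ[R] LC a j N :=
  lift (fun n => (of a j N n).comp (ξ.postcompOfLinear R (quo a n) h)) <| by
    intro n m hnm x
    simp only [LinearMap.comp_apply]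
    rw [← of_trans hnm]
    congr 1
    exact Abelian.Ext.comp_assoc _ _ _ (zero_add i) h (by lia)

lemma post_of (a : Ideal R) {M N : ModuleCat.{0} R} {k : ℕ} (ξ : Abelian.Ext M N k) (i j : ℕ)
    (h : i + k = j) (n) (x : Abelian.Ext (quo a n) M i) :
    post a ξ i j h (of a i M n x) = of a j N n (x.comp ξ h) :=
  lift_of _ _ n x

lemma trans_comp (a : Ideal R) {M N : ModuleCat.{0} R} {k : ℕ} (ξ : Abelian.Ext M N k) (i j : ℕ)
    (h : i + k = j) (n m) (hnm : n ≤ m) (x : Abelian.Ext (quo a n) M i) :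
    trans a j N n m hnm (x.comp ξ h) = (trans a i M n m hnm x).comp ξ h :=
  (Abelian.Ext.comp_assoc _ _ _ (zero_add i) h (by lia)).symm

lemma exists_of_comp_eq_zero (a : Ideal R) {M N : ModuleCat.{0} R} {k : ℕ}
    (ξ : Abelian.Ext M N k) (i j : ℕ) (h : i + k = j) (z : LC a i M) (hz : post a ξ i j h z = 0) :
    ∃ n x, of a i M n x = z ∧ x.comp ξ h = 0 := by
  obtain ⟨n, x, rfl⟩ := exists_of z
  rw [post_of] at hz
  obtain ⟨m, hm, h0⟩ := of_eq_zero hz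
  rw [trans_comp] at h0
  exact ⟨m, _, of_trans hm x, h0⟩

lemma post_smul (a : Ideal R) {M N : ModuleCat.{0} R} {k : ℕ} (ξ : Abelian.Ext M N k) (i j : ℕ)
    (h : i + k = j) (r : R) (z) : post a (r • ξ) i j h z = r • post a ξ i j h z := by
  obtain ⟨n, x, rfl⟩ := exists_of z
  rw [post_of, post_of, Abelian.Ext.comp_smul, map_smul]

lemma post_id (a : Ideal R) {M : ModuleCat.{0} R} (i : ℕ) (z) :
    post a (Abelian.Ext.mk₀ (𝟙 M)) i i (add_zero i) z = z := by
  obtain ⟨n, x, rfl⟩ := exists_of z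
  rw [post_of, Abelian.Ext.comp_mk₀_id]

lemma post_comp_post (a : Ideal R) {M N P : ModuleCat.{0} R} {k l t : ℕ} (ξ : Abelian.Ext M N k)
    (η : Abelian.Ext N P l) (hkl : k + l = t)
    (i j m : ℕ) (h : i + k = j) (h' : j + l = m) (z) :
    post a η j m h' (post a ξ i j h z) = post a (ξ.comp η hkl) i m (by lia) z := by
  obtain ⟨n, x, rfl⟩ := exists_of z
  rw [post_of, post_of, post_of, Abelian.Ext.comp_assoc _ _ _ h hkl (by lia)]

variable (a : Ideal R) {S : ShortComplex (ModuleCat.{0} R)} (hS : S.ShortExact)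

include hS

lemma exact₂ (i : ℕ) (z : LC a i S.X₂)
    (hz : post a (Abelian.Ext.mk₀ S.g) i i (add_zero i) z = 0) :
    ∃ y, post a (Abelian.Ext.mk₀ S.f) i i (add_zero i) y = z := by
  obtain ⟨n, x, rfl, h⟩ := exists_of_comp_eq_zero a _ _ _ _ z hz
  obtain ⟨y, rfl⟩ := Abelian.Ext.covariant_sequence_exact₂ _ hS x h
  exact ⟨of a i _ n y, post_of _ _ _ _ _ _ _⟩

lemma exact₁ (i : ℕ) (z : LC a (i+1) S.X₁)
    (hz : post a (Abelian.Ext.mk₀ S.f) _ _ (add_zero _) z = 0) :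
    ∃ y, post a hS.extClass i (i+1) rfl y = z := by
  obtain ⟨n, x, rfl, h⟩ := exists_of_comp_eq_zero a _ _ _ _ z hz
  obtain ⟨y, rfl⟩ := Abelian.Ext.covariant_sequence_exact₁ _ hS x h rfl
  exact ⟨of a i _ n y, post_of _ _ _ _ _ _ _⟩

lemma exact₃ (i : ℕ) (z : LC a i S.X₃) (hz : post a hS.extClass i (i+1) rfl z = 0) :
    ∃ y, post a (Abelian.Ext.mk₀ S.g) i i (add_zero i) y = z := by
  obtain ⟨n, x, rfl, h⟩ := exists_of_comp_eq_zero a _ _ _ _ z hz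
  obtain ⟨y, rfl⟩ := Abelian.Ext.covariant_sequence_exact₃ _ hS x rfl h
  exact ⟨of a i _ n y, post_of _ _ _ _ _ _ _⟩

end LC

lemma LC.torsion (a : Ideal R) (i : ℕ) (M : ModuleCat.{0} R) (z : LC a i M) :
    ∃ n, ∀ r ∈ a ^ n, r • z = 0 := by
  obtain ⟨n, x, rfl⟩ := exists_of z
  refine ⟨n, fun r hr => ?_⟩
  rw [← map_smul]
  have h : r • 𝟙 (quo a n) = 0 := by
    ext
    change r • (Submodule.Quotient.mk 1 : R ⧸ a ^ n) = 0
    rw [← Submodule.Quotient.mk_smul, Submodule.Quotient.mk_eq_zero]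
    simpa using hr
  have : r • x = 0 := by
    conv_lhs => rw [← Abelian.Ext.mk₀_id_comp x]
    rw [← Abelian.Ext.smul_comp, ← Abelian.Ext.mk₀_smul, h, Abelian.Ext.mk₀_zero,
      Abelian.Ext.zero_comp]
  rw [this, map_zero]

lemma LC.subsingleton_of_injective (a : Ideal R) (i : ℕ) (M : ModuleCat.{0} R) [Injective M] :
    Subsingleton (LC a (i+1) M) := by
  rw [subsingleton_iff_forall_eq 0]
  intro z
  obtain ⟨n, x, rfl⟩ := exists_of z
  rw [x.eq_zero_of_injective, map_zero]

/-- The submodule of elements annihilated by a power of `a`. -/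
def tors (a : Ideal R) (N : Type) [AddCommGroup N] [Module R N] : Submodule R N where
  carrier := {x | ∃ n, ∀ r ∈ a ^ n, r • x = 0}
  zero_mem' := ⟨0, fun r _ => smul_zero r⟩
  add_mem' := by
    rintro x y ⟨n, hn⟩ ⟨m, hm⟩
    refine ⟨max n m, fun r hr => ?_⟩
    rw [smul_add, hn r (Ideal.pow_le_pow_right (le_max_left _ _) hr),
      hm r (Ideal.pow_le_pow_right (le_max_right _ _) hr), add_zero]
  smul_mem' := by
    rintro c x ⟨n, hn⟩
    exact ⟨n, fun r hr => by rw [smul_comm, hn r hr, smul_zero]⟩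

lemma mem_tors {a : Ideal R} {N : Type} [AddCommGroup N] [Module R N] {x : N} :
    x ∈ tors a N ↔ ∃ n, ∀ r ∈ a ^ n, r • x = 0 := Iff.rfl

/-- Evaluation at `1` of the degree-zero local cohomology. -/
def ev (a : Ideal R) (M : ModuleCat.{0} R) : LC a 0 M →ₗ[R] M :=
  LC.lift (fun n => { toFun := fun x => (Abelian.Ext.homEquiv₀ x).hom (Submodule.Quotient.mk 1)
                      map_add' := fun x y => by
                        rw [show Abelian.Ext.homEquiv₀ (x + y) = Abelian.Ext.homEquiv₀ x +
                          Abelian.Ext.homEquiv₀ y from map_add Abelian.Ext.addEquiv₀ x y]; rfl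
                      map_smul' := fun r x => by
                        rw [show Abelian.Ext.homEquiv₀ (r • x) = r • Abelian.Ext.homEquiv₀ x
                          from map_smul (Abelian.Ext.linearEquiv₀ (R := R)) r x]; rfl }) <| by
    intro n m h x
    obtain ⟨f, rfl⟩ := Abelian.Ext.homEquiv₀.symm.surjective x
    simp only [LinearMap.coe_mk, AddHom.coe_mk]
    have : trans a 0 M n m h (Abelian.Ext.homEquiv₀.symm f) =
      Abelian.Ext.homEquiv₀.symm (quoMap a h ≫ f) := Abelian.Ext.mk₀_comp_mk₀ _ _
    rw [this, Equiv.apply_symm_apply, Equiv.apply_symm_apply]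
    rfl

lemma ev_of_mk₀ (a : Ideal R) (M : ModuleCat.{0} R) (n : ℕ) (f : quo a n ⟶ M) :
    ev a M (LC.of a 0 M n (Abelian.Ext.mk₀ f)) = f.hom (Submodule.Quotient.mk 1) := by
  rw [ev, LC.lift_of]
  exact congrArg (fun g => (ModuleCat.Hom.hom g) _) (Abelian.Ext.homEquiv₀.apply_symm_apply f)

lemma ev_injective (a : Ideal R) (M : ModuleCat.{0} R) : Function.Injective (ev a M) := by
  rw [injective_iff_map_eq_zero]
  intro z hz
  obtain ⟨n, x, rfl⟩ := LC.exists_of z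
  obtain ⟨f, rfl⟩ := Abelian.Ext.mk₀_bijective _ _ |>.2 x
  rw [ev_of_mk₀] at hz
  have : f = 0 := by
    ext
    exact hz
  rw [this, Abelian.Ext.mk₀_zero, map_zero]

lemma ev_range (a : Ideal R) (M : ModuleCat.{0} R) : LinearMap.range (ev a M) = tors a M := by
  ext x
  rw [LinearMap.mem_range, mem_tors]
  constructor
  · rintro ⟨z, rfl⟩
    obtain ⟨n, hn⟩ := LC.torsion a 0 M z
    exact ⟨n, fun r hr => by rw [← map_smul, hn r hr, map_zero]⟩
  · rintro ⟨n, hn⟩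
    refine ⟨LC.of a 0 M n (Abelian.Ext.mk₀ (ModuleCat.ofHom
      (Submodule.liftQ (a ^ n) (LinearMap.toSpanSingleton R M x) hn))), ?_⟩
    rw [ev_of_mk₀]
    exact one_smul R x

lemma ev_post (a : Ideal R) {M N : ModuleCat.{0} R} (f : M ⟶ N) (z) :
    ev a N (LC.post a (Abelian.Ext.mk₀ f) 0 0 rfl z) = f.hom (ev a M z) := by
  obtain ⟨n, x, rfl⟩ := LC.exists_of z
  obtain ⟨g, rfl⟩ := Abelian.Ext.mk₀_bijective _ _ |>.2 x
  rw [LC.post_of, Abelian.Ext.mk₀_comp_mk₀, ev_of_mk₀, ev_of_mk₀]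
  rfl

open ZeroObject in
/-- A presentation of `Ext(-, M)` in degree `d` by an injective module. -/
lemma exists_extModel (d : ℕ) (M : ModuleCat.{0} R) :
    ∃ (E Q : ModuleCat.{0} R) (_ : Injective E) (π : E ⟶ Q) (ξ : Abelian.Ext Q M d),
      ∀ A : ModuleCat.{0} R,
      (∀ x : Abelian.Ext A M d, ∃ y : A ⟶ Q, (Abelian.Ext.mk₀ y).comp ξ (zero_add d) = x) ∧
      (∀ y : A ⟶ Q, (Abelian.Ext.mk₀ y).comp ξ (zero_add d) = 0 ↔ ∃ e : A ⟶ E, e ≫ π = y) := by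
  induction d using Nat.strong_induction_on generalizing M with
  | _ d ih =>
  obtain _ | d := d
  · refine ⟨0, M, inferInstance, 0, Abelian.Ext.mk₀ (𝟙 M), fun A => ⟨fun x => ?_, fun y => ?_⟩⟩
    · obtain ⟨y, rfl⟩ := Abelian.Ext.mk₀_bijective _ _ |>.2 x
      exact ⟨y, Abelian.Ext.comp_mk₀_id _⟩
    · rw [Abelian.Ext.comp_mk₀_id, Abelian.Ext.mk₀_eq_zero_iff]
      constructor
      · rintro rfl
        exact ⟨0, by simp⟩
      · rintro ⟨e, rfl⟩
        simp
  · let S := ShortComplex.mk (Injective.ι M) (cokernel.π (Injective.ι M)) (by simp)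
    have hS : S.ShortExact :=
      { exact := S.exact_of_g_is_cokernel (cokernelIsCokernel _) }
    have surj : ∀ (A) (x : Abelian.Ext A M (d+1)), ∃ x₃ : Abelian.Ext A S.X₃ d,
        x₃.comp hS.extClass rfl = x := by
      intro A x
      refine Abelian.Ext.covariant_sequence_exact₁ _ hS x ?_ rfl
      have : Injective S.X₂ := inferInstanceAs (Injective (Injective.under M))
      exact Abelian.Ext.eq_zero_of_injective _
    obtain _ | d := d
    · refine ⟨S.X₂, S.X₃, inferInstanceAs (Injective (Injective.under M)), S.g, hS.extClass,
        fun A => ⟨fun x => ?_, fun y => ⟨fun h => ?_, ?_⟩⟩⟩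
      · obtain ⟨y, hy⟩ := surj A x
        obtain ⟨y, rfl⟩ := Abelian.Ext.mk₀_bijective _ _ |>.2 y
        exact ⟨y, hy⟩
      · obtain ⟨e, he⟩ := Abelian.Ext.covariant_sequence_exact₃ _ hS _ _ h
        obtain ⟨e, rfl⟩ := Abelian.Ext.mk₀_bijective _ _ |>.2 e
        rw [Abelian.Ext.mk₀_comp_mk₀] at he
        exact ⟨e, Abelian.Ext.mk₀_bijective _ _ |>.1 he⟩
      · rintro ⟨e, rfl⟩
        rw [← Abelian.Ext.mk₀_comp_mk₀, Abelian.Ext.comp_assoc _ _ _ (zero_add 0) (zero_add 1)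
          (by lia), hS.comp_extClass, Abelian.Ext.comp_zero]
    · obtain ⟨E, Q, hE, π, ξ, h⟩ := ih (d+1) (by lia) S.X₃
      refine ⟨E, Q, hE, π, ξ.comp hS.extClass rfl, fun A => ⟨fun x => ?_, fun y => ?_⟩⟩
      · obtain ⟨x, rfl⟩ := surj A x
        obtain ⟨y, rfl⟩ := (h A).1 x
        exact ⟨y, (Abelian.Ext.comp_assoc _ _ _ (zero_add _) rfl (by lia)).symm⟩
      · rw [← (h A).2, ← Abelian.Ext.comp_assoc _ _ _ (zero_add (d+1)) rfl (by lia)]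
        constructor
        · intro h0
          obtain ⟨x, hx⟩ := Abelian.Ext.covariant_sequence_exact₃ _ hS _ _ h0
          have : Injective S.X₂ := inferInstanceAs (Injective (Injective.under M))
          rw [← hx, Abelian.Ext.eq_zero_of_injective x, Abelian.Ext.zero_comp]
        · intro h0
          rw [h0, Abelian.Ext.zero_comp]

lemma exists_gammaModel (d : ℕ) (M : ModuleCat.{0} R) :
    ∃ (E Q : ModuleCat.{0} R) (_ : Injective E) (π : E →ₗ[R] Q), ∀ a : Ideal R,
      ∃ Φ : tors a Q →ₗ[R] LC a d M, Function.Surjective Φ ∧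
        ∀ q, Φ q = 0 ↔ ∃ e ∈ tors a E, π e = q := by
  obtain ⟨E, Q, hE, π, ξ, h⟩ := exists_extModel d M
  refine ⟨E, Q, hE, π.hom, fun a => ?_⟩
  let e : LC a 0 Q ≃ₗ[R] tors a Q := (LinearEquiv.ofInjective _ (ev_injective a Q)).trans
    (LinearEquiv.ofEq _ _ (ev_range a Q))
  have he : ∀ z, (e z : Q) = ev a Q z := fun z => rfl
  refine ⟨(LC.post a ξ 0 d (zero_add d)).comp e.symm.toLinearMap, fun z => ?_, fun q => ?_⟩
  · obtain ⟨n, x, rfl⟩ := LC.exists_of z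
    obtain ⟨y, rfl⟩ := (h _).1 x
    exact ⟨e (LC.of a 0 Q n (Abelian.Ext.mk₀ y)), by
      simp only [LinearMap.comp_apply, LinearEquiv.coe_coe, LinearEquiv.symm_apply_apply]
      rw [LC.post_of]⟩
  · obtain ⟨z, rfl⟩ := e.surjective q
    simp only [LinearMap.comp_apply, LinearEquiv.coe_coe, LinearEquiv.symm_apply_apply, he]
    constructor
    · intro hz
      obtain ⟨n, x, rfl, h0⟩ := LC.exists_of_comp_eq_zero a _ _ _ _ z hz
      obtain ⟨y, rfl⟩ := Abelian.Ext.mk₀_bijective _ _ |>.2 x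
      obtain ⟨w, rfl⟩ := ((h _).2 y).1 h0
      refine ⟨ev a E (LC.of a 0 E n (Abelian.Ext.mk₀ w)), ?_, ?_⟩
      · rw [← ev_range]; exact ⟨_, rfl⟩
      · rw [ev_of_mk₀, ev_of_mk₀]; rfl
    · rintro ⟨w, hw, hwz⟩
      rw [← ev_range] at hw
      obtain ⟨w, rfl⟩ := hw
      rw [← ev_post] at hwz
      rw [← ev_injective a Q hwz]
      obtain ⟨n, x, rfl⟩ := LC.exists_of w
      obtain ⟨y, rfl⟩ := Abelian.Ext.mk₀_bijective _ _ |>.2 x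
      rw [LC.post_of, LC.post_of, Abelian.Ext.mk₀_comp_mk₀, ((h _).2 _).2 ⟨y, rfl⟩, map_zero]

end
end LH

namespace LH

noncomputable section

variable {R : Type} [CommRing R]

lemma exists_pow_smul_eq_zero (a : Ideal R) (N : Type) [AddCommGroup N] [Module R N]
    [Module.Finite R N] (h : ∀ x : N, x ∈ tors a N) : ∃ n, ∀ r ∈ a ^ n, ∀ x : N, r • x = 0 := by
  obtain ⟨s, hs⟩ := Module.Finite.fg_top (R := R) (M := N)
  choose f hf using h
  refine ⟨s.sup f, fun r hr x => ?_⟩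
  have hx : x ∈ Submodule.span R (s : Set N) := hs ▸ Submodule.mem_top
  induction hx using Submodule.span_induction with
  | mem y hy => exact hf y r (Ideal.pow_le_pow_right (Finset.le_sup hy) hr)
  | zero => exact smul_zero r
  | add y z _ _ hy hz => rw [smul_add, hy, hz, add_zero]
  | smul c y _ hy => rw [smul_comm, hy, smul_zero]

lemma tors_injective [IsNoetherianRing R] (a : Ideal R) (E : Type) [AddCommGroup E] [Module R E]
    [hE : Module.Injective R E] : Module.Injective R (tors a E) := by
  rw [← Module.Baer.iff_injective]
  intro I φ
  obtain ⟨n, hn⟩ := exists_pow_smul_eq_zero a (LinearMap.range φ) (by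
    rintro ⟨x, hx⟩
    obtain ⟨n, hn⟩ := x.2
    exact ⟨n, fun r hr => by ext; exact hn r hr⟩)
  obtain ⟨k, hk⟩ := Ideal.exists_pow_inf_eq_pow_smul a (I : Submodule R R)
  have key : ∀ x : I, (x : R) ∈ a ^ (n + k) → φ x = 0 := by
    intro x hx
    have h1 : (x : R) ∈ a ^ n • (a ^ k • ⊤ ⊓ (I : Submodule R R)) := by
      have := hk (n + k) (Nat.le_add_left _ _)
      rw [Nat.add_sub_cancel] at this
      rw [← this]
      exact ⟨by simpa using hx, x.2⟩
    have h2 : (x : R) ∈ a ^ n • (I : Submodule R R) := Submodule.smul_mono le_rfl inf_le_right h1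
    have h3 : x ∈ a ^ n • (⊤ : Submodule R I) := by
      have : a ^ n • (I : Submodule R R) = Submodule.map I.subtype (a ^ n • ⊤) := by
        rw [Submodule.map_smul'', Submodule.map_subtype_top]
      rw [this] at h2
      obtain ⟨y, hy, hyx⟩ := h2
      rwa [← Subtype.ext hyx]
    refine Submodule.smul_induction_on h3 (fun r hr y _ => ?_) (fun y z hy hz => ?_)
    · rw [map_smul]
      exact congrArg Subtype.val (hn r hr ⟨φ y, y, rfl⟩)
    · rw [map_add, hy, hz, add_zero]
  let J : Ideal R := a ^ (n + k)
  let g : (I ⧸ Submodule.comap I.subtype J) →ₗ[R] E :=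
    Submodule.liftQ _ ((tors a E).subtype.comp φ) (by
      intro x hx
      change ((φ x : tors a E) : E) = 0
      rw [key x hx]; rfl)
  let f : (I ⧸ Submodule.comap I.subtype J) →ₗ[R] (R ⧸ J) := Submodule.mapQ _ J I.subtype le_rfl
  have hf : Function.Injective f := by
    rw [← LinearMap.ker_eq_bot]
    exact Submodule.ker_liftQ_eq_bot _ _ _ (by
      rw [LinearMap.ker_comp, Submodule.ker_mkQ])
  obtain ⟨h, hh⟩ := hE.out f hf g
  have h1 : h (Submodule.Quotient.mk 1) ∈ tors a E := ⟨n + k, fun r hr => by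
    rw [← map_smul, ← Submodule.Quotient.mk_smul,
      (Submodule.Quotient.mk_eq_zero J).2 (by simpa using hr), map_zero]⟩
  refine ⟨LinearMap.toSpanSingleton R _ ⟨_, h1⟩, fun x hx => ?_⟩
  ext
  change x • h (Submodule.Quotient.mk 1) = φ ⟨x, hx⟩
  rw [← map_smul, ← Submodule.Quotient.mk_smul, smul_eq_mul, mul_one]
  exact hh (Submodule.Quotient.mk ⟨x, hx⟩)

/-- Local cohomology of an unbundled module. -/
abbrev H (a : Ideal R) (i : ℕ) (M : Type) [AddCommGroup M] [Module R M] : Type :=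
  LC a i (ModuleCat.of R M)

variable {M N P : Type} [AddCommGroup M] [Module R M] [AddCommGroup N] [Module R N]
  [AddCommGroup P] [Module R P]

/-- Functoriality of local cohomology. -/
def hmap (a : Ideal R) (i : ℕ) (f : M →ₗ[R] N) : H a i M →ₗ[R] H a i N :=
  LC.post a (Abelian.Ext.mk₀ (ModuleCat.ofHom f)) i i (add_zero i)

lemma hmap_id (a : Ideal R) (i : ℕ) (z : H a i M) : hmap a i LinearMap.id z = z :=
  LC.post_id a i z

lemma hmap_comp (a : Ideal R) (i : ℕ) (f : M →ₗ[R] N) (g : N →ₗ[R] P) (z : H a i M) :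
    hmap a i g (hmap a i f z) = hmap a i (g.comp f) z := by
  rw [hmap, hmap, LC.post_comp_post a _ _ (add_zero 0) _ _ _ _ _ z, Abelian.Ext.mk₀_comp_mk₀]
  rfl

lemma hmap_zero (a : Ideal R) (i : ℕ) (z : H a i M) :
    hmap a i (0 : M →ₗ[R] N) z = 0 := by
  obtain ⟨n, x, rfl⟩ := LC.exists_of z
  have h : ModuleCat.ofHom (0 : M →ₗ[R] N) = 0 := rfl
  rw [hmap, LC.post_of, h, Abelian.Ext.mk₀_zero, Abelian.Ext.comp_zero, map_zero]

lemma hmap_smul_id (a : Ideal R) (i : ℕ) (r : R) (z : H a i M) :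
    hmap a i (r • LinearMap.id : M →ₗ[R] M) z = r • z := by
  rw [← LC.post_id a i z, ← LC.post_smul, LC.post_id, ← Abelian.Ext.mk₀_smul]
  rfl

/-- The equivalence on local cohomology induced by an equivalence of modules. -/
def hequiv (a : Ideal R) (i : ℕ) (e : M ≃ₗ[R] N) : H a i M ≃ₗ[R] H a i N :=
  LinearEquiv.ofLinearMap (hmap a i e.toLinearMap) (hmap a i e.symm.toLinearMap)
    (by ext z; simp [hmap_comp, hmap_id]) (by ext z; simp [hmap_comp, hmap_id])

section exact

variable (a : Ideal R) (i : ℕ) {f : M →ₗ[R] N} {g : N →ₗ[R] P} (hf : Function.Injective f)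
  (hg : Function.Surjective g) (hfg : Function.Exact f g)

include hf hg hfg

lemma shortExact : (ShortComplex.mk (ModuleCat.ofHom f) (ModuleCat.ofHom g)
    (by ext x; exact hfg.apply_apply_eq_zero x)).ShortExact where
  exact := (ShortComplex.moduleCat_exact_iff _).2 fun x hx => (hfg x).1 hx
  mono_f := (ModuleCat.mono_iff_injective _).2 hf
  epi_g := (ModuleCat.epi_iff_surjective _).2 hg

lemma hmap_exact : Function.Exact (hmap a i f) (hmap a i g) := by
  intro z
  constructor
  · exact LC.exact₂ a (shortExact hf hg hfg) i z
  · rintro ⟨y, rfl⟩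
    rw [hmap_comp, hfg.linearMap_comp_eq_zero]
    exact hmap_zero a i y

lemma exists_connecting : ∃ δ : H a i P →ₗ[R] H a (i+1) M,
    Function.Exact (hmap a i g) δ ∧ Function.Exact δ (hmap a (i+1) f) := by
  have hS := shortExact hf hg hfg
  refine ⟨LC.post a hS.extClass i (i+1) rfl, fun z => ⟨LC.exact₃ a hS i z, ?_⟩,
    fun z => ⟨LC.exact₁ a hS i z, ?_⟩⟩
  · rintro ⟨y, rfl⟩
    have h0 := hS.comp_extClass
    rw [hmap]
    obtain ⟨n, x, rfl⟩ := LC.exists_of y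
    rw [LC.post_of, LC.post_of, Abelian.Ext.comp_assoc _ _ _ (add_zero i) (zero_add 1) (by lia)]
    erw [h0]
    rw [Abelian.Ext.comp_zero, map_zero]
  · rintro ⟨y, rfl⟩
    have h0 := hS.extClass_comp
    rw [hmap]
    obtain ⟨n, x, rfl⟩ := LC.exists_of y
    rw [LC.post_of, LC.post_of, Abelian.Ext.comp_assoc _ _ _ rfl (add_zero 1) (by lia)]
    erw [h0]
    rw [Abelian.Ext.comp_zero, map_zero]

end exact

lemma subsingleton_of_exact (a : Ideal R) (i : ℕ) {f : M →ₗ[R] N} {g : N →ₗ[R] P}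
    (hf : Function.Injective f) (hg : Function.Surjective g) (hfg : Function.Exact f g)
    [Subsingleton (H a i M)] [Subsingleton (H a i P)] : Subsingleton (H a i N) := by
  rw [subsingleton_iff_forall_eq 0]
  intro z
  obtain ⟨y, rfl⟩ := (hmap_exact a i hf hg hfg z).1 (Subsingleton.elim _ _)
  rw [Subsingleton.elim y 0, map_zero]

lemma subsingleton_of_exact_right (a : Ideal R) (i : ℕ) {f : M →ₗ[R] N} {g : N →ₗ[R] P}
    (hf : Function.Injective f) (hg : Function.Surjective g) (hfg : Function.Exact f g)
    [Subsingleton (H a (i+1) M)] [Subsingleton (H a i N)] : Subsingleton (H a i P) := by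
  rw [subsingleton_iff_forall_eq 0]
  intro z
  obtain ⟨δ, h1, -⟩ := exists_connecting a i hf hg hfg
  obtain ⟨y, rfl⟩ := (h1 z).1 (Subsingleton.elim _ _)
  rw [Subsingleton.elim y 0, map_zero]

lemma subsingleton_of_exact_left (a : Ideal R) (i : ℕ) {f : M →ₗ[R] N} {g : N →ₗ[R] P}
    (hf : Function.Injective f) (hg : Function.Surjective g) (hfg : Function.Exact f g)
    [Subsingleton (H a (i+1) N)] [Subsingleton (H a i P)] : Subsingleton (H a (i+1) M) := by
  rw [subsingleton_iff_forall_eq 0]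
  intro z
  obtain ⟨δ, -, h2⟩ := exists_connecting a i hf hg hfg
  obtain ⟨y, rfl⟩ := (h2 z).1 (Subsingleton.elim _ _)
  rw [Subsingleton.elim y 0, map_zero]

lemma subsingleton_of_subsingleton (a : Ideal R) (i : ℕ) [Subsingleton M] :
    Subsingleton (H a i M) := by
  rw [subsingleton_iff_forall_eq 0]
  intro z
  rw [← hmap_id a i z, show (LinearMap.id : M →ₗ[R] M) = (0 : R) • LinearMap.id by
    ext; exact Subsingleton.elim _ _, hmap_smul_id, zero_smul]

lemma exists_injective_embedding (R : Type) [CommRing R] (N : Type) [AddCommGroup N]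
    [Module R N] : ∃ (E : Type) (_ : AddCommGroup E) (_ : Module R E) (_ : Module.Injective R E)
      (ι : N →ₗ[R] E), Function.Injective ι := by
  let E : ModuleCat.{0} R := Injective.under (ModuleCat.of R N)
  have : Injective (ModuleCat.of R E) :=
    inferInstanceAs (Injective (Injective.under (ModuleCat.of R N)))
  exact ⟨E, _, _, Module.injective_module_of_injective_object R E,
    (Injective.ι (ModuleCat.of R N)).hom, (ModuleCat.mono_iff_injective _).1 inferInstance⟩

/-- Positive local cohomology of a torsion module vanishes. -/
lemma subsingleton_of_tors [IsNoetherianRing R] (a : Ideal R) (i : ℕ) (N : Type)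
    [AddCommGroup N] [Module R N] (h : tors a N = ⊤) : Subsingleton (H a (i+1) N) := by
  induction i generalizing N with
  | zero => ?_
  | succ i ih => ?_
  all_goals
    obtain ⟨E, _, _, hE, ι, hι⟩ := exists_injective_embedding R N
    have hG := tors_injective a E
    have hle : ∀ x, ι x ∈ tors a E := by
      intro x
      obtain ⟨n, hn⟩ := h.ge (Submodule.mem_top (x := x))
      exact ⟨n, fun r hr => by rw [← map_smul, hn r hr, map_zero]⟩
    let f : N →ₗ[R] tors a E := ι.codRestrict _ hle
    have hf : Function.Injective f := fun x y hxy => hι (congrArg Subtype.val hxy)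
    let g := (LinearMap.range f).mkQ
    have hg : Function.Surjective g := Submodule.mkQ_surjective _
    have hfg : Function.Exact f g := LinearMap.exact_map_mkQ_range f
    have : Injective (ModuleCat.of R (tors a E)) := Module.injective_object_of_injective_module R _
  · have hsub := LC.subsingleton_of_injective a 0 (ModuleCat.of R (tors a E))
    obtain ⟨δ, h1, h2⟩ := exists_connecting a 0 hf hg hfg
    rw [subsingleton_iff_forall_eq 0]
    intro z
    obtain ⟨y, rfl⟩ := (h2 z).1 (Subsingleton.elim _ _)
    rw [h1]
    obtain ⟨w, hw⟩ := hg (ev a _ y)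
    have hwt : w ∈ tors a (tors a E) := by
      obtain ⟨n, hn⟩ := w.2
      exact ⟨n, fun r hr => Subtype.ext (hn r hr)⟩
    have hwr : w ∈ LinearMap.range (ev a (ModuleCat.of R (tors a E))) := by
      rw [ev_range]; exact hwt
    obtain ⟨v, hv⟩ := hwr
    refine ⟨v, ev_injective a _ ?_⟩
    exact (ev_post a (ModuleCat.ofHom g) v).trans ((congrArg g hv).trans hw)
  · have hsub := LC.subsingleton_of_injective a (i+1) (ModuleCat.of R (tors a E))
    have : Subsingleton (H a (i+1) ((tors a E) ⧸ LinearMap.range f)) := by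
      refine ih _ ?_
      rw [eq_top_iff]
      rintro x -
      obtain ⟨x, rfl⟩ := hg x
      obtain ⟨n, hn⟩ := x.2
      exact ⟨n, fun r hr => by rw [← map_smul, show r • x = 0 from Subtype.ext (hn r hr), map_zero]⟩
    exact subsingleton_of_exact_left a (i+1) hf hg hfg

end
end LH

namespace LH

noncomputable section

open scoped Pointwise

variable {R : Type} [CommRing R]

lemma supportDim_quot_prime_le [IsNoetherianRing R] (p : Ideal R) [p.IsPrime] {x : R}
    (hx : x ∉ p) : Module.supportDim R (QuotSMulTop x (R ⧸ p)) + 1 ≤ Module.supportDim R (R ⧸ p) :=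
  Module.supportDim_quotSMulTop_succ_le_of_notMem_minimalPrimes (by
    rw [Ideal.annihilator_quotient, Ideal.minimalPrimes_eq_subsingleton_self]
    rintro q rfl
    exact hx)

lemma smul_quot_prime_injective (p : Ideal R) [p.IsPrime] {x : R} (hx : x ∉ p) :
    Function.Injective (x • LinearMap.id : (R ⧸ p) →ₗ[R] (R ⧸ p)) := by
  rw [injective_iff_map_eq_zero]
  intro y hy
  obtain ⟨y, rfl⟩ := Ideal.Quotient.mk_surjective y
  have : Ideal.Quotient.mk p (x * y) = 0 := hy
  rw [Ideal.Quotient.eq_zero_iff_mem] at this ⊢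
  exact (Ideal.IsPrime.mem_or_mem ‹_› this).resolve_left hx

lemma exact_smul_mkQ (x : R) (N : Type) [AddCommGroup N] [Module R N] :
    Function.Exact (x • LinearMap.id : N →ₗ[R] N) (x • (⊤ : Submodule R N)).mkQ := by
  rw [LinearMap.exact_iff, Submodule.ker_mkQ]
  ext y
  simp [Submodule.mem_smul_pointwise_iff_exists]

lemma eq_zero_of_smul_injective (a : Ideal R) (i : ℕ) (N : ModuleCat.{0} R) {x : R} (hx : x ∈ a)
    (h : ∀ z : LC a i N, x • z = 0 → z = 0) : Subsingleton (LC a i N) := by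
  rw [subsingleton_iff_forall_eq 0]
  intro z
  obtain ⟨n, hn⟩ := LC.torsion a i N z
  have := hn (x ^ n) (Ideal.pow_mem_pow hx n)
  clear hn
  induction n with
  | zero => simpa using this
  | succ n ih =>
    rw [pow_succ', mul_smul] at this
    exact ih (h _ this)

lemma subsingleton_of_supportDim_bot_lt {N : Type} [AddCommGroup N] [Module R N]
    (h : Module.supportDim R N < (0 : ℕ)) : Subsingleton N := by
  rw [← Module.supportDim_eq_bot_iff_subsingleton (R := R)]
  by_contra h0
  have : Nontrivial N := by
    rw [← not_subsingleton_iff_nontrivial, ← Module.supportDim_eq_bot_iff_subsingleton (R := R)]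
    exact h0
  have : Nonempty (Module.support R N) := (Module.nonempty_support_of_nontrivial).to_subtype
  have := Order.krullDim_nonneg (α := Module.support R N)
  exact absurd h (not_lt.2 this)

lemma tors_quot_eq_top {a p : Ideal R} (h : a ≤ p) : tors a (R ⧸ p) = ⊤ := by
  rw [eq_top_iff]
  rintro x -
  refine ⟨1, fun r hr => ?_⟩
  rw [pow_one] at hr
  obtain ⟨x, rfl⟩ := Ideal.Quotient.mk_surjective x
  change Ideal.Quotient.mk p (r * x) = 0
  rw [Ideal.Quotient.eq_zero_iff_mem]
  exact p.mul_mem_right _ (h hr)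

/-- Grothendieck's vanishing theorem. -/
theorem subsingleton_of_supportDim_lt [IsNoetherianRing R] (a : Ideal R) (i : ℕ) (N : Type)
    [AddCommGroup N] [Module R N] [Module.Finite R N] (h : Module.supportDim R N < i) :
    Subsingleton (H a i N) := by
  induction i generalizing N with
  | zero =>
    have := subsingleton_of_supportDim_bot_lt h
    exact subsingleton_of_subsingleton a 0
  | succ i ih =>
    induction ‹Module.Finite R N› using
      IsNoetherianRing.induction_on_isQuotientEquivQuotientPrime R with
    | subsingleton N => exact subsingleton_of_subsingleton a (i+1)
    | quotient N p f =>
      rw [Module.supportDim_eq_of_equiv f] at h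
      have : Subsingleton (H a (i+1) (R ⧸ p.asIdeal)) := by
        by_cases hap : a ≤ p.asIdeal
        · exact subsingleton_of_tors a i _ (tors_quot_eq_top hap)
        · obtain ⟨x, hxa, hxp⟩ := SetLike.not_le_iff_exists.1 hap
          have hs : Subsingleton (H a i (QuotSMulTop x (R ⧸ p.asIdeal))) := by
            refine ih _ ?_
            refine lt_of_add_lt_add_right (a := 1)
              ((supportDim_quot_prime_le p.asIdeal hxp).trans_lt ?_)
            exact_mod_cast h
          refine eq_zero_of_smul_injective a (i+1) _ hxa fun z hz => ?_
          obtain ⟨δ, -, h2⟩ := exists_connecting a i (smul_quot_prime_injective p.asIdeal hxp)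
            (Submodule.mkQ_surjective _) (exact_smul_mkQ x _)
          obtain ⟨y, rfl⟩ := (h2 z).1 ((hmap_smul_id a (i+1) x z).trans hz)
          exact (congrArg δ (Subsingleton.elim (α := H a i (QuotSMulTop x (R ⧸ p.asIdeal)))
            y 0)).trans (map_zero δ)
      exact (hequiv a (i+1) f).toEquiv.subsingleton
    | exact N₁ N₂ N₃ f g hf hg hfg h₁ h₃ =>
      have := h₁ ((Module.supportDim_le_of_injective f hf).trans_lt h)
      have := h₃ ((Module.supportDim_le_of_surjective g hg).trans_lt h)
      exact subsingleton_of_exact a (i+1) hf hg hfg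

end
end LH

namespace LH

noncomputable section

variable {R : Type} [CommRing R]

/-- The submodule of elements annihilated by `s`. -/
abbrev ann (s : Set R) (Z : Type) [AddCommGroup Z] [Module R Z] : Submodule R Z :=
  Submodule.torsionBySet R Z s

lemma mem_ann {s : Set R} {Z : Type} [AddCommGroup Z] [Module R Z] {z : Z} :
    z ∈ ann s Z ↔ ∀ r ∈ s, r • z = 0 := by
  rw [ann, Submodule.mem_torsionBySet_iff]
  exact ⟨fun h r hr => h ⟨r, hr⟩, fun h r => h r r.2⟩

/-- A linear map restricts to the elements annihilated by a set. -/
def annMap (s : Set R) {Y Z : Type} [AddCommGroup Y] [Module R Y] [AddCommGroup Z] [Module R Z]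
    (f : Y →ₗ[R] Z) : ann s Y →ₗ[R] ann s Z :=
  f.restrict fun y hy => mem_ann.2 fun r hr => by rw [← map_smul, mem_ann.1 hy r hr, map_zero]

/-- Artinian modules in which the submodule annihilated by `s` has finite length. -/
structure Cof (s : Set R) (Z : Type) [AddCommGroup Z] [Module R Z] : Prop where
  artinian : IsArtinian R Z
  noetherian : IsNoetherian R (ann s Z)

section

variable {X Y Z : Type} [AddCommGroup X] [Module R X] [AddCommGroup Y] [Module R Y]
  [AddCommGroup Z] [Module R Z] {s : Set R}

lemma Cof.of_subsingleton [Subsingleton Z] : Cof s Z :=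
  ⟨inferInstance, inferInstance⟩

lemma Cof.of_isNoetherian (h : IsArtinian R Z) (h' : IsNoetherian R Z) : Cof s Z :=
  ⟨h, inferInstance⟩

lemma Cof.of_injective (h : Cof s Z) (f : Y →ₗ[R] Z) (hf : Function.Injective f) : Cof s Y := by
  have := h.1
  have := h.2
  refine ⟨isArtinian_of_injective f hf, isNoetherian_of_injective (annMap s f) ?_⟩
  exact fun x y hxy => Subtype.ext (hf (congrArg Subtype.val hxy))

lemma Cof.of_exact (h : Cof s X) (h' : Cof s Z) {f : X →ₗ[R] Y} {g : Y →ₗ[R] Z}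
    (hf : Function.Injective f) (hfg : Function.Exact f g) : Cof s Y := by
  have := h.1
  have := h.2
  have := h'.1
  have := h'.2
  refine ⟨isArtinian_of_range_eq_ker f g hfg.linearMap_ker_eq.symm,
    isNoetherian_of_range_eq_ker (annMap s f) (annMap s g) ?_⟩
  ext y
  constructor
  · rintro ⟨x, rfl⟩
    exact Subtype.ext (hfg.apply_apply_eq_zero x)
  · intro hy
    obtain ⟨x, hx⟩ := (hfg y).1 (congrArg Subtype.val hy)
    refine ⟨⟨x, mem_ann.2 fun r hr => hf ?_⟩, Subtype.ext hx⟩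
    rw [map_smul, hx, map_zero, mem_ann.1 y.2 r hr]

lemma cof_insert {x : R} : Cof (insert x s) Z ↔ IsArtinian R Z ∧ Cof s (ann {x} Z) := by
  constructor
  · rintro ⟨h, h'⟩
    refine ⟨h, inferInstance, ?_⟩
    have hf : ∀ z : ann s (ann {x} Z), ((z : ann {x} Z) : Z) ∈ ann (insert x s) Z := by
      intro z
      rw [mem_ann]
      rintro r (rfl | hr)
      · exact mem_ann.1 z.1.2 _ rfl
      · exact congrArg Subtype.val (mem_ann.1 z.2 r hr)
    refine isNoetherian_of_injective (P := ann (insert x s) Z)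
      (LinearMap.codRestrict _ ((ann {x} Z).subtype.comp (Submodule.subtype _)) hf) ?_
    intro z w h
    exact Subtype.ext (Subtype.ext (congrArg (fun t => (t.1 : Z)) h))
  · rintro ⟨h, -, h'⟩
    refine ⟨h, ?_⟩
    have h1 : ∀ z : ann (insert x s) Z, (z : Z) ∈ ann {x} Z := fun z => mem_ann.2 (by
      rintro _ rfl
      exact mem_ann.1 z.2 _ (Set.mem_insert _ _))
    have h2 : ∀ z : ann (insert x s) Z, (⟨z, h1 z⟩ : ann {x} Z) ∈ ann s (ann {x} Z) :=
      fun z => mem_ann.2 fun r hr => Subtype.ext (mem_ann.1 z.2 _ (Set.mem_insert_of_mem _ hr))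
    refine isNoetherian_of_injective (P := ann s (ann {x} Z))
      (LinearMap.codRestrict _ (LinearMap.codRestrict _ (Submodule.subtype _) h1) h2) ?_
    intro z w h
    exact Subtype.ext (congrArg (fun t => (t.1.1 : Z)) h)

lemma cof_ann_pow {x : R} (h : Cof s (ann {x} Z)) (n : ℕ) : Cof s (ann {x ^ n} Z) := by
  induction n with
  | zero =>
    have : Subsingleton (ann {x ^ 0} Z) := by
      rw [subsingleton_iff_forall_eq 0]
      intro z
      have := mem_ann.1 z.2 1 (by simp)
      rw [one_smul] at this
      exact Subtype.ext this
    exact Cof.of_subsingleton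
  | succ n ih =>
    have hle : ann {x ^ n} Z ≤ ann {x ^ (n+1)} Z := fun z hz => mem_ann.2 (by
      rintro _ rfl
      rw [pow_succ', mul_smul, mem_ann.1 hz _ rfl, smul_zero])
    let g : ann {x ^ (n+1)} Z →ₗ[R] ann {x} Z :=
      LinearMap.codRestrict _ ((x ^ n • LinearMap.id : Z →ₗ[R] Z).comp (Submodule.subtype _)) (by
        intro z
        rw [mem_ann]
        rintro r hr
        have := mem_ann.1 z.2 _ rfl
        rw [Set.mem_singleton_iff] at hr
        subst hr
        change r • r ^ n • (z : Z) = 0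
        rw [smul_smul, ← pow_succ']
        exact this)
    refine Cof.of_exact ih h (f := Submodule.inclusion hle) (g := g)
      (Submodule.inclusion_injective hle) ?_
    intro z
    constructor
    · intro hz
      exact ⟨⟨z, mem_ann.2 (by rintro _ rfl; exact congrArg Subtype.val hz)⟩, rfl⟩
    · rintro ⟨y, rfl⟩
      exact Subtype.ext (mem_ann.1 y.2 _ rfl)

lemma exists_pow_smul_eq (x : R) (Z : Type) [AddCommGroup Z] [Module R Z] [IsArtinian R Z] :
    ∃ n, ∀ z : Z, ∃ w : Z, x ^ (n + 1) • w = x ^ n • z := by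
  obtain ⟨n, hn⟩ := IsArtinian.range_smul_pow_stabilizes Z x
  refine ⟨n, fun z => ?_⟩
  have : x ^ n • z ∈ LinearMap.range (x ^ (n+1) • LinearMap.id : Z →ₗ[R] Z) := by
    rw [← hn (n+1) n.le_succ]
    exact ⟨z, rfl⟩
  exact this

lemma Cof.of_surjective_finset (s : Finset R) (Y Z : Type) [AddCommGroup Y] [Module R Y]
    [AddCommGroup Z] [Module R Z] (h : Cof (s : Set R) Y) (g : Y →ₗ[R] Z)
    (hg : Function.Surjective g) : Cof (s : Set R) Z := by
  classical
  induction s using Finset.induction_on generalizing Y Z with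
  | empty =>
    have := h.1
    have := h.2
    have : IsNoetherian R Y := by
      refine isNoetherian_of_injective (P := ann ((∅ : Finset R) : Set R) Y)
        (LinearMap.codRestrict _ LinearMap.id fun y => mem_ann.2 (by simp)) ?_
      exact fun y z h => congrArg Subtype.val h
    have := isNoetherian_of_surjective g (LinearMap.range_eq_top.2 hg)
    have := isArtinian_of_surjective Y g hg
    exact Cof.of_isNoetherian inferInstance inferInstance
  | insert x s _ ih =>
    rw [Finset.coe_insert] at h ⊢
    have hY := (cof_insert.1 h).2
    let W := LinearMap.ker g
    have hW := (cof_insert.1 (h.of_injective W.subtype W.subtype_injective))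
    have := h.1
    refine cof_insert.2 ⟨isArtinian_of_surjective Y g hg, ?_⟩
    obtain ⟨n, hn⟩ := exists_pow_smul_eq x W
    let V := W ⧸ LinearMap.range (x • LinearMap.id : W →ₗ[R] W)
    have hV : Cof (s : Set R) V := by
      refine ih _ _ (cof_ann_pow hW.2 n) ((Submodule.mkQ _).comp (Submodule.subtype _)) ?_
      intro v
      obtain ⟨w, rfl⟩ := Submodule.mkQ_surjective _ v
      obtain ⟨w', hw'⟩ := hn w
      refine ⟨⟨w - x • w', mem_ann.2 ?_⟩, ?_⟩
      · rintro _ rfl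
        rw [smul_sub, ← hw', smul_smul, pow_succ, sub_self]
      · have : x • w' ∈ LinearMap.range (x • LinearMap.id : W →ₗ[R] W) := ⟨w', rfl⟩
        change Submodule.mkQ _ (w - x • w') = _
        rw [map_sub, sub_eq_self]
        exact (Submodule.Quotient.mk_eq_zero _).2 this
    let I := LinearMap.range (annMap {x} g)
    have hI : Cof (s : Set R) I :=
      ih _ _ hY (annMap {x} g).rangeRestrict (LinearMap.surjective_rangeRestrict _)
    let P : Submodule R Y := W.comap (x • LinearMap.id)
    have hP : ∀ y : P, x • (y : Y) ∈ W := fun y => y.2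
    let h0 : P →ₗ[R] ann {x} Z := LinearMap.codRestrict _ (g.comp P.subtype) (fun y => mem_ann.2 (by
      rintro _ rfl
      change _ • g y = 0
      rw [← map_smul]
      exact hP y))
    let h1 : P →ₗ[R] (ann {x} Z ⧸ I) := I.mkQ.comp h0
    let h2 : P →ₗ[R] V := (Submodule.mkQ _).comp
      (LinearMap.codRestrict W ((x • LinearMap.id).comp P.subtype) hP)
    have hle : LinearMap.ker h2 ≤ LinearMap.ker h1 := by
      intro y hy
      obtain ⟨w, hw⟩ := (Submodule.Quotient.mk_eq_zero _).1 hy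
      replace hw : x • (w : Y) = x • (y : Y) := congrArg Subtype.val hw
      refine (Submodule.Quotient.mk_eq_zero _).2 ⟨⟨y - w, mem_ann.2 ?_⟩, ?_⟩
      · rintro _ rfl
        rw [smul_sub, hw, sub_self]
      · have : g w = 0 := w.2
        refine Subtype.ext ?_
        change g (y - w) = g y
        rw [map_sub, this, sub_zero]
    have hU : Cof (s : Set R) (ann {x} Z ⧸ I) := by
      refine ih _ _ (hV.of_injective (Submodule.liftQ (LinearMap.ker h2) h2 le_rfl)
        (LinearMap.ker_eq_bot.1 (Submodule.ker_liftQ_eq_bot _ _ _ le_rfl)))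
        (Submodule.liftQ _ h1 hle) ?_
      intro u
      obtain ⟨u, rfl⟩ := Submodule.mkQ_surjective _ u
      obtain ⟨y, hy⟩ := hg u
      have hyP : y ∈ P := by
        change g (x • y) = 0
        rw [map_smul, hy]
        exact mem_ann.1 u.2 _ rfl
      refine ⟨Submodule.Quotient.mk ⟨y, hyP⟩, ?_⟩
      exact congrArg I.mkQ (Subtype.ext hy)
    exact hI.of_exact hU I.subtype_injective (LinearMap.exact_subtype_mkQ I)

lemma ann_span (s : Set R) : ann (Ideal.span s : Set R) Z = ann s Z :=
  (Submodule.torsionBySet_eq_torsionBySet_span s).symm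

lemma cof_span (s : Set R) : Cof (Ideal.span s : Set R) Z ↔ Cof s Z := by
  constructor
  · rintro ⟨h, h'⟩
    exact ⟨h, by rwa [ann_span] at h'⟩
  · rintro ⟨h, h'⟩
    exact ⟨h, by rwa [ann_span]⟩

lemma Cof.of_surjective {a : Ideal R} (ha : a.FG) (h : Cof (a : Set R) Y) (g : Y →ₗ[R] Z)
    (hg : Function.Surjective g) : Cof (a : Set R) Z := by
  obtain ⟨s, rfl⟩ := ha
  exact (cof_span _).2 (Cof.of_surjective_finset s Y Z ((cof_span _).1 h) g hg)

lemma Cof.noetherian_pow {a : Ideal R} (ha : a.FG) (h : Cof (a : Set R) Z) (n : ℕ) :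
    IsNoetherian R (ann ((a ^ n : Ideal R) : Set R) Z) := by
  obtain ⟨s, rfl⟩ := ha
  induction n with
  | zero =>
    have : Subsingleton (ann ((Ideal.span (s : Set R) ^ 0 : Ideal R) : Set R) Z) := by
      rw [subsingleton_iff_forall_eq 0]
      intro z
      have := mem_ann.1 z.2 1 (by simp)
      rw [one_smul] at this
      exact Subtype.ext this
    infer_instance
  | succ n ih =>
    set a := Ideal.span (s : Set R) with ha
    have := h.2
    have hs : ∀ r : s, (r : R) ∈ a := fun r => Ideal.subset_span r.2
    let g : ann ((a ^ (n+1) : Ideal R) : Set R) Z →ₗ[R] (s → ann ((a ^ n : Ideal R) : Set R) Z) :=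
      LinearMap.pi fun r => LinearMap.codRestrict _
        (((r : R) • LinearMap.id).comp (Submodule.subtype _)) fun z => mem_ann.2 fun t ht => by
          change t • (r : R) • (z : Z) = 0
          rw [smul_smul]
          exact mem_ann.1 z.2 _ (by
            rw [pow_succ]; exact Ideal.mul_mem_mul ht (hs r))
    have hle : ann (a : Set R) Z ≤ ann ((a ^ (n+1) : Ideal R) : Set R) Z :=
      Submodule.torsionBySet_le_torsionBySet_of_subset (Ideal.pow_le_self n.succ_ne_zero)
    refine isNoetherian_of_range_eq_ker (Submodule.inclusion hle) g ?_
    ext z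
    constructor
    · rintro ⟨y, rfl⟩
      ext r
      exact mem_ann.1 y.2 _ (hs r)
    · intro hz
      refine ⟨⟨z, ?_⟩, rfl⟩
      refine (ann_span (Z := Z) (s : Set R)).ge (mem_ann.2 ?_)
      intro r hr
      exact congrArg Subtype.val (congrFun hz ⟨r, hr⟩)

end

end
end LH

namespace LH

noncomputable section

open scoped Pointwise

variable {R : Type} [CommRing R]

/-- A module in which every element is killed by a power of `x` is Artinian as soon as the
submodule of elements killed by `x` is. -/
lemma isArtinian_of_ann (x : R) (Z : Type) [AddCommGroup Z] [Module R Z]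
    (h : ∀ z : Z, ∃ n : ℕ, x ^ n • z = 0) [IsArtinian R (ann {x} Z)] : IsArtinian R Z := by
  let G : ℕ → Submodule R Z → Submodule R (ann {x} Z) := fun j N =>
    Submodule.comap (ann {x} Z).subtype (N.map (x ^ j • LinearMap.id))
  have G_mono : ∀ j, Monotone (G j) := fun j N N' hN =>
    Submodule.comap_mono (Submodule.map_mono hN)
  have G_anti : ∀ N i j, i ≤ j → G j N ≤ G i N := by
    rintro N i j hij z ⟨w, hw, hwz⟩
    refine ⟨x ^ (j - i) • w, N.smul_mem _ hw, ?_⟩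
    change x ^ i • x ^ (j - i) • w = _
    rw [smul_smul, ← pow_add, Nat.add_sub_cancel' hij]
    exact hwz
  have key : ∀ N N' : Submodule R Z, N ≤ N' → (∀ j, G j N' ≤ G j N) → N' ≤ N := by
    intro N N' hN hG
    have : ∀ k : ℕ, ∀ z ∈ N', x ^ k • z = 0 → z ∈ N := by
      intro k
      induction k with
      | zero =>
        intro z _ hz
        rw [pow_zero, one_smul] at hz
        rw [hz]; exact N.zero_mem
      | succ k ih =>
        intro z hz hzk
        have hmem : x ^ k • z ∈ ann {x} Z := mem_ann.2 (by
          rintro _ rfl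
          rw [smul_smul, ← pow_succ', hzk])
        obtain ⟨w, hw, hwz⟩ := hG k (show (⟨_, hmem⟩ : ann {x} Z) ∈ G k N' from ⟨z, hz, rfl⟩)
        replace hwz : x ^ k • w = x ^ k • z := hwz
        have := ih (z - w) (N'.sub_mem hz (hN hw)) (by rw [smul_sub, hwz, sub_self])
        rw [← sub_add_cancel z w]
        exact N.add_mem this hw
    intro z hz
    obtain ⟨k, hk⟩ := h z
    exact this k z hz hk
  rw [← monotone_stabilizes_iff_artinian]
  intro F
  let N : ℕ → Submodule R Z := fun i => OrderDual.ofDual (F i)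
  have hN : ∀ i j, i ≤ j → N j ≤ N i := fun i j hij => F.monotone hij
  obtain ⟨-, ⟨⟨i₀, j₀⟩, rfl⟩, hmin⟩ := IsArtinian.set_has_minimal
    (Set.range fun t : ℕ × ℕ => G t.2 (N t.1)) ⟨_, ⟨(0, 0), rfl⟩⟩
  have hmin' : ∀ i j, i₀ ≤ i → j₀ ≤ j → G j (N i) = G j₀ (N i₀) := by
    intro i j hi hj
    refine eq_of_le_of_not_lt ?_ (hmin _ ⟨(i, j), rfl⟩)
    exact (G_mono j (hN _ _ hi)).trans (G_anti _ _ _ hj)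
  have hst : ∀ j, ∃ i, ∀ i', i ≤ i' → G j (N i) = G j (N i') := fun j =>
    IsArtinian.monotone_stabilizes ⟨fun i => OrderDual.toDual (G j (N i)),
      fun i i' hi => G_mono j (hN _ _ hi)⟩
  choose f hf using hst
  refine ⟨max i₀ ((Finset.range j₀).sup f), fun m hm => ?_⟩
  refine le_antisymm (α := Submodule R Z) (key _ _ (hN _ _ hm) fun j => ?_) (hN _ _ hm)
  by_cases hj : j < j₀
  · have h1 : f j ≤ max i₀ ((Finset.range j₀).sup f) :=
      (Finset.le_sup (Finset.mem_range.2 hj)).trans (le_max_right _ _)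
    exact ((hf j _ h1).symm.trans (hf j _ (h1.trans hm))).le
  · rw [not_lt] at hj
    exact ((hmin' _ j (le_max_left _ _) hj).trans
      (hmin' m j ((le_max_left _ _).trans hm) hj).symm).le

lemma Cof.of_ann {s : Set R} {x : R} (hx : x ∈ s) {Z : Type} [AddCommGroup Z] [Module R Z]
    (h : ∀ z : Z, ∃ n : ℕ, x ^ n • z = 0) (h' : Cof s (ann {x} Z)) : Cof s Z := by
  have := h'.1
  rw [← Set.insert_eq_of_mem hx]
  exact cof_insert.2 ⟨isArtinian_of_ann x Z h, h'⟩

variable [IsNoetherianRing R]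

lemma isArtinian_quot_prime (p : Ideal R) (h : Module.supportDim R (R ⧸ p) ≤ (0 : ℕ)) :
    IsArtinian R (R ⧸ p) := by
  rw [Module.supportDim_quotient_eq_ringKrullDim] at h
  have : Ring.KrullDimLE 0 (R ⧸ p) := Ring.krullDimLE_iff.2 h
  have : IsArtinianRing (R ⧸ p) := IsNoetherianRing.isArtinianRing_of_krullDimLE_zero
  exact isArtinian_of_surjective_algebraMap (M := R ⧸ p) (R := R ⧸ p) (S := R)
    Ideal.Quotient.mk_surjective

/-- The top local cohomology module is Artinian and cofinite. -/
theorem cof_top (a : Ideal R) (d : ℕ) (N : Type) [AddCommGroup N] [Module R N]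
    [Module.Finite R N] (h : Module.supportDim R N ≤ d) : Cof (a : Set R) (H a d N) := by
  have hfg : a.FG := IsNoetherian.noetherian a
  induction d generalizing N with
  | zero =>
    induction ‹Module.Finite R N› using
      IsNoetherianRing.induction_on_isQuotientEquivQuotientPrime R with
    | subsingleton N =>
      have : Subsingleton (H a 0 N) := subsingleton_of_subsingleton a _
      exact Cof.of_subsingleton
    | quotient N p f =>
      rw [Module.supportDim_eq_of_equiv f] at h
      have := isArtinian_quot_prime p.asIdeal h
      refine Cof.of_injective (Z := R ⧸ p.asIdeal) (Cof.of_isNoetherian this inferInstance)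
        ((ev a (ModuleCat.of R (R ⧸ p.asIdeal))).comp (hequiv a 0 f).toLinearMap) ?_
      exact (ev_injective a _).comp (hequiv a 0 f).injective
    | exact N₁ N₂ N₃ f g hf hg hfg' h₁ h₃ =>
      have c₁ := h₁ ((Module.supportDim_le_of_injective f hf).trans h)
      have c₃ := h₃ ((Module.supportDim_le_of_surjective g hg).trans h)
      refine Cof.of_exact (c₁.of_surjective hfg (hmap a 0 f).rangeRestrict
        (LinearMap.surjective_rangeRestrict _)) c₃ (Submodule.subtype_injective _)
        (g := hmap a 0 g) ?_
      have := hmap_exact a 0 hf hg hfg'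
      intro z
      rw [this z]
      exact ⟨fun ⟨y, hy⟩ => ⟨⟨z, y, hy⟩, rfl⟩, fun ⟨y, hy⟩ => hy ▸ y.2⟩
  | succ d ih =>
    induction ‹Module.Finite R N› using
      IsNoetherianRing.induction_on_isQuotientEquivQuotientPrime R with
    | subsingleton N =>
      have : Subsingleton (H a (d+1) N) := subsingleton_of_subsingleton a _
      exact Cof.of_subsingleton
    | quotient N p f =>
      rw [Module.supportDim_eq_of_equiv f] at h
      refine Cof.of_injective (Z := H a (d+1) (R ⧸ p.asIdeal)) ?_
        (hequiv a (d+1) f).toLinearMap (hequiv a (d+1) f).injective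
      by_cases hap : a ≤ p.asIdeal
      · have := subsingleton_of_tors a d _ (tors_quot_eq_top hap)
        exact Cof.of_subsingleton
      · obtain ⟨x, hxa, hxp⟩ := SetLike.not_le_iff_exists.1 hap
        have hs : Cof (a : Set R) (H a d (QuotSMulTop x (R ⧸ p.asIdeal))) := by
          refine ih _ ?_
          rw [← ENat.WithBot.lt_add_one_iff]
          refine lt_of_add_lt_add_right (a := 1)
            ((supportDim_quot_prime_le p.asIdeal hxp).trans_lt ?_)
          refine h.trans_lt ?_
          exact_mod_cast Nat.lt_succ_self _
        obtain ⟨δ, -, h2⟩ := exists_connecting a d (smul_quot_prime_injective p.asIdeal hxp)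
          (Submodule.mkQ_surjective _) (exact_smul_mkQ x _)
        have hc := hs.of_surjective hfg δ.rangeRestrict (LinearMap.surjective_rangeRestrict _)
        refine Cof.of_ann hxa (fun z => ?_) (hc.of_injective
          (LinearMap.codRestrict (LinearMap.range δ) (Submodule.subtype _) fun z => ?_) ?_)
        · obtain ⟨n, hn⟩ := LC.torsion a _ _ z
          exact ⟨n, hn _ (Ideal.pow_mem_pow hxa n)⟩
        · exact (h2 z).1 ((hmap_smul_id a (d+1) x _).trans (mem_ann.1 z.2 x rfl))
        · exact fun z w hzw => Subtype.ext (congrArg (fun t => t.1) hzw)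
    | exact N₁ N₂ N₃ f g hf hg hfg' h₁ h₃ =>
      have c₁ := h₁ ((Module.supportDim_le_of_injective f hf).trans h)
      have c₃ := h₃ ((Module.supportDim_le_of_surjective g hg).trans h)
      refine Cof.of_exact (c₁.of_surjective hfg (hmap a (d+1) f).rangeRestrict
        (LinearMap.surjective_rangeRestrict _)) c₃ (Submodule.subtype_injective _)
        (g := hmap a (d+1) g) ?_
      have := hmap_exact a (d+1) hf hg hfg'
      intro z
      rw [this z]
      exact ⟨fun ⟨y, hy⟩ => ⟨⟨z, y, hy⟩, rfl⟩, fun ⟨y, hy⟩ => hy ▸ y.2⟩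

end
end LH

namespace LH

noncomputable section

variable {R : Type} [CommRing R]

lemma isMaximal_of_mem_support {X : Type} [AddCommGroup X] [Module R X] [IsArtinian R X]
    (p : PrimeSpectrum R) (hp : p ∈ Module.support R X) : p.asIdeal.IsMaximal := by
  obtain ⟨z, hz⟩ := Module.mem_support_iff_exists_annihilator.1 hp
  let f : R →ₗ[R] X := LinearMap.toSpanSingleton R X z
  have hle : LinearMap.ker f ≤ p.asIdeal := by
    intro r hr
    refine hz ?_
    rw [Submodule.mem_annihilator_span_singleton]
    exact hr
  have : IsArtinian R (R ⧸ LinearMap.ker f) :=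
    isArtinian_of_injective ((LinearMap.ker f).liftQ f le_rfl)
      (LinearMap.ker_eq_bot.1 (Submodule.ker_liftQ_eq_bot _ _ _ le_rfl))
  have : IsArtinian R (R ⧸ p.asIdeal) :=
    isArtinian_of_surjective _ (Submodule.factor hle) (Submodule.factor_surjective hle)
  have : IsArtinianRing (R ⧸ p.asIdeal) := isArtinian_of_tower R this
  exact Ideal.Quotient.maximal_of_isField _ (IsArtinianRing.isField_of_isDomain _)

lemma exists_ann_of_mem_support [IsNoetherianRing R] {X : Type} [AddCommGroup X] [Module R X]
    [IsArtinian R X] (p : PrimeSpectrum R) (hp : p ∈ Module.support R X) :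
    ∃ z : X, z ≠ 0 ∧ ∀ r ∈ p.asIdeal, r • z = 0 := by
  obtain ⟨z, hz⟩ := Module.mem_support_iff_exists_annihilator.1 hp
  have hmin : p.asIdeal ∈ (Module.annihilator R (Submodule.span R {z})).minimalPrimes := by
    refine ⟨⟨p.2, hz⟩, fun q hq hqp => ?_⟩
    have : (⟨q, hq.1⟩ : PrimeSpectrum R) ∈ Module.support R X :=
      Module.mem_support_iff_exists_annihilator.2 ⟨z, hq.2⟩
    exact ((isMaximal_of_mem_support _ this).eq_of_le p.2.ne_top hqp).ge
  have := Module.associatedPrimes.minimalPrimes_annihilator_subset_associatedPrimes R _ hmin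
  obtain ⟨-, w, hw⟩ := (isAssociatedPrime_iff).1 this
  have hw' : ∀ r : R, r ∈ p.asIdeal ↔ r • w = 0 := fun r => by
    rw [hw, Submodule.mem_colon_singleton, Submodule.mem_bot]
  refine ⟨w, fun h => ?_, fun r hr => congrArg Subtype.val ((hw' r).1 hr)⟩
  refine p.2.ne_top ((Ideal.eq_top_iff_one _).2 ((hw' 1).2 ?_))
  rw [one_smul]
  exact Subtype.ext h

/-- The intersection of the primes in the support. -/
def radSupp (R : Type) [CommRing R] (X : Type) [AddCommGroup X] [Module R X] : Ideal R :=
  ⨅ p ∈ Module.support R X, p.asIdeal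

section

variable {X : Type} [AddCommGroup X] [Module R X]

lemma radSupp_le (p : PrimeSpectrum R) (hp : p ∈ Module.support R X) :
    radSupp R X ≤ p.asIdeal := iInf₂_le p hp

lemma le_radSupp {a : Ideal R} (h : ∀ z : X, ∃ n, ∀ r ∈ a ^ n, r • z = 0) : a ≤ radSupp R X := by
  refine le_iInf₂ fun p hp => ?_
  obtain ⟨z, hz⟩ := Module.mem_support_iff_exists_annihilator.1 hp
  obtain ⟨n, hn⟩ := h z
  refine Ideal.IsPrime.le_of_pow_le (n := n) (le_trans (fun r hr => ?_) hz)
  rw [Submodule.mem_annihilator_span_singleton]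
  exact hn r hr

lemma radSupp_torsion [IsNoetherianRing R] (z : X) : ∃ n, ∀ r ∈ radSupp R X ^ n, r • z = 0 := by
  have h : radSupp R X ≤ (Submodule.span R {z}).annihilator.radical := by
    rw [Ideal.radical_eq_sInf]
    refine le_sInf fun q hq => ?_
    have := hq.2
    exact radSupp_le ⟨q, hq.2⟩ (Module.mem_support_iff_exists_annihilator.2 ⟨z, hq.1⟩)
  obtain ⟨n, hn⟩ := Ideal.exists_pow_le_of_le_radical_of_fg h (IsNoetherian.noetherian _)
  refine ⟨n, fun r hr => ?_⟩
  have := hn hr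
  rwa [Submodule.mem_annihilator_span_singleton] at this

lemma finite_support [IsNoetherianRing R] [IsArtinian R X] : (Module.support R X).Finite := by
  classical
  let f : Module.support R X → Submodule R X := fun p => ann (p.1.asIdeal : Set R) X
  have hind : iSupIndep f := by
    rw [iSupIndep_iff_supIndep]
    intro s
    refine Submodule.supIndep_torsionBySet_ideal (p := fun q : Module.support R X => q.1.asIdeal) ?_
    intro p _ q _ hpq
    exact (isMaximal_of_mem_support p.1 p.2).coprime_of_ne (isMaximal_of_mem_support q.1 q.2)
      fun h => hpq (Subtype.ext (PrimeSpectrum.ext h))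
  refine Set.finite_coe_iff.1 (WellFoundedLT.finite_of_iSupIndep hind fun p hp => ?_)
  obtain ⟨z, hz, h⟩ := exists_ann_of_mem_support p.1 p.2
  have : z ∈ f p := mem_ann.2 h
  rw [hp] at this
  exact hz this

lemma isArtinianRing_quot_radSupp [IsNoetherianRing R] [IsArtinian R X] :
    IsArtinianRing (R ⧸ radSupp R X) := by
  have hfin := finite_support (R := R) (X := X)
  have := hfin.to_subtype
  let f : R →ₗ[R] ((p : Module.support R X) → R ⧸ p.1.asIdeal) :=
    LinearMap.pi fun p => Submodule.mkQ _
  have hf : LinearMap.ker f = radSupp R X := by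
    ext r
    rw [radSupp, Ideal.mem_iInf]
    constructor
    · intro hr p
      rw [Ideal.mem_iInf]
      intro hp
      exact (Submodule.Quotient.mk_eq_zero _).1 (congrFun hr ⟨p, hp⟩)
    · intro hr
      ext p
      exact (Submodule.Quotient.mk_eq_zero _).2 ((Ideal.mem_iInf.1 (hr p.1)) p.2)
  have : ∀ p : Module.support R X, IsArtinian R (R ⧸ p.1.asIdeal) := fun p => by
    have := isMaximal_of_mem_support p.1 p.2
    let := Ideal.Quotient.field p.1.asIdeal
    exact isArtinian_of_surjective_algebraMap (M := R ⧸ p.1.asIdeal) (R := R ⧸ p.1.asIdeal)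
      (S := R) Ideal.Quotient.mk_surjective
  have : IsArtinian R (R ⧸ radSupp R X) :=
    isArtinian_of_injective ((radSupp R X).liftQ f hf.ge)
      (LinearMap.ker_eq_bot.1 (Submodule.ker_liftQ_eq_bot _ _ _ hf.le))
  exact isArtinian_of_tower R this

lemma isRadical_radSupp : (radSupp R X).IsRadical := by
  refine Ideal.isRadical_iInf _ fun p => Ideal.isRadical_iInf _ fun _ => p.2.isRadical

lemma isSemisimpleRing_quot_radSupp [IsNoetherianRing R] [IsArtinian R X] :
    IsSemisimpleRing (R ⧸ radSupp R X) := by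
  have := isArtinianRing_quot_radSupp (R := R) (X := X)
  have := (Ideal.isRadical_iff_quotient_reduced _).1 (isRadical_radSupp (R := R) (X := X))
  exact IsArtinianRing.isSemisimpleRing_of_isReduced _

end

end
end LH

namespace LH

noncomputable section

variable {R : Type} [CommRing R]

lemma tors_anti {b c : Ideal R} (h : b ≤ c) (N : Type) [AddCommGroup N] [Module R N] :
    tors c N ≤ tors b N := by
  rintro z ⟨n, hn⟩
  exact ⟨n, fun r hr => hn r (Ideal.pow_right_mono h n hr)⟩

lemma mem_tors_sup {b : Ideal R} {x : R} {N : Type} [AddCommGroup N] [Module R N] {z : N}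
    (h : z ∈ tors b N) {n : ℕ} (hx : x ^ n • z = 0) : z ∈ tors (b ⊔ Ideal.span {x}) N := by
  obtain ⟨m, hm⟩ := h
  refine ⟨m + n, fun r hr => ?_⟩
  obtain ⟨s, hs, t, ht, rfl⟩ := Submodule.mem_sup.1 (Ideal.sup_pow_add_le_pow_sup_pow hr)
  rw [Ideal.span_singleton_pow, Ideal.mem_span_singleton'] at ht
  obtain ⟨t, rfl⟩ := ht
  rw [add_smul, hm s hs, mul_smul, hx, smul_zero, add_zero]

/-- In an injective module over a Noetherian ring, division by `x ^ k` is possible up to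
multiplication by a power of `x`. -/
lemma exists_pow_smul_eq_pow_smul [IsNoetherianRing R] (I : Type) [AddCommGroup I] [Module R I]
    [hI : Module.Injective R I] (x : R) (k : ℕ) (η : I) :
    ∃ n, ∃ e : I, x ^ (n + k) • e = x ^ n • η := by
  obtain ⟨n, hn⟩ := monotone_stabilizes_iff_noetherian.2 (inferInstanceAs (IsNoetherian R R))
    ⟨fun n => LinearMap.ker (x ^ n • LinearMap.id : R →ₗ[R] R), fun i j hij r hr => by
      have hr' : x ^ i * r = 0 := hr
      change x ^ j * r = 0
      rw [← Nat.sub_add_cancel hij, pow_add, mul_assoc, hr', mul_zero]⟩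
  have hk := hn (n + k) (Nat.le_add_right _ _)
  let φ : R →ₗ[R] R := x ^ (n + k) • LinearMap.id
  let f : (R ⧸ LinearMap.ker φ) →ₗ[R] R := Submodule.liftQ _ φ le_rfl
  let g : (R ⧸ LinearMap.ker φ) →ₗ[R] I :=
    Submodule.liftQ _ (LinearMap.toSpanSingleton R I (x ^ n • η)) (by
      intro r hr
      have : r ∈ LinearMap.ker (x ^ n • LinearMap.id : R →ₗ[R] R) := hk.ge hr
      have h2 : x ^ n * r = 0 := this
      change r • x ^ n • η = 0
      rw [smul_smul, mul_comm, h2, zero_smul])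
  obtain ⟨h, hh⟩ := hI.out f (LinearMap.ker_eq_bot.1 (Submodule.ker_liftQ_eq_bot _ _ _ le_rfl)) g
  refine ⟨n, h 1, ?_⟩
  have := hh (Submodule.Quotient.mk 1)
  have hf : f (Submodule.Quotient.mk 1) = x ^ (n + k) • (1 : R) := rfl
  have hg : g (Submodule.Quotient.mk 1) = (1 : R) • x ^ n • η := rfl
  rw [← map_smul, ← hf, this, hg, one_smul]

section

variable {E Q : Type} [AddCommGroup E] [Module R E] [AddCommGroup Q] [Module R Q]
  (π : E →ₗ[R] Q)

lemma exists_lift_step [IsNoetherianRing R] [Module.Injective R E] (b : Ideal R) (x : R)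
    (ζ : tors b Q) (k : ℕ) (hk : ∃ e ∈ tors b E, π e = x ^ k • (ζ : Q)) :
    ∃ ζ' ∈ tors (b ⊔ Ideal.span {x}) Q, ∃ e ∈ tors b E, π e = (ζ : Q) - ζ' := by
  obtain ⟨η, hη, hηζ⟩ := hk
  have := tors_injective b E
  obtain ⟨n, e, he⟩ := exists_pow_smul_eq_pow_smul (tors b E) x k ⟨η, hη⟩
  replace he : x ^ (n + k) • (e : E) = x ^ n • η := congrArg Subtype.val he
  have hπe : π e ∈ tors b Q := by
    obtain ⟨m, hm⟩ := e.2
    exact ⟨m, fun r hr => by rw [← map_smul, hm r hr, map_zero]⟩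
  refine ⟨ζ - π e, mem_tors_sup (n := n + k) (Submodule.sub_mem _ ζ.2 hπe) ?_, e, e.2, by abel⟩
  rw [smul_sub, ← map_smul, he, map_smul, hηζ, smul_smul, pow_add, sub_self]

end

lemma exists_one_sub_smul_eq_zero {Z : Type} [AddCommGroup Z] [Module R Z] [IsArtinian R Z]
    [IsNoetherianRing R] (J : Ideal R) (z : Z) :
    ∃ n, ∃ r ∈ J, ∀ t ∈ J ^ n, (1 - r) • t • z = 0 := by
  obtain ⟨n, hn⟩ := IsArtinian.monotone_stabilizes (R := R) (M := Z)
    ⟨fun n => OrderDual.toDual (J ^ n • Submodule.span R {z}), fun i j hij =>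
      Submodule.smul_mono_left (Ideal.pow_le_pow_right hij)⟩
  have h : J ^ n • Submodule.span R {z} = J ^ (n+1) • Submodule.span R {z} :=
    hn (n+1) n.le_succ
  have hfg : (J ^ n • Submodule.span R {z}).FG :=
    Submodule.FG.smul (IsNoetherian.noetherian _) (Submodule.fg_span_singleton z)
  obtain ⟨r, hr, hr'⟩ := Submodule.exists_sub_one_mem_and_smul_eq_zero_of_fg_of_le_smul J _ hfg (by
    rw [← Submodule.mul_smul, ← pow_succ']; exact h.le)
  refine ⟨n, 1 - r, ?_, fun t ht => ?_⟩
  · rw [← neg_sub]; exact J.neg_mem hr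
  · rw [sub_sub_cancel]
    exact hr' _ (Submodule.smul_mem_smul ht (Submodule.mem_span_singleton_self z))

theorem exists_surjective_of_torsion [IsNoetherianRing R] (a J : Ideal R) (ha : a ≤ J) (d : ℕ)
    (N : Type) [AddCommGroup N] [Module R N] [Module.Finite R N]
    (hd : Module.supportDim R N ≤ d)
    (hX : ∀ z : H a d N, ∃ n, ∀ r ∈ J ^ n, r • z = 0) :
    ∃ f : H J d N →ₗ[R] H a d N, Function.Surjective f := by
  obtain ⟨E, Q, hE, π, hΦ⟩ := exists_gammaModel d (ModuleCat.of R N)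
  have : Module.Injective R E := Module.injective_module_of_injective_object R E
  choose Φ hsurj hker using hΦ
  have heq : ∀ b c : Ideal R, b ≤ c → ∀ q q' : tors c Q, Φ c q = Φ c q' → ∀ (t t' : tors b Q),
      (t : Q) = q → (t' : Q) = q' → Φ b t = Φ b t' := by
    intro b c hbc q q' h t t' ht ht'
    rw [← sub_eq_zero, ← map_sub, hker] at h ⊢
    obtain ⟨e, he, he'⟩ := h
    refine ⟨e, tors_anti hbc _ he, ?_⟩
    rw [he']
    simp [ht, ht']
  let P : Ideal R → Prop := fun c => ∀ ε : H a d N, ∃ (ζ : tors c Q) (h : (ζ : Q) ∈ tors a Q),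
    Φ a ⟨ζ, h⟩ = ε ∧ ∃ n, ∀ r ∈ J ^ n, r • Φ c ζ = 0
  have hPa : P a := by
    intro ε
    obtain ⟨ζ, rfl⟩ := hsurj a ε
    exact ⟨ζ, ζ.2, rfl, hX _⟩
  have hstep : ∀ c, a ≤ c → ∀ x ∈ J, P c → P (c ⊔ Ideal.span {x}) := by
    intro c hac x hx hP ε
    obtain ⟨ζ, hζ, hζε, n, hn⟩ := hP ε
    have hk := hn _ (Ideal.pow_mem_pow hx n)
    rw [← map_smul, hker] at hk
    obtain ⟨ζ', hζ', e, he, heζ⟩ := exists_lift_step π c x ζ n hk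
    have hζa : ζ' ∈ tors a Q := tors_anti (hac.trans le_sup_left) Q hζ'
    have h1 : Φ a ⟨ζ', hζa⟩ = ε := by
      rw [← hζε, eq_comm, ← sub_eq_zero, ← map_sub, hker]
      exact ⟨e, tors_anti hac _ he, heζ⟩
    have := (cof_top (c ⊔ Ideal.span {x}) d N hd).1
    obtain ⟨m, r, hr, hrm⟩ := exists_one_sub_smul_eq_zero J (Φ (c ⊔ Ideal.span {x}) ⟨ζ', hζ'⟩)
    obtain ⟨k, hk⟩ := hX ε
    obtain ⟨s, hs⟩ := sub_dvd_pow_sub_pow 1 r k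
    rw [one_pow] at hs
    refine ⟨s • (1 - r) • ⟨ζ', hζ'⟩, Submodule.smul_mem _ _ (Submodule.smul_mem _ _ hζa), ?_,
      m, fun t ht => ?_⟩
    · have : Φ a (s • (1 - r) • ⟨ζ', hζa⟩) = ε := by
        rw [map_smul, map_smul, h1, smul_smul, mul_comm, ← hs, sub_smul, one_smul,
          hk _ (Ideal.pow_mem_pow hr k), sub_zero]
      exact this
    · rw [map_smul, map_smul, smul_comm, smul_comm t, hrm t ht, smul_zero]
  have hPJ : P J := by
    obtain ⟨s, hs⟩ : J.FG := IsNoetherian.noetherian J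
    have hall : ∀ t : Finset R, (t : Set R) ⊆ J → P (a ⊔ Ideal.span (t : Set R)) := by
      classical
      intro t
      induction t using Finset.induction_on with
      | empty =>
        intro _
        simpa using hPa
      | insert x t _ ih =>
        intro ht
        rw [Finset.coe_insert, Set.insert_subset_iff] at ht
        have := hstep _ le_sup_left x ht.1 (ih ht.2)
        rwa [sup_assoc, sup_comm (Ideal.span (t : Set R)), ← Ideal.span_insert,
          ← Finset.coe_insert] at this
    have := hall s (hs ▸ Ideal.subset_span)
    rwa [show Ideal.span (s : Set R) = J from hs, sup_eq_right.2 ha] at this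
  let f : (tors J Q ⧸ LinearMap.ker (Φ J)) →ₗ[R] H a d N :=
    Submodule.liftQ _ ((Φ a).comp (Submodule.inclusion (tors_anti ha Q))) (by
      intro q hq
      rw [LinearMap.mem_ker, hker] at hq
      obtain ⟨e, he, he'⟩ := hq
      exact (hker a _).2 ⟨e, tors_anti ha _ he, he'⟩)
  refine ⟨f.comp ((Φ J).quotKerEquivOfSurjective (hsurj J)).symm.toLinearMap, fun ε => ?_⟩
  obtain ⟨ζ, h, hζ, -⟩ := hPJ ε
  refine ⟨(Φ J).quotKerEquivOfSurjective (hsurj J) (Submodule.Quotient.mk ζ), ?_⟩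
  rw [LinearMap.comp_apply, LinearEquiv.coe_coe, LinearEquiv.symm_apply_apply]
  exact hζ

theorem subsingleton_of_iSup_stab [IsNoetherianRing R] (a J : Ideal R) (ha : a ≤ J) (d : ℕ)
    (N : Type) [AddCommGroup N] [Module R N] [Module.Finite R N]
    (hd : Module.supportDim R N ≤ d)
    (hX : ∀ z : H a d N, ∃ n, ∀ r ∈ J ^ n, r • z = 0)
    (h : ⨆ n : ℕ, stab J (ann ((a ^ n : Ideal R) : Set R) (H J d N)) = ⊤) :
    Subsingleton (H a d N) := by
  obtain ⟨f, hf⟩ := exists_surjective_of_torsion a J ha d N hd hX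
  have hc := cof_top a d N hd
  have key : ∀ n : ℕ, stab J (ann ((a ^ n : Ideal R) : Set R) (H a d N)) = ⊥ := by
    intro n
    have := hc.noetherian_pow (IsNoetherian.noetherian a) n
    obtain ⟨k, hk⟩ := exists_pow_smul_eq_zero J (ann ((a ^ n : Ideal R) : Set R) (H a d N))
      (fun x => by
        obtain ⟨m, hm⟩ := hX x
        exact ⟨m, fun r hr => Subtype.ext (hm r hr)⟩)
    rw [eq_bot_iff]
    refine (iInf_le _ k).trans (Submodule.smul_le.2 fun r hr x hx => ?_)
    exact congrArg Subtype.val (hk r hr ⟨x, hx⟩)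
  have h2 : (⊤ : Submodule R (H J d N)).map f ≤ ⊥ := by
    rw [← h, Submodule.map_iSup]
    refine iSup_le fun n => ?_
    rw [← key n]
    refine le_iInf fun k => ?_
    refine (Submodule.map_mono (iInf_le _ k)).trans ?_
    rw [Submodule.map_smul'']
    refine Submodule.smul_mono le_rfl ?_
    rintro _ ⟨x, hx, rfl⟩
    exact mem_ann.2 fun r hr => by rw [← map_smul, mem_ann.1 hx r hr, map_zero]
  rw [Submodule.map_top, LinearMap.range_eq_top.2 hf] at h2
  exact (Submodule.subsingleton_iff R).1 (subsingleton_of_bot_eq_top (le_bot_iff.1 h2).symm)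

end
end LH

namespace LH

noncomputable section

open scoped Pointwise

variable {R : Type} [CommRing R]

lemma supportDim_quot_le {N : Type} [AddCommGroup N] [Module R N] [Module.Finite R N]
    {p : PrimeSpectrum R} (hp : p ∈ Module.support R N) :
    Module.supportDim R (R ⧸ p.asIdeal) ≤ Module.supportDim R N := by
  rw [Module.supportDim_quotient_eq_ringKrullDim,
    Module.supportDim_eq_ringKrullDim_quotient_annihilator]
  exact ringKrullDim_le_of_surjective
    (Ideal.Quotient.factor (Module.annihilator_le_of_mem_support hp))
    (Ideal.Quotient.factor_surjective _)

lemma supportDim_quot_prime_le_of_le [IsNoetherianRing R] {p : Ideal R} [p.IsPrime] {x : R}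
    (hx : x ∉ p) {I : Ideal R} (hpI : p ≤ I) (hxI : x ∈ I) :
    Module.supportDim R (R ⧸ I) + 1 ≤ Module.supportDim R (R ⧸ p) := by
  refine le_trans (add_le_add_left ?_ 1) (supportDim_quot_prime_le p hx)
  refine Module.supportDim_le_of_surjective
    (Submodule.liftQ _ (Submodule.factor hpI) ?_) ?_
  · intro y hy
    obtain ⟨z, -, rfl⟩ := Submodule.mem_smul_pointwise_iff_exists _ _ _ |>.1 hy
    obtain ⟨z, rfl⟩ := Ideal.Quotient.mk_surjective z
    rw [LinearMap.mem_ker]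
    change Ideal.Quotient.mk I (x * z) = 0
    exact Ideal.Quotient.eq_zero_iff_mem.2 (I.mul_mem_right _ hxI)
  · intro y
    obtain ⟨y, rfl⟩ := Ideal.Quotient.mk_surjective y
    exact ⟨Submodule.Quotient.mk (Ideal.Quotient.mk p y), rfl⟩

lemma eq_of_supportDim_eq [IsNoetherianRing R] {p q : Ideal R} [q.IsPrime] {d : ℕ}
    (hqp : q ≤ p) (hp : Module.supportDim R (R ⧸ p) = d)
    (hq : Module.supportDim R (R ⧸ q) ≤ d) : q = p := by
  refine le_antisymm hqp fun x hx => by_contra fun hxq => ?_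
  have := (supportDim_quot_prime_le_of_le hxq hqp hx).trans hq
  rw [hp] at this
  exact absurd this (by exact_mod_cast (Nat.lt_succ_self d).not_ge)

lemma exists_mem_support_nontrivial [IsNoetherianRing R] (a : Ideal R) (i : ℕ) (N : Type)
    [AddCommGroup N] [Module R N] [Module.Finite R N] (h : Nontrivial (H a i N)) :
    ∃ p ∈ Module.support R N, Nontrivial (H a i (R ⧸ p.asIdeal)) := by
  induction ‹Module.Finite R N› using
      IsNoetherianRing.induction_on_isQuotientEquivQuotientPrime R with
  | subsingleton N =>
    exact absurd h (not_nontrivial_iff_subsingleton.2 (subsingleton_of_subsingleton a i))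
  | quotient N p f =>
    refine ⟨p, ?_, (hequiv a i f).symm.toEquiv.nontrivial⟩
    rw [LinearEquiv.support_eq f, Module.mem_support_iff_of_finite, Ideal.annihilator_quotient]
  | exact N₁ N₂ N₃ f g hf hg hfg h₁ h₃ =>
    by_cases h1 : Nontrivial (H a i N₁)
    · obtain ⟨p, hp, h⟩ := h₁ h1
      exact ⟨p, Module.support_subset_of_injective f hf hp, h⟩
    by_cases h3 : Nontrivial (H a i N₃)
    · obtain ⟨p, hp, h⟩ := h₃ h3
      exact ⟨p, Module.support_subset_of_surjective g hg hp, h⟩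
    rw [not_nontrivial_iff_subsingleton] at h1 h3
    exact absurd h (not_nontrivial_iff_subsingleton.2 (subsingleton_of_exact a i hf hg hfg))

theorem exists_mem_associatedPrimes_nontrivial [IsNoetherianRing R] (a : Ideal R) (d : ℕ)
    (N : Type) [AddCommGroup N] [Module R N] [Module.Finite R N]
    (hd : Module.supportDim R N ≤ d) (h : Nontrivial (H a d N)) :
    ∃ p ∈ associatedPrimes R N, Module.supportDim R (R ⧸ p) = d ∧
      Nontrivial (H a d (R ⧸ p)) := by
  obtain ⟨p, hp, hn⟩ := exists_mem_support_nontrivial a d N h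
  have hpd : Module.supportDim R (R ⧸ p.asIdeal) = d := by
    refine le_antisymm ((supportDim_quot_le hp).trans hd) (not_lt.1 fun hlt => ?_)
    exact absurd hn (not_nontrivial_iff_subsingleton.2 (subsingleton_of_supportDim_lt a d _ hlt))
  refine ⟨p.asIdeal, ?_, hpd, hn⟩
  refine Module.associatedPrimes.minimalPrimes_annihilator_subset_associatedPrimes R N
    ⟨⟨p.2, Module.annihilator_le_of_mem_support hp⟩, fun q hq hqp => ?_⟩
  have := hq.1
  have hqs : (⟨q, hq.1⟩ : PrimeSpectrum R) ∈ Module.support R N :=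
    Module.mem_support_iff_of_finite.2 hq.2
  exact (eq_of_supportDim_eq hqp hpd ((supportDim_quot_le hqs).trans hd)).ge

/-- A finite module supported at `p`, of dimension at most `dim R/p`, has a nonzero map to
`R/p`. -/
lemma exists_map_quot_prime [IsNoetherianRing R] {N : Type} [AddCommGroup N] [Module R N]
    [Module.Finite R N] {d : ℕ} (hd : Module.supportDim R N ≤ d) {p : PrimeSpectrum R}
    (hp : p ∈ Module.support R N) (hpd : Module.supportDim R (R ⧸ p.asIdeal) = d) :
    ∃ (φ : N →ₗ[R] R ⧸ p.asIdeal) (s : R), s ∉ p.asIdeal ∧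
      Ideal.Quotient.mk p.asIdeal s ∈ LinearMap.range φ := by
  obtain ⟨K, hK, hmax⟩ := set_has_maximal_iff_noetherian.2 (inferInstanceAs (IsNoetherian R N))
    {K : Submodule R N | p ∈ Module.support R (N ⧸ K)}
    ⟨⊥, Module.support_subset_of_surjective (Submodule.quotEquivOfEqBot ⊥ rfl).toLinearMap
      (Submodule.quotEquivOfEqBot ⊥ rfl).surjective hp⟩
  have : Nontrivial (N ⧸ K) := Module.nonempty_support_iff.1 ⟨p, hK⟩
  obtain ⟨q, hq⟩ := associatedPrimes.nonempty R (N ⧸ K)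
  obtain ⟨hqp, f, hf⟩ := (isAssociatedPrime_iff_exists_injective_linearMap q _).1 hq
  let L := LinearMap.range f
  have hL : p ∉ Module.support R ((N ⧸ K) ⧸ L) := by
    intro hpL
    have h1 : p ∈ Module.support R (N ⧸ L.comap K.mkQ) :=
      Module.support_subset_of_surjective (Submodule.mapQ _ _ K.mkQ le_rfl)
        (fun y => by
          obtain ⟨y, rfl⟩ := Submodule.mkQ_surjective _ y
          obtain ⟨y, rfl⟩ := Submodule.mkQ_surjective _ y
          exact ⟨Submodule.Quotient.mk y, rfl⟩) hpL
    refine hmax _ h1 (lt_of_le_of_ne ?_ ?_)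
    · intro x hx
      rw [Submodule.mem_comap, Submodule.mkQ_apply, (Submodule.Quotient.mk_eq_zero K).2 hx]
      exact zero_mem _
    · intro he
      have h2 : f 1 = 0 := by
        obtain ⟨y, hy⟩ := Submodule.mkQ_surjective K (f 1)
        have : y ∈ K := by
          rw [he, Submodule.mem_comap, hy]
          exact ⟨1, rfl⟩
        rw [← hy, Submodule.mkQ_apply, (Submodule.Quotient.mk_eq_zero K).2 this]
      have : (Ideal.Quotient.mk q 1) = 0 := hf (h2.trans (map_zero f).symm)
      rw [Ideal.Quotient.eq_zero_iff_mem] at this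
      exact hqp.ne_top ((Ideal.eq_top_iff_one _).2 this)
  have hqle : q ≤ p.asIdeal := by
    have := Module.support_of_exact (f := f) (g := L.mkQ)
      (LinearMap.exact_iff.2 (Submodule.ker_mkQ _)) hf (Submodule.mkQ_surjective _)
    have h3 : p ∈ Module.support R (N ⧸ K) := hK
    rw [this] at h3
    have h4 := h3.resolve_right hL
    rwa [Module.mem_support_iff_of_finite, Ideal.annihilator_quotient] at h4
  have hqN : (⟨q, hqp⟩ : PrimeSpectrum R) ∈ Module.support R N := by
    refine Module.support_subset_of_surjective _ (Submodule.mkQ_surjective K)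
      (Module.support_subset_of_injective f hf ?_)
    rw [Module.mem_support_iff_of_finite, Ideal.annihilator_quotient]
  obtain rfl : q = p.asIdeal :=
    eq_of_supportDim_eq hqle hpd ((supportDim_quot_le hqN).trans hd)
  rw [Module.mem_support_iff_of_finite] at hL
  obtain ⟨s, hs, hsp⟩ := SetLike.not_le_iff_exists.1 hL
  have hsL : ∀ x : N ⧸ K, s • x ∈ L := fun x => by
    rw [← Submodule.Quotient.mk_eq_zero, Submodule.Quotient.mk_smul]
    exact Module.mem_annihilator.1 hs _
  let ψ : (N ⧸ K) →ₗ[R] L := LinearMap.codRestrict L (s • LinearMap.id) hsL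
  refine ⟨((LinearEquiv.ofInjective f hf).symm.toLinearMap.comp ψ).comp K.mkQ, s, hsp, ?_⟩
  obtain ⟨y, hy⟩ := Submodule.mkQ_surjective K (f 1)
  refine ⟨y, ?_⟩
  rw [LinearMap.comp_apply, hy, LinearMap.comp_apply, LinearEquiv.coe_coe,
    LinearEquiv.symm_apply_eq]
  refine Subtype.ext ?_
  change s • f 1 = f (Ideal.Quotient.mk p.asIdeal s)
  rw [← map_smul]
  congr 1
  change Ideal.Quotient.mk p.asIdeal (s * 1) = _
  rw [mul_one]

theorem subsingleton_quot_prime [IsNoetherianRing R] (a : Ideal R) {N : Type} [AddCommGroup N]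
    [Module R N] [Module.Finite R N] {d : ℕ} (hd : Module.supportDim R N ≤ d)
    {p : PrimeSpectrum R} (hp : p ∈ Module.support R N)
    (hpd : Module.supportDim R (R ⧸ p.asIdeal) = d) [Subsingleton (H a d N)] :
    Subsingleton (H a d (R ⧸ p.asIdeal)) := by
  obtain ⟨φ, s, hs, hsφ⟩ := exists_map_quot_prime hd hp hpd
  have h1 : Subsingleton (H a (d+1) (LinearMap.ker φ)) := by
    refine subsingleton_of_supportDim_lt a (d+1) _ ?_
    refine ((Module.supportDim_le_of_injective _ (Submodule.injective_subtype _)).trans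
      hd).trans_lt ?_
    exact_mod_cast Nat.lt_succ_self d
  have h2 : Subsingleton (H a d (LinearMap.range φ)) :=
    subsingleton_of_exact_right a d (Submodule.injective_subtype (LinearMap.ker φ))
      φ.surjective_rangeRestrict (by
        rw [LinearMap.exact_iff, LinearMap.ker_rangeRestrict, Submodule.range_subtype])
  have h3 : Subsingleton (H a d ((R ⧸ p.asIdeal) ⧸ LinearMap.range φ)) := by
    refine subsingleton_of_supportDim_lt a d _ ?_
    have h4 := (supportDim_quot_prime_le p.asIdeal hs).trans hpd.le
    have h5 : Module.supportDim R (QuotSMulTop s (R ⧸ p.asIdeal)) < d :=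
      lt_of_add_lt_add_right (a := 1) (h4.trans_lt (by exact_mod_cast Nat.lt_succ_self d))
    refine lt_of_le_of_lt ?_ h5
    have hle : s • (⊤ : Submodule R (R ⧸ p.asIdeal)) ≤ LinearMap.range φ := by
      intro y hy
      obtain ⟨z, -, rfl⟩ := Submodule.mem_smul_pointwise_iff_exists _ _ _ |>.1 hy
      obtain ⟨z, rfl⟩ := Ideal.Quotient.mk_surjective z
      have := Submodule.smul_mem _ z hsφ
      rwa [show z • Ideal.Quotient.mk p.asIdeal s = s • Ideal.Quotient.mk p.asIdeal z from
        congrArg (Ideal.Quotient.mk p.asIdeal) (mul_comm z s)] at this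
    exact Module.supportDim_le_of_surjective (Submodule.factor hle)
      (Submodule.factor_surjective hle)
  exact subsingleton_of_exact a d (Submodule.injective_subtype (LinearMap.range φ))
    (Submodule.mkQ_surjective _)
    (by rw [LinearMap.exact_iff, Submodule.ker_mkQ, Submodule.range_subtype])

lemma cohDim_lt_iff [IsNoetherianRing R] (a : Ideal R) {N : Type} [AddCommGroup N]
    [Module R N] [Module.Finite R N] {d : ℕ} (hd : Module.supportDim R N ≤ d) :
    cohDim R a N < (d : WithBot ℕ∞) ↔ Subsingleton (H a d N) := by
  have e := fun i => topLCEquiv a i N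
  constructor
  · intro h
    by_contra hn
    rw [not_subsingleton_iff_nontrivial] at hn
    have : ((d : ℕ) : WithBot ℕ∞) ≤ cohDim R a N :=
      le_sSup ⟨d, rfl, (e d).symm.toEquiv.nontrivial⟩
    exact absurd h this.not_gt
  · intro h
    have key : ∀ i : ℕ, Nontrivial (TopLC R a i N) → i < d := by
      intro i hi
      have hi' : Nontrivial (H a i N) := (e i).toEquiv.nontrivial
      by_contra hid
      rcases (not_lt.1 hid).eq_or_lt with rfl | hlt
      · exact absurd h (not_subsingleton_iff_nontrivial.2 hi')
      · refine absurd hi' (not_nontrivial_iff_subsingleton.2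
          (subsingleton_of_supportDim_lt a i N (hd.trans_lt ?_)))
        exact_mod_cast hlt
    cases d with
    | zero =>
      rw [cohDim, show {n : WithBot ℕ∞ | ∃ i : ℕ, n = (i : ℕ) ∧ Nontrivial (TopLC R a i N)} = ∅
        from Set.eq_empty_of_forall_notMem fun n ⟨i, _, hi⟩ =>
          absurd (key i hi) (Nat.not_lt_zero i),
        sSup_empty]
      exact WithBot.bot_lt_coe _
    | succ d =>
      refine lt_of_le_of_lt (b := ((d : ℕ) : WithBot ℕ∞)) (sSup_le ?_)
        (by exact_mod_cast Nat.lt_succ_self d)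
      rintro _ ⟨i, rfl, hi⟩
      exact_mod_cast Nat.le_of_lt_succ (key i hi)

theorem subsingleton_iff_cohDim [IsNoetherianRing R] (a : Ideal R) (N : Type) [AddCommGroup N]
    [Module R N] [Module.Finite R N] {d : ℕ} (hd : moduleDim R N = (d : WithBot ℕ∞)) :
    Subsingleton (H a d N) ↔ ∀ p ∈ Assh R N, cohDim R a (R ⧸ p) < (d : WithBot ℕ∞) := by
  have hd' : Module.supportDim R N ≤ d := hd.le
  constructor
  · rintro h p ⟨hp, hpd⟩
    have := hp.isPrime
    rw [hd, ← Module.supportDim_quotient_eq_ringKrullDim] at hpd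
    rw [cohDim_lt_iff a hpd.le]
    refine subsingleton_quot_prime (p := ⟨p, this⟩) a hd' ?_ hpd
    rw [Module.mem_support_iff_of_finite, ← Submodule.annihilator_top]
    exact IsAssociatedPrime.annihilator_le hp
  · intro h
    by_contra hn
    rw [not_subsingleton_iff_nontrivial] at hn
    obtain ⟨p, hp, hpd, hpn⟩ := exists_mem_associatedPrimes_nontrivial a d N hd' hn
    have := h p ⟨hp, by rw [hd, ← hpd, Module.supportDim_quotient_eq_ringKrullDim]⟩
    rw [cohDim_lt_iff a hpd.le] at this
    exact absurd this (not_subsingleton_iff_nontrivial.2 hpn)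

end
end LH

namespace LH

noncomputable section

open scoped Pointwise

variable {R : Type} [CommRing R]

section hull

variable {E : Type} [AddCommGroup E] [Module R E]

/-- `H` is an essential extension of the submodule `S`. -/
def IsEss (S H : Submodule R E) : Prop := S ≤ H ∧ ∀ K ≤ H, Disjoint K S → K = ⊥

lemma exists_maximal_isEss (S : Submodule R E) : ∃ H, IsEss S H ∧
    ∀ H', IsEss S H' → H ≤ H' → H' = H := by
  obtain ⟨H, -, hH⟩ := zorn_le_nonempty₀ {H : Submodule R E | IsEss S H} (by
    intro c hc hchain K hK
    refine ⟨sSup c, ⟨(hc hK).1.trans (le_sSup hK), fun L hL hLS => ?_⟩, fun z hz => le_sSup hz⟩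
    rw [eq_bot_iff]
    intro x hx
    obtain ⟨F, hF, hxF⟩ := (Submodule.mem_sSup_of_directed ⟨K, hK⟩ hchain.directedOn).1 (hL hx)
    have := (hc hF).2 (L ⊓ F) inf_le_right (hLS.mono_left inf_le_left)
    exact this.le ⟨hx, hxF⟩) S ⟨le_rfl, fun K hK hd => disjoint_self.1 (hd.mono_right hK)⟩
  exact ⟨H, hH.1, fun H' h hle => le_antisymm (hH.2 h hle) hle⟩

lemma exists_maximal_disjoint (H : Submodule R E) :
    ∃ K, Disjoint H K ∧ ∀ K', Disjoint H K' → K ≤ K' → K' = K := by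
  obtain ⟨K, -, hK⟩ := zorn_le_nonempty₀ {K : Submodule R E | Disjoint H K} (by
    intro c hc hchain K hK
    refine ⟨sSup c, ?_, fun z hz => le_sSup hz⟩
    rw [Set.mem_ofPred_eq, hchain.directedOn.disjoint_sSup_right]
    exact fun F hF => hc hF) ⊥ disjoint_bot_right
  exact ⟨K, hK.1, fun K' h hle => le_antisymm (hK.2 h hle) hle⟩

lemma exists_retraction [hE : Module.Injective R E] (S H : Submodule R E) (hH : IsEss S H)
    (hmax : ∀ H', IsEss S H' → H ≤ H' → H' = H) : ∃ π : E →ₗ[R] H, ∀ x : H, π x = x := by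
  obtain ⟨K, hK, hKmax⟩ := exists_maximal_disjoint H
  have hinj : Function.Injective (K.mkQ.comp H.subtype) := by
    rw [← LinearMap.ker_eq_bot, LinearMap.ker_comp, Submodule.ker_mkQ, eq_bot_iff]
    intro x hx
    exact Subtype.ext (Submodule.disjoint_def.1 hK _ x.2 hx)
  obtain ⟨φ, hφ⟩ := hE.out (K.mkQ.comp H.subtype) hinj H.subtype
  have hφ' : ∀ x ∈ H, φ (K.mkQ x) = x := fun x hx => hφ ⟨x, hx⟩
  have hHr : H ≤ LinearMap.range φ := fun x hx => ⟨_, hφ' x hx⟩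
  have hr : LinearMap.range φ = H := by
    refine hmax _ ⟨hH.1.trans hHr, fun L hL hLS => ?_⟩ hHr
    have h1 : L ⊓ H = ⊥ := hH.2 _ inf_le_right (hLS.mono_left inf_le_left)
    have h2 : Disjoint H (L.comap (φ.comp K.mkQ)) := by
      rw [Submodule.disjoint_def]
      intro x hx hxL
      rw [Submodule.mem_comap, LinearMap.comp_apply, hφ' x hx] at hxL
      exact h1.le ⟨hxL, hx⟩
    have h4 : K ≤ L.comap (φ.comp K.mkQ) := fun x hx => by
      rw [Submodule.mem_comap, LinearMap.comp_apply, Submodule.mkQ_apply,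
        (Submodule.Quotient.mk_eq_zero K).2 hx, map_zero]
      exact zero_mem _
    have h3 := hKmax _ h2 h4
    rw [eq_bot_iff]
    intro x hx
    obtain ⟨y, rfl⟩ := hL hx
    obtain ⟨y, rfl⟩ := K.mkQ_surjective y
    have : y ∈ K := h3 ▸ (show y ∈ L.comap (φ.comp K.mkQ) from hx)
    rw [Submodule.mem_bot, Submodule.mkQ_apply, (Submodule.Quotient.mk_eq_zero K).2 this, map_zero]
  refine ⟨(φ.comp K.mkQ).codRestrict H fun x => hr ▸ ⟨_, rfl⟩, fun x => Subtype.ext ?_⟩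
  exact hφ' x x.2

/-- Injective hulls. -/
lemma exists_injective_hull (S : Type) [AddCommGroup S] [Module R S] :
    ∃ (I : Type) (_ : AddCommGroup I) (_ : Module R I) (_ : Module.Injective R I)
      (ι : S →ₗ[R] I), Function.Injective ι ∧
        ∀ K : Submodule R I, Disjoint K (LinearMap.range ι) → K = ⊥ := by
  obtain ⟨E, _, _, hE, ι, hι⟩ := exists_injective_embedding R S
  obtain ⟨H, hH, hmax⟩ := exists_maximal_isEss (LinearMap.range ι)
  obtain ⟨π, hπ⟩ := exists_retraction _ H hH hmax
  refine ⟨H, inferInstance, inferInstance, ⟨fun X Y _ _ _ _ f hf g => ?_⟩,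
    ι.codRestrict H fun x => hH.1 ⟨x, rfl⟩, fun x y h => hι (congrArg Subtype.val h),
    fun K hK => ?_⟩
  · obtain ⟨h, hh⟩ := hE.out f hf (H.subtype.comp g)
    refine ⟨π.comp h, fun x => ?_⟩
    rw [LinearMap.comp_apply, hh]
    exact hπ _
  · have := hH.2 (K.map H.subtype) (Submodule.map_subtype_le _ _) (by
      rw [Submodule.disjoint_def] at hK ⊢
      rintro _ ⟨x, hx, rfl⟩ ⟨s, hs⟩
      have h0 := hK x hx ⟨s, Subtype.ext hs⟩
      rw [h0]; rfl)
    rw [eq_bot_iff]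
    intro x hx
    have h0 : (x : E) ∈ K.map H.subtype := ⟨x, hx, rfl⟩
    rw [this] at h0
    exact Subtype.ext h0

end hull

lemma isSemisimple_ann (J : Ideal R) [IsSemisimpleRing (R ⧸ J)] (Z : Type) [AddCommGroup Z]
    [Module R Z] : IsSemisimpleModule R (ann (J : Set R) Z) := by
  have h : Module.IsTorsionBySet R (ann (J : Set R) Z) J := fun x r =>
    Subtype.ext (mem_ann.1 x.2 _ r.2)
  let _ := h.module
  exact h.isSemisimpleModule_iff.1 inferInstance

lemma ann_eq_range (J : Ideal R) [IsSemisimpleRing (R ⧸ J)] {S I : Type} [AddCommGroup S]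
    [Module R S] [AddCommGroup I] [Module R I] (ι : S →ₗ[R] I)
    (hS : LinearMap.range ι ≤ ann (J : Set R) I)
    (hess : ∀ K : Submodule R I, Disjoint K (LinearMap.range ι) → K = ⊥) :
    ann (J : Set R) I = LinearMap.range ι := by
  have := isSemisimple_ann J I
  obtain ⟨K, hK⟩ := exists_isCompl ((LinearMap.range ι).comap (ann (J : Set R) I).subtype)
  have h1 : K.map (ann (J : Set R) I).subtype = ⊥ := hess _ (by
    rw [Submodule.disjoint_def]
    rintro _ ⟨x, hx, rfl⟩ hx'
    have := Submodule.disjoint_def.1 hK.1 x hx' hx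
    rw [this]; rfl)
  replace h1 : K = ⊥ := Submodule.map_injective_of_injective
    (Submodule.injective_subtype (ann (J : Set R) I)) (h1.trans (Submodule.map_bot _).symm)
  have h2 := hK.sup_eq_top
  rw [h1, sup_bot_eq] at h2
  exact le_antisymm (fun x hx => show (⟨x, hx⟩ : ann (J : Set R) I) ∈
    (LinearMap.range ι).comap (ann (J : Set R) I).subtype from h2 ▸ Submodule.mem_top) hS

lemma mem_smul_of_ann [IsNoetherianRing R] (b : Ideal R) {Z I : Type} [AddCommGroup Z] [Module R Z]
    [AddCommGroup I] [Module R I] [hI : Module.Injective R I] (f : Z →ₗ[R] I)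
    (hf : ∀ z ∈ ann (b : Set R) Z, f z = 0) : f ∈ b • (⊤ : Submodule R (Z →ₗ[R] I)) := by
  classical
  obtain ⟨s, hs⟩ : b.FG := IsNoetherian.noetherian b
  let φ : Z →ₗ[R] (s → Z) := LinearMap.pi fun i => (i : R) • LinearMap.id
  have hφ : LinearMap.ker φ ≤ LinearMap.ker f := by
    intro z hz
    refine hf z ?_
    rw [← hs, show ((Submodule.span R (s : Set R) : Ideal R) : Set R) =
      (Ideal.span (s : Set R) : Ideal R) from rfl,
      ann_span, mem_ann]
    exact fun r hr => congrFun hz ⟨r, hr⟩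
  obtain ⟨h, hh⟩ := hI.out ((LinearMap.ker φ).liftQ φ le_rfl)
    (LinearMap.ker_eq_bot.1 (Submodule.ker_liftQ_eq_bot _ _ _ le_rfl))
    ((LinearMap.ker φ).liftQ f hφ)
  have hfh : f = ∑ i : s, (i : R) • h.comp (LinearMap.single R (fun _ : s => Z) i) := by
    ext z
    have h1 := hh (Submodule.Quotient.mk z)
    rw [Submodule.liftQ_apply, Submodule.liftQ_apply] at h1
    rw [← h1, LinearMap.sum_apply]
    conv_lhs => rw [show φ z = ∑ i, Pi.single i (φ z i) from
      (Finset.univ_sum_single _).symm, map_sum]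
    refine Finset.sum_congr rfl fun i _ => ?_
    rw [LinearMap.smul_apply, LinearMap.comp_apply, ← map_smul, ← map_smul]
    rfl
  rw [hfh]
  refine Submodule.sum_mem _ fun i _ => Submodule.smul_mem_smul ?_ trivial
  rw [← hs]
  exact Submodule.subset_span i.2

section matlis

variable (J : Ideal R) (Z : Type) [AddCommGroup Z] [Module R Z]

lemma isHausdorff_hom (I : Type) [AddCommGroup I] [Module R I]
    (hZJ : ∀ z : Z, ∃ n, ∀ r ∈ J ^ n, r • z = 0) : IsHausdorff J (Z →ₗ[R] I) := by
  refine ⟨fun f hf => LinearMap.ext fun z => ?_⟩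
  obtain ⟨n, hn⟩ := hZJ z
  have h1 := (SModEq.zero).1 (hf n)
  refine Submodule.smul_induction_on (p := fun g : Z →ₗ[R] I => g z = 0) h1 (fun r hr g _ => ?_)
    fun g g' hg hg' => ?_
  · rw [LinearMap.smul_apply, ← map_smul, hn r hr, map_zero]
  · rw [LinearMap.add_apply, hg, hg', add_zero]

lemma isPrecomplete_pi [IsAdicComplete J R] (n : ℕ) : IsPrecomplete J (Fin n → R) := by
  refine ⟨fun f hf => ?_⟩
  have h1 : ∀ i : Fin n, ∃ L : R, ∀ k, f k i ≡ L [SMOD (J ^ k • ⊤ : Submodule R R)] := by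
    intro i
    refine IsPrecomplete.prec' _ fun {k l} hkl => ?_
    have := SModEq.map (hf hkl) (LinearMap.proj i)
    refine this.mono ?_
    rw [Submodule.map_smul'']
    exact Submodule.smul_mono le_rfl le_top
  choose L hL using h1
  refine ⟨L, fun k => ?_⟩
  rw [SModEq.sub_mem, ← Finset.univ_sum_single (f k - L)]
  refine Submodule.sum_mem _ fun i _ => ?_
  have h2 := SModEq.sub_mem.1 (hL i k)
  rw [smul_eq_mul, Ideal.mul_top] at h2
  have h3 : (Pi.single i ((f k - L) i) : Fin n → R) = (f k i - L i) • Pi.single i 1 := by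
    rw [← Pi.single_smul, smul_eq_mul, mul_one, Pi.sub_apply]
  rw [h3]
  exact Submodule.smul_mem_smul h2 trivial

lemma finite_of_finite_quot [IsAdicComplete J R] (N : Type) [AddCommGroup N] [Module R N]
    [IsHausdorff J N]
    (h : Module.Finite R (N ⧸ (J • ⊤ : Submodule R N))) : Module.Finite R N := by
  obtain ⟨n, f, hf⟩ := Module.Finite.exists_fin' R (N ⧸ (J • ⊤ : Submodule R N))
  obtain ⟨g, hg⟩ := Module.projective_lifting_property (J • ⊤ : Submodule R N).mkQ f
    (Submodule.mkQ_surjective _)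
  have := isPrecomplete_pi J n
  exact Module.Finite.of_surjective g (surjective_of_mkQ_comp_surjective (I := J) (by rwa [hg]))

lemma finite_hom [IsNoetherianRing R] [IsAdicComplete J R] [IsSemisimpleRing (R ⧸ J)]
    [IsArtinian R Z] (I : Type) [AddCommGroup I] [Module R I] [Module.Injective R I]
    (hZJ : ∀ z : Z, ∃ n, ∀ r ∈ J ^ n, r • z = 0) [IsNoetherian R (ann (J : Set R) I)] :
    Module.Finite R (Z →ₗ[R] I) := by
  have := isHausdorff_hom J Z I hZJ
  refine finite_of_finite_quot J _ ?_
  have := isSemisimple_ann J Z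
  have hiff : IsArtinian R (ann (J : Set R) Z) ↔ Module.Finite R (ann (J : Set R) Z) :=
    (IsSemisimpleModule.finite_tfae (R := R) (M := ann (J : Set R) Z)).out 2 0
  have : Module.Finite R (ann (J : Set R) Z) := hiff.1 inferInstance
  let ρ : (Z →ₗ[R] I) →ₗ[R] (ann (J : Set R) Z →ₗ[R] ann (J : Set R) I) :=
    { toFun := fun f => annMap _ f
      map_add' := fun f g => rfl
      map_smul' := fun r f => rfl }
  have h1 : LinearMap.ker ρ ≤ J • ⊤ := fun f hf => mem_smul_of_ann J f fun z hz =>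
    congrArg Subtype.val (LinearMap.congr_fun hf (⟨z, hz⟩ : ann (J : Set R) Z))
  have h2 : Module.Finite R ((Z →ₗ[R] I) ⧸ LinearMap.ker ρ) := by
    have : IsNoetherian R ((Z →ₗ[R] I) ⧸ LinearMap.ker ρ) :=
      isNoetherian_of_injective ((LinearMap.ker ρ).liftQ ρ le_rfl)
        (LinearMap.ker_eq_bot.1 (Submodule.ker_liftQ_eq_bot _ ρ _ le_rfl))
    infer_instance
  exact Module.Finite.of_surjective (Submodule.factor h1) (Submodule.factor_surjective h1)

end matlis

lemma exists_pow_mem_sup_annihilator (b : Ideal R) {N : Type} [AddCommGroup N] [Module R N]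
    [Module.Finite R N] {c : R} (h : ∀ f : N, c • f ∈ b • (⊤ : Submodule R N)) :
    ∃ n, c ^ n ∈ b ⊔ Module.annihilator R N := by
  obtain ⟨p, hp, -, hpb, hp0⟩ :=
    LinearMap.exists_monic_and_natDegree_eq_and_coeff_mem_pow_and_aeval_eq_zero R
      (algebraMap R (Module.End R N) c) b (by
        rintro _ ⟨f, rfl⟩
        exact h f)
  refine ⟨p.natDegree, ?_⟩
  have h1 : p.eval c ∈ Module.annihilator R N := by
    rw [Module.mem_annihilator]
    intro f
    rw [Polynomial.aeval_algebraMap_apply] at hp0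
    have := LinearMap.congr_fun hp0 f
    exact this
  rw [Polynomial.eval_eq_sum_range, Finset.sum_range_succ, hp.coeff_natDegree, one_mul] at h1
  rw [← sub_add_cancel (c ^ p.natDegree) (-∑ x ∈ Finset.range p.natDegree, p.coeff x * c ^ x)]
  refine Submodule.add_mem _ (Submodule.mem_sup_right ?_) (Submodule.mem_sup_left ?_)
  · rwa [sub_neg_eq_add, add_comm]
  · refine neg_mem (Submodule.sum_mem _ fun i hi => Ideal.mul_mem_right _ _ ?_)
    exact Ideal.pow_le_self (Nat.sub_ne_zero_of_lt (Finset.mem_range.1 hi)) (hpb i)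

/-- If `c` kills `(0 :_Z b)`, then a power of `c` lies in `b + q`, where `q` is a prime outside of
which every element acts surjectively on the Artinian module `Z`. -/
theorem exists_pow_mem_sup [IsNoetherianRing R] (J : Ideal R) [IsAdicComplete J R]
    [IsSemisimpleRing (R ⧸ J)] (Z : Type) [AddCommGroup Z] [Module R Z] [IsArtinian R Z]
    [Nontrivial Z] (hZJ : ∀ z : Z, ∃ n, ∀ r ∈ J ^ n, r • z = 0) (b q : Ideal R)
    (hq : ∀ s ∉ q, ∀ z : Z, ∃ w, s • w = z) {c : R} (hc : ∀ z ∈ ann (b : Set R) Z, c • z = 0) :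
    ∃ n, c ^ n ∈ b ⊔ q := by
  obtain ⟨m, hm⟩ := Module.nonempty_support_of_nontrivial (R := R) (M := Z)
  obtain ⟨z, hz0, hz⟩ := exists_ann_of_mem_support m hm
  have hmax := isMaximal_of_mem_support m hm
  have hJm : J ≤ m.asIdeal := (le_radSupp hZJ).trans (radSupp_le m hm)
  obtain ⟨I, _, _, _, ι, hι, hess⟩ := exists_injective_hull (R := R) (R ⧸ m.asIdeal)
  have hrange : LinearMap.range ι ≤ ann (J : Set R) I := by
    rintro _ ⟨x, rfl⟩
    obtain ⟨x, rfl⟩ := Ideal.Quotient.mk_surjective x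
    refine mem_ann.2 fun r hr => ?_
    rw [← map_smul, show r • Ideal.Quotient.mk m.asIdeal x = 0 from
      Ideal.Quotient.eq_zero_iff_mem.2 (m.asIdeal.mul_mem_right _ (hJm hr)), map_zero]
  have : IsNoetherian R (ann (J : Set R) I) := by
    rw [ann_eq_range J ι hrange hess]
    infer_instance
  have := finite_hom J Z I hZJ
  let k : (R ⧸ m.asIdeal) →ₗ[R] Z := Submodule.liftQ _ (LinearMap.toSpanSingleton R Z z) hz
  have hk : Function.Injective k := by
    rw [injective_iff_map_eq_zero]
    intro x hx
    obtain ⟨x, rfl⟩ := Ideal.Quotient.mk_surjective x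
    by_contra hne
    rw [Ideal.Quotient.eq_zero_iff_mem] at hne
    obtain ⟨y, i, hi, hy⟩ := hmax.exists_inv hne
    refine hz0 ?_
    have hx' : x • z = 0 := hx
    rw [← one_smul R z, ← hy, add_smul, mul_smul, hx', smul_zero, hz i hi, add_zero]
  obtain ⟨f, hf⟩ := Module.Injective.out k hk ι
  have hf0 : f ≠ 0 := by
    rintro rfl
    have h1 : ι (Ideal.Quotient.mk _ 1) = 0 := (hf _).symm
    have h2 := hι (h1.trans (map_zero ι).symm)
    rw [Ideal.Quotient.eq_zero_iff_mem] at h2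
    exact hmax.ne_top ((Ideal.eq_top_iff_one _).2 h2)
  obtain ⟨n, hn⟩ := exists_pow_mem_sup_annihilator b (N := Z →ₗ[R] I) (c := c) fun g =>
    mem_smul_of_ann b _ fun z hz => by rw [LinearMap.smul_apply, ← map_smul, hc z hz, map_zero]
  refine ⟨n, sup_le_sup_left ?_ b hn⟩
  intro s hs
  by_contra hsq
  refine hf0 (LinearMap.ext fun z => ?_)
  obtain ⟨w, rfl⟩ := hq s hsq z
  rw [map_smul, ← LinearMap.smul_apply, Module.mem_annihilator.1 hs f]
  rfl

theorem ringKrullDim_quot_le_zero [IsNoetherianRing R] (J : Ideal R) [IsAdicComplete J R]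
    [IsSemisimpleRing (R ⧸ J)] (Z : Type) [AddCommGroup Z] [Module R Z]
    [Nontrivial Z] (hZJ : ∀ z : Z, ∃ n, ∀ r ∈ J ^ n, r • z = 0) (b q : Ideal R)
    (hZ : Cof (b : Set R) Z)
    (hq : ∀ s ∉ q, ∀ z : Z, ∃ w, s • w = z) : ringKrullDim (R ⧸ (b ⊔ q)) ≤ 0 := by
  have := hZ.1
  have := hZ.2
  let A := Module.annihilator R (ann (b : Set R) Z)
  have hA : IsArtinianRing (R ⧸ A) := by
    have : IsArtinian R (R ⧸ A) := by
      obtain ⟨s, hs⟩ := Module.Finite.fg_top (R := R) (M := ann (b : Set R) Z)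
      let φ : R →ₗ[R] (s → ann (b : Set R) Z) :=
        LinearMap.pi fun i => LinearMap.toSpanSingleton R _ i.1
      have hφ : LinearMap.ker φ = A := by
        ext r
        rw [LinearMap.mem_ker]
        constructor
        · intro h
          rw [Module.mem_annihilator]
          intro z
          have hz : z ∈ Submodule.span R (s : Set (ann (b : Set R) Z)) := hs ▸ Submodule.mem_top
          induction hz using Submodule.span_induction with
          | mem x hx => exact congrFun h ⟨x, hx⟩
          | zero => exact smul_zero r
          | add x y _ _ hx hy => rw [smul_add, hx, hy, add_zero]
          | smul t x _ hx => rw [smul_comm, hx, smul_zero]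
        · intro h
          ext1 i
          exact Module.mem_annihilator.1 h i.1
      rw [← hφ]
      exact isArtinian_of_injective ((LinearMap.ker φ).liftQ φ le_rfl)
        (LinearMap.ker_eq_bot.1 (Submodule.ker_liftQ_eq_bot _ φ _ le_rfl))
    exact isArtinian_of_tower R this
  have hAle : A ≤ (b ⊔ q).radical := fun c hc =>
    exists_pow_mem_sup J Z hZJ b q hq fun z hz =>
      congrArg Subtype.val (Module.mem_annihilator.1 hc (⟨z, hz⟩ : ann (b : Set R) Z))
  refine (Ring.krullDimLE_iff (n := 0)).1 (Ring.krullDimLE_zero_iff.2 fun P hP => ?_)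
  have h1 : A ≤ P.comap (Ideal.Quotient.mk (b ⊔ q)) := by
    refine hAle.trans ((Ideal.IsPrime.radical_le_iff (Ideal.comap_isPrime _ _)).2 fun x hx => ?_)
    rw [Ideal.mem_comap, Ideal.Quotient.eq_zero_iff_mem.2 hx]
    exact zero_mem _
  have h2 : (P.comap (Ideal.Quotient.mk (b ⊔ q))).IsMaximal := by
    have hsurj := Ideal.Quotient.mk_surjective (I := A)
    have hp := Ideal.map_isPrime_of_surjective hsurj (I := P.comap (Ideal.Quotient.mk (b ⊔ q)))
      (by rwa [Ideal.mk_ker])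
    have hmx : (Ideal.map (Ideal.Quotient.mk A) (P.comap (Ideal.Quotient.mk (b ⊔ q)))).IsMaximal :=
      IsArtinianRing.isMaximal_of_isPrime _
    have := Ideal.comap_isMaximal_of_surjective _ hsurj
      (K := Ideal.map (Ideal.Quotient.mk A) (P.comap (Ideal.Quotient.mk (b ⊔ q))))
    rwa [Ideal.comap_map_of_surjective _ hsurj, ← RingHom.ker_eq_comap_bot, Ideal.mk_ker,
      sup_eq_left.2 h1] at this
  have h3 := Ideal.map_eq_top_or_isMaximal_of_surjective (Ideal.Quotient.mk (b ⊔ q))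
    Ideal.Quotient.mk_surjective h2
  rw [Ideal.map_comap_of_surjective _ Ideal.Quotient.mk_surjective] at h3
  exact h3.resolve_left hP.ne_top

end
end LH

namespace LH

noncomputable section

open scoped Pointwise

variable {R : Type} [CommRing R]

lemma le_of_isAdicComplete_of_isMaximal (J : Ideal R) [IsAdicComplete J R] (m : Ideal R)
    [m.IsMaximal] : J ≤ m :=
  (IsAdicComplete.le_jacobson_bot J).trans (sInf_le ⟨bot_le, ‹_›⟩)

lemma torsion_of_isArtinian [IsNoetherianRing R] (J : Ideal R) [IsAdicComplete J R] (Z : Type)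
    [AddCommGroup Z] [Module R Z] [IsArtinian R Z] (z : Z) :
    ∃ n, ∀ r ∈ J ^ n, r • z = 0 := by
  have hJ : J ≤ radSupp R Z := le_iInf₂ fun p hp => by
    have := isMaximal_of_mem_support p hp
    exact le_of_isAdicComplete_of_isMaximal J p.asIdeal
  obtain ⟨n, hn⟩ := radSupp_torsion (R := R) z
  exact ⟨n, fun r hr => hn r (Ideal.pow_right_mono hJ n hr)⟩

lemma smul_surjective_of_notMem [IsNoetherianRing R] (b : Ideal R) (d : ℕ) (q : Ideal R)
    [q.IsPrime] (hq : Module.supportDim R (R ⧸ q) ≤ d) (s : R) (hs : s ∉ q)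
    (z : H b d (R ⧸ q)) : ∃ w : H b d (R ⧸ q), s • w = z := by
  have h1 : Module.supportDim R (QuotSMulTop s (R ⧸ q)) < d := by
    refine lt_of_add_lt_add_right (a := (1 : WithBot ℕ∞)) ?_
    refine ((supportDim_quot_prime_le q hs).trans hq).trans_lt ?_
    exact_mod_cast Nat.lt_succ_self d
  have h2 : Subsingleton (H b d (QuotSMulTop s (R ⧸ q))) :=
    subsingleton_of_supportDim_lt b d _ h1
  obtain ⟨w, hw⟩ := (hmap_exact b d (smul_quot_prime_injective q hs)
    (Submodule.mkQ_surjective _) (exact_smul_mkQ s (R ⧸ q)) z).1 (h2.elim _ _)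
  exact ⟨w, by rw [← hw, hmap_smul_id]⟩

/-- The Lichtenbaum-Hartshorne theorem over a ring complete with respect to an ideal `J` with
`R / J` semisimple. -/
theorem exists_ringKrullDim_quot_le_zero [IsNoetherianRing R] (J : Ideal R) [IsAdicComplete J R]
    [IsSemisimpleRing (R ⧸ J)] (b : Ideal R) (d : ℕ) (N : Type) [AddCommGroup N] [Module R N]
    [Module.Finite R N] (hd : Module.supportDim R N ≤ d) (h : Nontrivial (H b d N)) :
    ∃ q ∈ associatedPrimes R N, Module.supportDim R (R ⧸ q) = d ∧
      ringKrullDim (R ⧸ (b ⊔ q)) ≤ 0 := by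
  obtain ⟨q, hq, hqd, hZ⟩ := exists_mem_associatedPrimes_nontrivial b d N hd h
  have hqp : q.IsPrime := hq.isPrime
  have hcof := cof_top b d (R ⧸ q) hqd.le
  have := hcof.1
  exact ⟨q, hq, hqd, ringKrullDim_quot_le_zero J (H b d (R ⧸ q)) (torsion_of_isArtinian J _) b q
    hcof fun s hs => smul_surjective_of_notMem b d q hqd.le s hs⟩

end
end LH

namespace LH

noncomputable section

section noetherian

lemma exists_eq_of_approx {T : Type} [CommRing T] (K : Ideal T) [IsAdicComplete K T] {k : ℕ}
    (f : (Fin k → T) →ₗ[T] T) (P : ℕ → Ideal T) (hP : ∀ n, P n ≤ K ^ n)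
    (h : ∀ n, ∀ x ∈ P n, ∃ c : Fin k → T, (∀ i, c i ∈ K ^ n) ∧ x - f c ∈ P (n + 1))
    (x : T) (hx : x ∈ P 0) : ∃ c, f c = x := by
  choose! c hc hc' using h
  let y : ∀ n, P n := fun n => Nat.rec ⟨x, hx⟩ (fun n y => ⟨y - f (c n y), hc' n y y.2⟩) n
  have hy : ∀ n, (y (n + 1)).1 = (y n).1 - f (c n (y n).1) := fun n => rfl
  let s : ℕ → Fin k → T := fun n => ∑ i ∈ Finset.range n, c i (y i).1
  have hs : ∀ n, f (s n) = x - (y n).1 := by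
    intro n
    induction n with
    | zero => simp [s, y]
    | succ n ih =>
      rw [hy, show s (n + 1) = s n + c n (y n).1 from Finset.sum_range_succ _ _, map_add, ih]
      ring
  have hsm : ∀ n (v : Fin k → T), (∀ i, v i ∈ K ^ n) →
      v ∈ (K ^ n • ⊤ : Submodule T (Fin k → T)) := by
    intro n v hv
    rw [← Finset.univ_sum_single v]
    refine Submodule.sum_mem _ fun i _ => ?_
    rw [show Pi.single i (v i) = v i • (Pi.single i 1 : Fin k → T) by
      rw [← Pi.single_smul, smul_eq_mul, mul_one]]
    exact Submodule.smul_mem_smul (hv i) trivial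
  have hcau : ∀ {m n}, m ≤ n → s m ≡ s n [SMOD (K ^ m • ⊤ : Submodule T (Fin k → T))] := by
    intro m n hmn
    refine SModEq.symm (SModEq.sub_mem.2 ?_)
    rw [show s n - s m = ∑ i ∈ Finset.Ico m n, c i (y i).1 from
      (Finset.sum_Ico_eq_sub _ hmn).symm]
    refine Submodule.sum_mem _ fun i hi => hsm m _ fun j => ?_
    exact Ideal.pow_le_pow_right (Finset.mem_Ico.1 hi).1 (hc i (y i).1 (y i).2 j)
  obtain ⟨L, hL⟩ := (isPrecomplete_pi K k).prec' s hcau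
  refine ⟨L, sub_eq_zero.1 (IsHausdorff.haus' (I := K) _ fun n => ?_)⟩
  rw [SModEq.zero, smul_eq_mul, Ideal.mul_top]
  have h1 : f (s n) - f L ∈ (K ^ n • ⊤ : Ideal T) := by
    rw [← map_sub]
    have h2 := Submodule.mem_map_of_mem (f := f) (SModEq.sub_mem.1 (hL n))
    rw [Submodule.map_smul''] at h2
    exact Submodule.smul_mono le_rfl le_top h2
  rw [smul_eq_mul, Ideal.mul_top, hs] at h1
  have := neg_mem (add_mem h1 (hP n (y n).2))
  convert this using 1
  ring

variable {R T : Type} [CommRing R] [CommRing T] [Algebra R T] (I : Ideal R)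

lemma exists_sub_mem_pow (hsurj : ∀ t : T, ∃ r : R, t - algebraMap R T r ∈ I.map (algebraMap R T))
    (n : ℕ) (x : T) (hx : x ∈ I.map (algebraMap R T) ^ n) :
    ∃ r ∈ I ^ n, x - algebraMap R T r ∈ I.map (algebraMap R T) ^ (n + 1) := by
  rw [← Ideal.map_pow] at hx
  induction hx using Submodule.span_induction with
  | mem x h =>
    obtain ⟨r, hr, rfl⟩ := h
    exact ⟨r, hr, by simp⟩
  | zero => exact ⟨0, zero_mem _, by simp⟩
  | add x y _ _ hx hy =>
    obtain ⟨r, hr, hxr⟩ := hx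
    obtain ⟨s, hs, hys⟩ := hy
    refine ⟨r + s, add_mem hr hs, ?_⟩
    rw [map_add, add_sub_add_comm]
    exact add_mem hxr hys
  | smul t x _ hx =>
    obtain ⟨r, hr, hxr⟩ := hx
    obtain ⟨s, hs⟩ := hsurj t
    refine ⟨s * r, Ideal.mul_mem_left _ _ hr, ?_⟩
    rw [map_mul, smul_eq_mul, show t * x - algebraMap R T s * algebraMap R T r =
      t * (x - algebraMap R T r) + (t - algebraMap R T s) * algebraMap R T r by ring, pow_succ']
    refine add_mem ?_ (Ideal.mul_mem_mul hs ?_)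
    · rw [← pow_succ']
      exact Ideal.mul_mem_left _ _ hxr
    · rw [← Ideal.map_pow]
      exact Ideal.mem_map_of_mem _ hr

/-- The filtration of `R` by the `n`-th leading forms of the elements of an ideal of `T`. -/
def leadingFiltration (J : Ideal T) : I.Filtration R where
  N n :=
    { carrier := {r | r ∈ I ^ n ∧ ∃ j ∈ J, j - algebraMap R T r ∈ I.map (algebraMap R T) ^ (n + 1)}
      zero_mem' := ⟨zero_mem _, 0, zero_mem _, by simp⟩
      add_mem' := by
        rintro r s ⟨hr, i, hi, hir⟩ ⟨hs, j, hj, hjs⟩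
        refine ⟨add_mem hr hs, i + j, add_mem hi hj, ?_⟩
        rw [map_add, add_sub_add_comm]
        exact add_mem hir hjs
      smul_mem' := by
        rintro t r ⟨hr, i, hi, hir⟩
        refine ⟨Ideal.mul_mem_left _ _ hr, algebraMap R T t * i, Ideal.mul_mem_left _ _ hi, ?_⟩
        rw [smul_eq_mul, map_mul, ← mul_sub]
        exact Ideal.mul_mem_left _ _ hir }
  mono n := by
    rintro r ⟨hr, -⟩
    refine ⟨Ideal.pow_le_pow_right n.le_succ hr, 0, zero_mem _, ?_⟩
    rw [zero_sub, neg_mem_iff, ← Ideal.map_pow]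
    exact Ideal.mem_map_of_mem _ hr
  smul_le n := by
    rw [Submodule.smul_le]
    rintro t ht r ⟨hr, i, hi, hir⟩
    refine ⟨?_, algebraMap R T t * i, Ideal.mul_mem_left _ _ hi, ?_⟩
    · rw [pow_succ']
      exact Ideal.mul_mem_mul ht hr
    · rw [smul_eq_mul, map_mul, ← mul_sub, pow_succ']
      exact Ideal.mul_mem_mul (Ideal.mem_map_of_mem _ ht) hir

lemma isNoetherian_quot_pow [IsNoetherianRing R]
    (hsurj : ∀ t : T, ∃ r : R, t - algebraMap R T r ∈ I.map (algebraMap R T)) (n : ℕ) :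
    IsNoetherian T (T ⧸ I.map (algebraMap R T) ^ n) := by
  have h : ∀ n, ∀ t : T, ∃ r : R, t - algebraMap R T r ∈ I.map (algebraMap R T) ^ n := by
    intro n t
    induction n with
    | zero => exact ⟨0, by simp⟩
    | succ n ih =>
      obtain ⟨r, hr⟩ := ih
      obtain ⟨s, -, hs⟩ := exists_sub_mem_pow I hsurj n _ hr
      exact ⟨r + s, by rwa [map_add, ← sub_sub]⟩
  have : IsNoetherian R (T ⧸ I.map (algebraMap R T) ^ n) := by
    refine isNoetherian_of_surjective (Algebra.linearMap R (T ⧸ I.map (algebraMap R T) ^ n)) ?_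
    rw [LinearMap.range_eq_top]
    intro t
    obtain ⟨t, rfl⟩ := Ideal.Quotient.mk_surjective t
    obtain ⟨r, hr⟩ := h n t
    exact ⟨r, ((Ideal.Quotient.mk_eq_mk_iff_sub_mem _ _).2 hr).symm⟩
  exact isNoetherian_of_tower R this

theorem isNoetherianRing_of_isAdicComplete [IsNoetherianRing R]
    [IsAdicComplete (I.map (algebraMap R T)) T]
    (hsurj : ∀ t : T, ∃ r : R, t - algebraMap R T r ∈ I.map (algebraMap R T)) :
    IsNoetherianRing T := by
  refine ⟨fun J => ?_⟩
  set K := I.map (algebraMap R T) with hK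
  obtain ⟨N, hN⟩ := ((I.stableFiltration_stable (⊤ : Submodule R R)).of_le
    (F' := leadingFiltration I J) (fun n r hr => by
      change r ∈ I ^ n • (⊤ : Submodule R R)
      rw [smul_eq_mul, Ideal.mul_top]
      exact hr.1)).exists_pow_smul_eq
  obtain ⟨k, g, hg⟩ := Submodule.fg_iff_exists_fin_generating_family.1
    (IsNoetherian.noetherian ((leadingFiltration I J).N N))
  have hg' : ∀ i, g i ∈ (leadingFiltration I J).N N := fun i => by
    rw [← hg]
    exact Submodule.subset_span ⟨i, rfl⟩
  choose hgI j hj hjg using hg'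
  have hpow : ∀ n, ∀ r ∈ I ^ n, algebraMap R T r ∈ K ^ n := fun n r hr => by
    rw [hK, ← Ideal.map_pow]
    exact Ideal.mem_map_of_mem _ hr
  have hjK : ∀ i, j i ∈ K ^ N := fun i => by
    rw [← sub_add_cancel (j i) (algebraMap R T (g i))]
    exact add_mem (Ideal.pow_le_pow_right N.le_succ (hjg i)) (hpow N _ (hgI i))
  let f : (Fin k → T) →ₗ[T] T := Fintype.linearCombination T j
  have hf : ∀ c, f c = ∑ i, c i * j i := fun c => rfl
  have hfJ : ∀ c, f c ∈ J := fun c => by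
    rw [hf]
    exact Submodule.sum_mem _ fun i _ => Ideal.mul_mem_left _ _ (hj i)
  have key : ∀ x ∈ J ⊓ K ^ (N + 0), ∃ c, f c = x := by
    refine exists_eq_of_approx K f (fun n => J ⊓ K ^ (N + n))
      (fun n => inf_le_right.trans (Ideal.pow_le_pow_right (Nat.le_add_left _ _))) ?_
    rintro n x ⟨hxJ, hxK⟩
    obtain ⟨r, hr, hxr⟩ := exists_sub_mem_pow I hsurj (N + n) x hxK
    have h1 : r ∈ (leadingFiltration I J).N (N + n) := ⟨hr, x, hxJ, hxr⟩
    rw [hN, ← hg, Submodule.mem_ideal_smul_span_iff_exists_sum] at h1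
    obtain ⟨c, hc, rfl⟩ := h1
    refine ⟨fun i => algebraMap R T (c i), fun i => hpow n _ (hc i), sub_mem hxJ (hfJ _), ?_⟩
    rw [Finsupp.sum_fintype _ _ (fun i => zero_smul R (g i))] at hxr
    have h2 : ∑ i, algebraMap R T (c i) * (j i - algebraMap R T (g i)) ∈ K ^ (N + n + 1) := by
      refine Submodule.sum_mem _ fun i _ => ?_
      rw [show N + n + 1 = n + (N + 1) by ring, pow_add]
      exact Ideal.mul_mem_mul (hpow n _ (hc i)) (hjg i)
    have h3 := sub_mem hxr h2
    suffices h4 : x - f (fun i => algebraMap R T (c i)) = x - algebraMap R T (∑ i, c i • g i) -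
        ∑ i, algebraMap R T (c i) * (j i - algebraMap R T (g i)) by
      rw [h4]
      exact h3
    rw [hf, map_sum, sub_sub, ← Finset.sum_add_distrib]
    refine congrArg (x - ·) (Finset.sum_congr rfl fun i _ => ?_)
    rw [smul_eq_mul, map_mul]
    ring
  refine Submodule.fg_of_fg_map_of_fg_inf_ker (Submodule.mkQ (K ^ N)) ?_ ?_
  · have := isNoetherian_quot_pow I hsurj N
    exact IsNoetherian.noetherian _
  · have : J ⊓ LinearMap.ker (Submodule.mkQ (K ^ N)) = LinearMap.range f := by
      rw [Submodule.ker_mkQ]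
      apply le_antisymm
      · intro x hx
        exact key x hx
      · rintro _ ⟨c, rfl⟩
        refine ⟨hfJ c, ?_⟩
        change f c ∈ K ^ N
        rw [hf]
        exact Submodule.sum_mem _ fun i _ => Ideal.mul_mem_left _ _ (hjK i)
    rw [this, LinearMap.range_eq_map]
    exact Module.Finite.fg_top.map f

end noetherian

end
end LH

namespace LH

noncomputable section

section dimension

lemma height_le_height_comap {A B : Type} [CommRing A] [CommRing B] [IsNoetherianRing A]
    [IsNoetherianRing B] (f : A →+* B) (P : Ideal B) [P.IsPrime] (h : (P.comap f).map f = P) :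
    P.height ≤ (P.comap f).height := by
  algebraize [f]
  have : P.LiesOver (P.comap f) := ⟨rfl⟩
  refine (Ideal.height_le_height_add_of_liesOver (P.comap f) P).trans ?_
  have h0 : ∀ Q, Q = P → (P.map (Ideal.Quotient.mk Q)).height = 0 := by
    rintro _ rfl
    rw [Ideal.map_quotient_self, Ideal.height_bot]
  exact ((congrArg _ (h0 _ h)).trans (add_zero _)).le

lemma ringKrullDim_le_of_map_comap {A B : Type} [CommRing A] [CommRing B] [IsNoetherianRing A]
    [IsNoetherianRing B] (f : A →+* B)
    (h : ∀ P : Ideal B, P.IsMaximal → P ≤ (P.comap f).map f) :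
    ringKrullDim B ≤ ringKrullDim A := by
  rw [ringKrullDim_le_iff_isMaximal_height_le]
  intro P hP
  have h1 := height_le_height_comap f P (le_antisymm Ideal.map_comap_le (h P hP))
  exact (WithBot.coe_le_coe.2 h1).trans
    (Ideal.height_le_ringKrullDim_of_ne_top (Ideal.comap_ne_top f hP.ne_top))

variable {R T : Type} [CommRing R] [CommRing T] [Algebra R T] [IsNoetherianRing R] (I : Ideal R)

lemma ringKrullDim_quot_le_of_isAdicComplete [IsAdicComplete (I.map (algebraMap R T)) T]
    (hsurj : ∀ t : T, ∃ r : R, t - algebraMap R T r ∈ I.map (algebraMap R T))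
    {c : Ideal R} {C : Ideal T} (hc : c ≤ C.comap (algebraMap R T)) :
    ringKrullDim (T ⧸ C) ≤ ringKrullDim (R ⧸ c) := by
  have := isNoetherianRing_of_isAdicComplete I hsurj
  refine ringKrullDim_le_of_map_comap (Ideal.quotientMap C (algebraMap R T) hc) fun P hP => ?_
  have hmax := Ideal.comap_isMaximal_of_surjective (Ideal.Quotient.mk C)
    Ideal.Quotient.mk_surjective (K := P)
  have hI : I.map (algebraMap R T) ≤ P.comap (Ideal.Quotient.mk C) :=
    le_of_isAdicComplete_of_isMaximal _ _
  have h1 : (P.comap (Ideal.Quotient.mk C)).comap (algebraMap R T) ≤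
      (((P.comap (Ideal.quotientMap C (algebraMap R T) hc)).map
        (Ideal.quotientMap C (algebraMap R T) hc)).comap (Ideal.Quotient.mk C)).comap
          (algebraMap R T) := fun r hr => by
    rw [Ideal.mem_comap, Ideal.mem_comap, ← Ideal.quotientMap_mk (H := hc)]
    refine Ideal.mem_map_of_mem _ ?_
    rw [Ideal.mem_comap, Ideal.quotientMap_mk]
    exact hr
  intro y hy
  obtain ⟨x, rfl⟩ := Ideal.Quotient.mk_surjective y
  obtain ⟨r, hr⟩ := hsurj x
  have hrP : r ∈ (P.comap (Ideal.Quotient.mk C)).comap (algebraMap R T) := by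
    rw [Ideal.mem_comap, ← sub_sub_cancel x (algebraMap R T r)]
    exact sub_mem hy (hI hr)
  have h2 := Ideal.map_le_iff_le_comap.2 ((Ideal.map_le_iff_le_comap.1 hI).trans h1) hr
  have h3 := add_mem h2 (h1 hrP)
  rwa [sub_add_cancel] at h3

lemma supportDim_tensor_le_of_isAdicComplete [IsAdicComplete (I.map (algebraMap R T)) T]
    (hsurj : ∀ t : T, ∃ r : R, t - algebraMap R T r ∈ I.map (algebraMap R T))
    (M : Type) [AddCommGroup M] [Module R M] [Module.Finite R M] :
    Module.supportDim T (T ⊗[R] M) ≤ Module.supportDim R M := by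
  rw [Module.supportDim_eq_ringKrullDim_quotient_annihilator,
    Module.supportDim_eq_ringKrullDim_quotient_annihilator]
  refine ringKrullDim_quot_le_of_isAdicComplete I hsurj fun r hr => ?_
  rw [Ideal.mem_comap, Module.mem_annihilator]
  intro z
  induction z with
  | zero => exact smul_zero _
  | add x y hx hy => rw [smul_add, hx, hy, add_zero]
  | tmul t m =>
    rw [algebraMap_smul, ← TensorProduct.tmul_smul, Module.mem_annihilator.1 hr,
      TensorProduct.tmul_zero]

omit [IsNoetherianRing R] in
lemma isSemisimpleRing_quot_map [IsSemisimpleRing (R ⧸ I)]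
    (hsurj : ∀ t : T, ∃ r : R, t - algebraMap R T r ∈ I.map (algebraMap R T)) :
    IsSemisimpleRing (T ⧸ I.map (algebraMap R T)) := by
  refine RingHom.isSemisimpleRing_of_surjective
    (Ideal.quotientMap (I.map (algebraMap R T)) (algebraMap R T) Ideal.le_comap_map) fun t => ?_
  obtain ⟨t, rfl⟩ := Ideal.Quotient.mk_surjective t
  obtain ⟨r, hr⟩ := hsurj t
  exact ⟨Ideal.Quotient.mk I r, ((Ideal.Quotient.mk_eq_mk_iff_sub_mem _ _).2 hr).symm⟩

lemma adicCompletion_exists_sub_mem (t : AdicCompletion I R) :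
    ∃ r : R, t - algebraMap R _ r ∈ I.map (algebraMap R (AdicCompletion I R)) := by
  obtain ⟨r, hr⟩ := Ideal.Quotient.mk_surjective (AdicCompletion.evalOneₐ I t)
  refine ⟨r, ?_⟩
  rw [← AdicCompletion.ker_evalOneₐ_eq_map I (IsNoetherian.noetherian I), RingHom.mem_ker, map_sub,
    sub_eq_zero]
  exact hr.symm

lemma isAdicComplete_adicCompletion :
    IsAdicComplete (I.map (algebraMap R (AdicCompletion I R))) (AdicCompletion I R) :=
  AdicCompletion.isAdicComplete_self I (IsNoetherian.noetherian I)

/-- If `H^d_{aT}(M ⊗ T) ≠ 0`, where `T` is the `I`-adic completion of `R` and `R / I` is semisimple,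
then `aT + q` is zero-dimensional for some `q` in `Assh_T(M ⊗ T)`. -/
theorem exists_mem_Assh_tensor [IsSemisimpleRing (R ⧸ I)] (b : Ideal (AdicCompletion I R)) (d : ℕ)
    (M : Type) [AddCommGroup M] [Module R M] [Module.Finite R M]
    (hd : Module.supportDim R M ≤ d)
    (h : Nontrivial (H b d (AdicCompletion I R ⊗[R] M))) :
    ∃ q ∈ Assh (AdicCompletion I R) (AdicCompletion I R ⊗[R] M),
      ringKrullDim (AdicCompletion I R ⧸ (b ⊔ q)) ≤ 0 := by
  have hsurj := adicCompletion_exists_sub_mem I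
  have := isAdicComplete_adicCompletion I
  have := isNoetherianRing_of_isAdicComplete I hsurj
  have := isSemisimpleRing_quot_map I hsurj
  have hd' := (supportDim_tensor_le_of_isAdicComplete I hsurj M).trans hd
  obtain ⟨q, hq, hqd, hq0⟩ := exists_ringKrullDim_quot_le_zero
    (I.map (algebraMap R (AdicCompletion I R))) b d _ hd' h
  refine ⟨q, ⟨hq, ?_⟩, hq0⟩
  rw [← Module.supportDim_quotient_eq_ringKrullDim]
  refine le_antisymm ?_ (hqd ▸ hd')
  have hqp := hq.isPrime
  refine supportDim_quot_le (p := ⟨q, hqp⟩) ?_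
  rw [Module.mem_support_iff_of_finite, ← Submodule.annihilator_top]
  exact IsAssociatedPrime.annihilator_le hq

end dimension

end
end LH

namespace LH

noncomputable section

section restrict

lemma subsingleton_zero_iff {R : Type} [CommRing R] (a : Ideal R) (N : Type) [AddCommGroup N]
    [Module R N] : Subsingleton (H a 0 N) ↔ tors a N = ⊥ := by
  have h : LinearMap.range (ev a (ModuleCat.of R N)) = tors a N := ev_range a _
  rw [← h, LinearMap.range_eq_bot]
  constructor
  · intro _
    ext z
    rw [Subsingleton.elim z 0, map_zero, map_zero]
  · intro h0
    exact ⟨fun x y => ev_injective a _ (by rw [h0]; rfl)⟩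

variable {R : Type} [CommRing R] {M N P : Type} [AddCommGroup M] [Module R M] [AddCommGroup N]
  [Module R N] [AddCommGroup P] [Module R P] (a : Ideal R) {f : M →ₗ[R] N} {g : N →ₗ[R] P}

lemma exists_mem_tors_of_subsingleton [Subsingleton (H a 1 M)] (hf : Function.Injective f)
    (hg : Function.Surjective g) (hfg : Function.Exact f g) {x : P} (hx : x ∈ tors a P) :
    ∃ w ∈ tors a N, g w = x := by
  obtain ⟨δ, h1, -⟩ := exists_connecting a 0 hf hg hfg
  have hx' : x ∈ LinearMap.range (ev a (ModuleCat.of R P)) := by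
    rw [ev_range]; exact hx
  obtain ⟨z, rfl⟩ := hx'
  obtain ⟨y, rfl⟩ := (h1 z).1 (Subsingleton.elim _ _)
  refine ⟨ev a (ModuleCat.of R N) y, ?_, (ev_post a (ModuleCat.ofHom g) y).symm⟩
  have := LinearMap.mem_range_self (ev a (ModuleCat.of R N)) y
  rw [ev_range] at this
  exact this

lemma subsingleton_of_exists_mem_tors [Subsingleton (H a 1 N)] (hf : Function.Injective f)
    (hg : Function.Surjective g) (hfg : Function.Exact f g)
    (h : ∀ x ∈ tors a P, ∃ w ∈ tors a N, g w = x) : Subsingleton (H a 1 M) := by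
  obtain ⟨δ, h1, h2⟩ := exists_connecting a 0 hf hg hfg
  rw [subsingleton_iff_forall_eq 0]
  intro z
  obtain ⟨y, rfl⟩ := (h2 z).1 (Subsingleton.elim _ _)
  rw [h1]
  have hy := LinearMap.mem_range_self (ev a (ModuleCat.of R P)) y
  rw [ev_range] at hy
  obtain ⟨w, hw, hwy⟩ := h _ hy
  have hwr : w ∈ LinearMap.range (ev a (ModuleCat.of R N)) := by
    rw [ev_range]; exact hw
  obtain ⟨v, rfl⟩ := hwr
  exact ⟨v, ev_injective a _ ((ev_post a (ModuleCat.ofHom g) v).trans hwy)⟩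

variable {T : Type} [CommRing T] [Algebra R T]

lemma mem_tors_map {N : Type} [AddCommGroup N] [Module R N] [Module T N] [IsScalarTower R T N]
    {x : N} : x ∈ tors (a.map (algebraMap R T)) N ↔ x ∈ tors a N := by
  rw [mem_tors, mem_tors]
  refine exists_congr fun n => ?_
  rw [← Ideal.map_pow]
  constructor
  · intro h r hr
    rw [← algebraMap_smul T]
    exact h _ (Ideal.mem_map_of_mem _ hr)
  · intro h
    have : (a ^ n).map (algebraMap R T) ≤ Ideal.torsionOf T N x := by
      rw [Ideal.map_le_iff_le_comap]
      intro r hr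
      rw [Ideal.mem_comap, Ideal.mem_torsionOf_iff, algebraMap_smul]
      exact h r hr
    exact fun t ht => this ht

lemma injective_restrict [Module.Flat R T] (E : Type) [AddCommGroup E] [Module R E] [Module T E]
    [IsScalarTower R T E] [hE : Module.Injective T E] : Module.Injective R E := by
  refine ⟨fun X Y _ _ _ _ f hf g => ?_⟩
  obtain ⟨h, hh⟩ := hE.out (AlgebraTensorModule.lTensor T T f)
    (Module.Flat.lTensor_preserves_injective_linearMap f hf) (LinearMap.liftBaseChange T g)
  refine ⟨(h.restrictScalars R).comp (TensorProduct.mk R T Y 1), fun x => ?_⟩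
  have := hh (1 ⊗ₜ x)
  simpa using this

theorem subsingleton_restrict [Module.Flat R T] (i : ℕ) (N : Type) [AddCommGroup N] [Module R N]
    [Module T N] [IsScalarTower R T N] (h : Subsingleton (H (a.map (algebraMap R T)) i N)) :
    Subsingleton (H a i N) := by
  induction i generalizing N with
  | zero =>
    rw [subsingleton_zero_iff] at h ⊢
    rw [eq_bot_iff] at h ⊢
    exact fun x hx => h ((mem_tors_map a).2 hx)
  | succ i ih =>
    obtain ⟨E, _, _, hE, ι, hι⟩ := exists_injective_embedding T N
    let _ : Module R E := Module.compHom E (algebraMap R T)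
    have : IsScalarTower R T E := ⟨fun r t x => by
      rw [Algebra.smul_def, mul_smul]; rfl⟩
    have hE' := injective_restrict (R := R) (T := T) E
    have : Injective (ModuleCat.of R E) := Module.injective_object_of_injective_module R _
    have : Injective (ModuleCat.of T E) := Module.injective_object_of_injective_module T _
    let g := (LinearMap.range ι).mkQ
    have hg : Function.Surjective g := Submodule.mkQ_surjective _
    have hfg : Function.Exact ι g := LinearMap.exact_map_mkQ_range ι
    have hι' : Function.Injective (ι.restrictScalars R) := hι
    have hg' : Function.Surjective (g.restrictScalars R) := hg
    have hfg' : Function.Exact (ι.restrictScalars R) (g.restrictScalars R) := hfg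
    have h1 (j) : Subsingleton (H a (j + 1) E) :=
      LC.subsingleton_of_injective a j (ModuleCat.of R E)
    have h2 (j) : Subsingleton (H (a.map (algebraMap R T)) (j + 1) E) :=
      LC.subsingleton_of_injective _ j (ModuleCat.of T E)
    cases i with
    | zero =>
      refine subsingleton_of_exists_mem_tors a hι' hg' hfg' fun x hx => ?_
      obtain ⟨w, hw, hwx⟩ := exists_mem_tors_of_subsingleton _ hι hg hfg
        ((mem_tors_map (T := T) a).2 hx)
      exact ⟨w, (mem_tors_map a).1 hw, hwx⟩
    | succ i =>
      have := ih (E ⧸ LinearMap.range ι) (subsingleton_of_exact_right _ (i + 1) hι hg hfg)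
      exact subsingleton_of_exact_left a (i + 1) hι' hg' hfg'

end restrict

end
end LH

namespace LH

noncomputable section

section separated

variable {R : Type} [CommRing R] [IsNoetherianRing R]

lemma exists_universal_ext (d : ℕ) (A : Type) [AddCommGroup A] [Module R A] [Module.Finite R A] :
    ∃ (B : Type) (_ : AddCommGroup B) (_ : Module R B) (_ : Module.Finite R B)
      (ξ : Abelian.Ext (ModuleCat.of R A) (ModuleCat.of R B) d),
      ∀ (M : ModuleCat.{0} R) (x : Abelian.Ext (ModuleCat.of R A) M d),
        ∃ f : ModuleCat.of R B ⟶ M, ξ.comp (Abelian.Ext.mk₀ f) (add_zero d) = x := by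
  induction d generalizing A with
  | zero =>
    refine ⟨A, _, _, ‹_›, Abelian.Ext.mk₀ (𝟙 _), fun M x => ?_⟩
    obtain ⟨f, rfl⟩ := (Abelian.Ext.mk₀_bijective _ _).2 x
    exact ⟨f, Abelian.Ext.mk₀_id_comp _⟩
  | succ d ih =>
    obtain ⟨n, p, hp⟩ := Module.Finite.exists_fin' R A
    have hS := shortExact (LinearMap.ker p).subtype_injective hp (LinearMap.exact_subtype_ker_map p)
    obtain ⟨B, _, _, hB, ξ, hξ⟩ := ih (LinearMap.ker p)
    refine ⟨B, _, _, hB, hS.extClass.comp ξ (add_comm 1 d), fun M x => ?_⟩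
    have : Projective (ModuleCat.of R (Fin n → R)) :=
      ModuleCat.projective_of_categoryTheory_projective _
    obtain ⟨y, rfl⟩ := Abelian.Ext.contravariant_sequence_exact₃ hS M x
      (Abelian.Ext.eq_zero_of_projective _) (add_comm 1 d)
    obtain ⟨f, rfl⟩ := hξ M y
    exact ⟨f, Abelian.Ext.comp_assoc _ _ _ _ _ (by lia)⟩

lemma exists_smul_eq_of_hom (I : Ideal R) {B M : Type} [AddCommGroup B] [Module R B]
    [Module.Finite R B] [AddCommGroup M] [Module R M] [Module.Finite R M] {E : Type*}
    [AddCommGroup E] [Module R E] (Φ : (B →ₗ[R] M) →ₗ[R] E) (hΦ : Function.Surjective Φ) (x : E)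
    (h : ∀ k, ∃ f, Φ f = x ∧ ∀ b, f b ∈ (I ^ k • ⊤ : Submodule R M)) : ∃ r ∈ I, r • x = x := by
  obtain ⟨n, p, hp⟩ := Module.Finite.exists_fin' R B
  let ι : (B →ₗ[R] M) →ₗ[R] (Fin n → M) :=
    { toFun f i := f (p (Pi.single i 1))
      map_add' _ _ := rfl
      map_smul' _ _ := rfl }
  have hι : Function.Injective ι := by
    intro f g hfg
    have : f.comp p = g.comp p := by
      refine LinearMap.pi_ext' fun i => LinearMap.ext_ring ?_
      exact congrFun hfg i
    ext b
    obtain ⟨y, rfl⟩ := hp b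
    exact LinearMap.congr_fun this y
  have : IsNoetherian R (B →ₗ[R] M) := isNoetherian_of_injective ι hι
  have : Module.Finite R E := Module.Finite.of_surjective Φ hΦ
  have key : ∀ j (f : B →ₗ[R] M), ι f ∈ (I ^ j • LinearMap.range ι) →
      Φ f ∈ (I ^ j • ⊤ : Submodule R E) := by
    intro j f hf
    rw [LinearMap.range_eq_map, ← Submodule.map_smul''] at hf
    obtain ⟨g, hg, hgf⟩ := hf
    rw [← hι hgf]
    have := Submodule.mem_map_of_mem (f := Φ) hg
    rw [Submodule.map_smul''] at this
    exact Submodule.smul_mono le_rfl le_top this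
  obtain ⟨c, hc⟩ := Ideal.exists_pow_inf_eq_pow_smul I (LinearMap.range ι)
  have hx : x ∈ (⨅ j : ℕ, I ^ j • ⊤ : Submodule R E) := by
    rw [Submodule.mem_iInf]
    intro j
    obtain ⟨f, rfl, hf⟩ := h (j + c)
    refine key j f ?_
    have h1 : ι f ∈ (I ^ (j + c) • ⊤ ⊓ LinearMap.range ι) := by
      refine ⟨?_, f, rfl⟩
      have : ∀ i, (Pi.single i (ι f i) : Fin n → M) ∈
          (I ^ (j + c) • ⊤ : Submodule R (Fin n → M)) := by
        intro i
        have := Submodule.mem_map_of_mem (f := LinearMap.single R (fun _ : Fin n => M) i)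
          (hf (p (Pi.single i 1)))
        rw [Submodule.map_smul''] at this
        exact Submodule.smul_mono le_rfl le_top this
      rw [← Finset.univ_sum_single (ι f)]
      exact sum_mem fun i _ => this i
    rw [hc _ (Nat.le_add_left c j), Nat.add_sub_cancel] at h1
    exact Submodule.smul_mono le_rfl inf_le_right h1
  obtain ⟨r, hr⟩ := (Ideal.mem_iInf_smul_pow_eq_bot_iff I x).1 hx
  exact ⟨r, r.2, hr⟩

lemma exists_smul_eq_of_hmap_eq_zero (a I : Ideal R) (d : ℕ) {M W : Type} [AddCommGroup M]
    [Module R M] [Module.Finite R M] [AddCommGroup W] [Module R W] (φ : M →ₗ[R] W)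
    (hφ : ∀ k, ∃ π : W →ₗ[R] M ⧸ (I ^ k • ⊤ : Submodule R M), π.comp φ = Submodule.mkQ _)
    (z : H a d M) (hz : hmap a d φ z = 0) : ∃ r ∈ I, r • z = z := by
  obtain ⟨n, x, rfl, hx⟩ := LC.exists_of_comp_eq_zero a _ _ _ _ z hz
  obtain ⟨B, _, _, _, ξ, hξ⟩ := exists_universal_ext (R := R) d (R ⧸ a ^ n)
  let Φ : (B →ₗ[R] M) →ₗ[R] Abelian.Ext (quo a n) (ModuleCat.of R M) d :=
    { toFun f := ξ.comp (Abelian.Ext.mk₀ (ModuleCat.ofHom f)) (add_zero d)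
      map_add' f g := by
        rw [ModuleCat.ofHom_add, Abelian.Ext.mk₀_add, Abelian.Ext.comp_add]
      map_smul' r f := by
        rw [RingHom.id_apply, ← Abelian.Ext.comp_smul, ← Abelian.Ext.mk₀_smul]; rfl }
  have hΦ : Function.Surjective Φ := fun y => by
    obtain ⟨f, hf⟩ := hξ _ y
    exact ⟨f.hom, hf⟩
  suffices ∃ r ∈ I, r • x = x by
    obtain ⟨r, hr, hrx⟩ := this
    exact ⟨r, hr, by rw [← map_smul, hrx]⟩
  refine exists_smul_eq_of_hom I Φ hΦ x fun k => ?_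
  obtain ⟨π, hπ⟩ := hφ k
  have hS := shortExact (I ^ k • ⊤ : Submodule R M).subtype_injective
    (Submodule.mkQ_surjective _) (LinearMap.exact_subtype_mkQ (I ^ k • ⊤ : Submodule R M))
  obtain ⟨y, hy⟩ := Abelian.Ext.covariant_sequence_exact₂ _ hS x (by
    have : ModuleCat.ofHom (Submodule.mkQ (I ^ k • ⊤ : Submodule R M)) =
      ModuleCat.ofHom φ ≫ ModuleCat.ofHom π := by rw [← hπ]; rfl
    change x.comp (Abelian.Ext.mk₀ (ModuleCat.ofHom (Submodule.mkQ _))) _ = 0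
    rw [this, ← Abelian.Ext.mk₀_comp_mk₀, ← Abelian.Ext.comp_assoc _ _ _ (add_zero d) _ (by lia),
      hx, Abelian.Ext.zero_comp])
  obtain ⟨f, rfl⟩ := hξ _ y
  refine ⟨(Submodule.subtype _).comp f.hom, ?_, fun b => (f.hom b).2⟩
  rw [← hy, Abelian.Ext.comp_assoc _ _ _ _ (add_zero 0) (by lia), Abelian.Ext.mk₀_comp_mk₀]
  rfl

theorem subsingleton_of_subsingleton_tensor (a I : Ideal R) (d : ℕ) {M : Type} [AddCommGroup M]
    [Module R M] [Module.Finite R M] [IsArtinian R (H a d M)] (hI : I ≤ radSupp R (H a d M))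
    [h : Subsingleton (H a d (AdicCompletion I R ⊗[R] M))] : Subsingleton (H a d M) := by
  rw [← Module.support_eq_empty_iff (R := R), Set.eq_empty_iff_forall_notMem]
  intro p hp
  obtain ⟨z, hz, hpz⟩ := exists_ann_of_mem_support p hp
  obtain ⟨r, hr, hrz⟩ := exists_smul_eq_of_hmap_eq_zero a I d
    (TensorProduct.mk R (AdicCompletion I R) M 1) (fun k => by
      refine ⟨(TensorProduct.quotTensorEquivQuotSMul M (I ^ k)).toLinearMap.comp
        ((AdicCompletion.evalₐ I k).toLinearMap.restrictScalars R |>.rTensor M), ?_⟩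
      ext x
      simp) z
    (Subsingleton.elim _ _)
  exact hz (hrz.symm.trans (hpz r (radSupp_le p hp (hI hr))))

end separated

end
end LH

namespace LH

noncomputable section

section transport

variable {R : Type} [CommRing R] {X Y : Type} [AddCommGroup X] [Module R X] [AddCommGroup Y]
  [Module R Y]

lemma map_stab (e : X ≃ₗ[R] Y) (b : Ideal R) (N : Submodule R X) :
    (stab b N).map e.toLinearMap = stab b (N.map e.toLinearMap) := by
  rw [stab, stab]
  refine (map_iInf (Submodule.orderIsoMapComap e) _).trans (iInf_congr fun n => ?_)
  exact Submodule.map_smul'' _ _ _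

lemma map_ann (e : X ≃ₗ[R] Y) (s : Set R) : (ann s X).map e.toLinearMap = ann s Y := by
  ext y
  rw [Submodule.map_equiv_eq_comap_symm, Submodule.mem_comap, mem_ann, mem_ann]
  refine forall₂_congr fun r _ => ?_
  rw [LinearEquiv.coe_coe, ← map_smul, LinearEquiv.map_eq_zero_iff]

lemma iSup_stab_ann_eq_top (e : X ≃ₗ[R] Y) (b : Ideal R) (s : ℕ → Set R)
    (h : ⨆ n, stab b (ann (s n) X) = ⊤) : ⨆ n, stab b (ann (s n) Y) = ⊤ := by
  have := congrArg (Submodule.map e.toLinearMap) h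
  rw [Submodule.map_iSup, Submodule.map_top, LinearEquiv.range] at this
  simpa only [map_stab, map_ann] using this

lemma radSupp_congr (e : X ≃ₗ[R] Y) : radSupp R X = radSupp R Y := by
  rw [radSupp, radSupp, e.support_eq]

lemma radSupp_eq_top [Subsingleton X] : radSupp R X = ⊤ := by
  rw [radSupp, Module.support_eq_empty_iff.2 ‹_›]
  simp

end transport

lemma subsingleton_top {R : Type} [CommRing R] (d : ℕ) (M : Type) [AddCommGroup M] [Module R M] :
    Subsingleton (H (⊤ : Ideal R) d M) := by
  rw [subsingleton_iff_forall_eq 0]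
  intro z
  obtain ⟨n, hn⟩ := LC.torsion ⊤ d _ z
  have h1 : (1 : R) ∈ (⊤ : Ideal R) ^ n := by
    rw [Ideal.top_pow]; trivial
  rw [← one_smul R z]
  exact hn 1 h1

lemma subsingleton_adicCompletion_top (R : Type) [CommRing R] :
    Subsingleton (AdicCompletion (⊤ : Ideal R) R) := by
  refine ⟨fun x y => AdicCompletion.ext_evalₐ fun n => ?_⟩
  have : Subsingleton (R ⧸ (⊤ : Ideal R) ^ n) := by
    rw [Ideal.top_pow]; infer_instance
  exact Subsingleton.elim _ _

lemma assh_eq_empty_of_subsingleton (R : Type) [CommRing R] (M : Type) [AddCommGroup M]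
    [Module R M] [Subsingleton R] : Assh R M = ∅ := by
  rw [Set.eq_empty_iff_forall_notMem]
  rintro p ⟨hp, -⟩
  exact hp.isPrime.ne_top (Subsingleton.elim _ _)

section vanishing

variable {R : Type} [CommRing R] (a : Ideal R) {M : Type} [AddCommGroup M] [Module R M] {d : ℕ}

lemma iSup_stab_eq_top_of_le {J : Ideal R} (ha : a ≤ J)
    (h : ∀ l : ℕ, ∃ n : ℕ, ann ((a ^ l : Ideal R) : Set R) (TopLC R J d M) ≤
      stab J (ann ((a ^ n : Ideal R) : Set R) (TopLC R J d M))) :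
    ⨆ n : ℕ, stab J (ann ((a ^ n : Ideal R) : Set R) (TopLC R J d M)) = ⊤ := by
  rw [eq_top_iff]
  rintro z -
  obtain ⟨l, hl⟩ := LC.torsion J d _ ((topLCEquiv J d M).symm z)
  obtain ⟨n, hn⟩ := h l
  refine Submodule.mem_iSup_of_mem n (hn (mem_ann.2 fun r hr => ?_))
  have := hl r (Ideal.pow_right_mono ha l hr)
  rwa [← map_smul, LinearEquiv.map_eq_zero_iff] at this

lemma le_radSupp_topLC : a ≤ radSupp R (TopLC R a d M) := by
  rw [← radSupp_congr (topLCEquiv a d M)]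
  exact le_radSupp fun z => LC.torsion a d _ z

variable [IsNoetherianRing R] [Module.Finite R M]

lemma subsingleton_of_iSup_stab_topLC (hd : Module.supportDim R M ≤ d)
    (h : ⨆ n : ℕ, stab (radSupp R (TopLC R a d M)) (ann ((a ^ n : Ideal R) : Set R)
      (TopLC R (radSupp R (TopLC R a d M)) d M)) = ⊤) : Subsingleton (H a d M) := by
  refine subsingleton_of_iSup_stab a (radSupp R (TopLC R a d M)) (le_radSupp_topLC a) d M hd
    (fun z => ?_) (iSup_stab_ann_eq_top (topLCEquiv _ d M).symm _ _ h)
  rw [← radSupp_congr (topLCEquiv a d M)]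
  exact radSupp_torsion z

lemma subsingleton_of_forall_mem_Assh (hd : Module.supportDim R M ≤ d) (I : Ideal R)
    (hI : I = radSupp R (H a d M))
    (h : ∀ q ∈ Assh (AdicCompletion I R) (AdicCompletion I R ⊗[R] M),
      (0 : WithBot ℕ∞) < ringKrullDim (AdicCompletion I R ⧸
        (a.map (algebraMap R (AdicCompletion I R)) ⊔ q))) : Subsingleton (H a d M) := by
  have : IsArtinian R (H a d M) := (cof_top a d M hd).artinian
  have : IsSemisimpleRing (R ⧸ I) := hI ▸ isSemisimpleRing_quot_radSupp
  by_contra hns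
  have : Module.Flat R (AdicCompletion I R) := AdicCompletion.flat_of_isNoetherian I
  have hns' : Nontrivial (H (a.map (algebraMap R (AdicCompletion I R))) d
      (AdicCompletion I R ⊗[R] M)) := by
    rw [← not_subsingleton_iff_nontrivial]
    intro h0
    have := subsingleton_restrict a d (AdicCompletion I R ⊗[R] M) h0
    exact hns (subsingleton_of_subsingleton_tensor a I d hI.le)
  obtain ⟨q, hq, hq0⟩ := exists_mem_Assh_tensor I _ d M hd hns'
  exact (h q hq).not_ge hq0

end vanishing

end
end LH

/-- Lichtenbaum–Hartshorne over general Noetherian rings: with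
`𝔐 = ∩_{m ∈ Supp_R H^d_a(M)} m` and `T` the `𝔐`-adic completion of `R`, the following are
equivalent: (i) `H^d_a(M) = 0`; (ii) `H^d_𝔐(M) = Σₙ ⟨𝔐⟩(0 :_{H^d_𝔐(M)} aⁿ)`;
(iii) for every `l` there is `n` with `(0 :_{H^d_𝔐(M)} a^l) ⊆ ⟨𝔐⟩(0 :_{H^d_𝔐(M)} aⁿ)`;
(iv) `dim T/(aT + p) > 0` for all `p ∈ Assh_T(M ⊗_R T)`;
(v) `cd_R(a, R/p) < d` for all `p ∈ Assh_R M`. -/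
theorem stmt_19 (R : Type) [CommRing R] [IsNoetherianRing R] (a : Ideal R)
    (M : Type) [AddCommGroup M] [Module R M] [Module.Finite R M]
    (d : ℕ) (hd : moduleDim R M = (d : WithBot ℕ∞))
    (𝔐 : Ideal R) (h𝔐 : 𝔐 = ⨅ p ∈ Module.support R (TopLC R a d M), p.asIdeal) :
    (Subsingleton (TopLC R a d M) ↔
      (⨆ n : ℕ, stab 𝔐
        (Submodule.torsionBySet R (TopLC R 𝔐 d M) ((a ^ n : Ideal R) : Set R))) = ⊤) ∧
    (Subsingleton (TopLC R a d M) ↔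
      ∀ l : ℕ, ∃ n : ℕ,
        Submodule.torsionBySet R (TopLC R 𝔐 d M) ((a ^ l : Ideal R) : Set R) ≤
          stab 𝔐 (Submodule.torsionBySet R (TopLC R 𝔐 d M) ((a ^ n : Ideal R) : Set R))) ∧
    (Subsingleton (TopLC R a d M) ↔
      ∀ q ∈ Assh (AdicCompletion 𝔐 R) ((AdicCompletion 𝔐 R) ⊗[R] M),
        (0 : WithBot ℕ∞) < ringKrullDim ((AdicCompletion 𝔐 R) ⧸
          (a.map (algebraMap R (AdicCompletion 𝔐 R)) ⊔ q))) ∧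
    (Subsingleton (TopLC R a d M) ↔
      ∀ p ∈ Assh R M, cohDim R a (R ⧸ p) < (d : WithBot ℕ∞)) := by
  have hd' : Module.supportDim R M ≤ d := hd.le
  have e : Subsingleton (LH.H a d M) ↔ Subsingleton (TopLC R a d M) :=
    (LH.topLCEquiv a d M).toEquiv.subsingleton_congr
  change 𝔐 = LH.radSupp R (TopLC R a d M) at h𝔐
  have htop : Subsingleton (TopLC R a d M) → 𝔐 = ⊤ := fun _ => h𝔐.trans LH.radSupp_eq_top
  have htop' : Subsingleton (TopLC R a d M) → Subsingleton (TopLC R 𝔐 d M) := fun h => by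
    rw [htop h]
    have := LH.subsingleton_top (R := R) d M
    exact (LH.topLCEquiv ⊤ d M).symm.toEquiv.subsingleton
  have h2 : (⨆ n : ℕ, stab 𝔐
      (Submodule.torsionBySet R (TopLC R 𝔐 d M) ((a ^ n : Ideal R) : Set R))) = ⊤ →
      Subsingleton (TopLC R a d M) := fun h => by
    subst h𝔐
    exact e.1 (LH.subsingleton_of_iSup_stab_topLC a hd' h)
  refine ⟨⟨fun h => ?_, h2⟩, ⟨fun h l => ⟨0, ?_⟩, fun h => h2 ?_⟩, ⟨fun h => ?_, fun h => e.1 ?_⟩,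
    e.symm.trans (LH.subsingleton_iff_cohDim a M hd)⟩
  · have := htop' h
    exact Subsingleton.elim _ _
  · have := htop' h
    exact (Subsingleton.elim _ _).le
  · exact LH.iSup_stab_eq_top_of_le a (h𝔐 ▸ LH.le_radSupp_topLC a) h
  · have hT := htop h
    clear h𝔐 htop' h2
    subst hT
    have := LH.subsingleton_adicCompletion_top R
    rw [LH.assh_eq_empty_of_subsingleton]
    exact fun q hq => hq.elim
  · exact LH.subsingleton_of_forall_mem_Assh a hd' 𝔐
      (h𝔐.trans (LH.radSupp_congr (LH.topLCEquiv a d M)).symm) h
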